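/- arXiv:1511.05767 — 2 statements merged into one kernel-verified Lean document; each statement's English description precedes it below -/
import Mathlib

section
/- Let n ≥ 3. The set of maximal subgroups of infinite index of SL(n,ℤ) has cardinality 2^{ℵ₀} (the continuum). -/
/- Common setup: `SL(n,ℤ)`, `SL(n,ℝ)`, the real projective space `ℙ^{n-1}(ℝ)`
with its quotient topology and the projective action, rank-1 unipotent elements
and their attracting points / fixed hyperplanes, metrics compatible with the
topology of `ℙ`, `ε`-neighbourhoods, Schottky systems, profinite density,
maximal subgroups, and lattices in `SL(n,ℝ)`. -/

open Matrix LinearAlgebra.Projectivization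

abbrev SLZ (n : ℕ) := Matrix.SpecialLinearGroup (Fin n) ℤ

abbrev SLR (n : ℕ) := Matrix.SpecialLinearGroup (Fin n) ℝ

/-- The real projective space `ℙ^{n-1}(ℝ)`: the projectivization of `ℝⁿ`. -/
abbrev Proj (n : ℕ) := Projectivization ℝ (Fin n → ℝ)

/-- The quotient topology on `ℙ^{n-1}(ℝ)`. -/
noncomputable instance (n : ℕ) : TopologicalSpace (Proj n) :=
  inferInstanceAs (TopologicalSpace (Quotient _))

/-- The action of `SL(n,ℝ)` on `ℙ^{n-1}(ℝ)` induced by the linear action on `ℝⁿ`. -/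
noncomputable def actR {n : ℕ} (g : SLR n) (x : Proj n) : Proj n :=
  Projectivization.map (Matrix.SpecialLinearGroup.toLin' g).toLinearMap
    (Matrix.SpecialLinearGroup.toLin' g).injective x

/-- The action of `SL(n,ℤ)` on `ℙ^{n-1}(ℝ)` induced by the linear action on `ℝⁿ`. -/
noncomputable def act {n : ℕ} (g : SLZ n) (x : Proj n) : Proj n :=
  actR (Matrix.SpecialLinearGroup.map (Int.castRingHom ℝ) g) x

/-- The real matrix attached to `g ∈ SL(n,ℤ)`. -/
noncomputable def matR {n : ℕ} (g : SLZ n) : Matrix (Fin n) (Fin n) ℝ :=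
  ((Matrix.SpecialLinearGroup.map (Int.castRingHom ℝ)) g : Matrix (Fin n) (Fin n) ℝ)

/-- The subspace `Im(u - I) ⊆ ℝⁿ` (a line when `u` is rank-1 unipotent). -/
noncomputable def lineOf {n : ℕ} (u : SLZ n) : Submodule ℝ (Fin n → ℝ) :=
  LinearMap.range (Matrix.mulVecLin (matR u - 1))

/-- The subspace `ker(u - I) ⊆ ℝⁿ` (a hyperplane when `u` is rank-1 unipotent). -/
noncomputable def hypOf {n : ℕ} (u : SLZ n) : Submodule ℝ (Fin n → ℝ) :=
  LinearMap.ker (Matrix.mulVecLin (matR u - 1))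

/-- The rational matrix attached to `g ∈ SL(n,ℤ)`. -/
noncomputable def matQ {n : ℕ} (g : SLZ n) : Matrix (Fin n) (Fin n) ℚ :=
  ((Matrix.SpecialLinearGroup.map (Int.castRingHom ℚ)) g : Matrix (Fin n) (Fin n) ℚ)

/-- `g - I`, as a `ℚ`-linear endomorphism of `ℚⁿ`. -/
noncomputable def linQ {n : ℕ} (g : SLZ n) : (Fin n → ℚ) →ₗ[ℚ] (Fin n → ℚ) :=
  Matrix.mulVecLin (matQ g - 1)

/-- `u` is a rank-1 unipotent element of `SL(n,ℤ)`: `u - I` is nilpotent of rank one. -/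
def IsR1U {n : ℕ} (u : SLZ n) : Prop :=
  IsNilpotent (linQ u) ∧ Module.finrank ℚ (LinearMap.range (linQ u)) = 1

/-- The point of attraction `p_u` of `u`, as a subset of `ℙ` (a singleton when `u` is a
rank-1 unipotent): the projective points whose representative spans `Im(u - I)`. -/
def attSet {n : ℕ} (u : SLZ n) : Set (Proj n) :=
  {x | x.submodule = lineOf u}

/-- The fixed hyperplane `L_u` of `u`, as a subset of `ℙ`. -/
def fixSet {n : ℕ} (u : SLZ n) : Set (Proj n) :=
  {x | x.submodule ≤ hypOf u}

/-- The subset of `ℙ` corresponding to a linear subspace `W ⊆ ℝⁿ`. -/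
def projSet {n : ℕ} (W : Submodule ℝ (Fin n → ℝ)) : Set (Proj n) :=
  {x | x.submodule ≤ W}

/-- The image `g • W` of a subspace of `ℝⁿ` under `g ∈ SL(n,ℤ)`. -/
noncomputable def actSub {n : ℕ} (g : SLZ n) (W : Submodule ℝ (Fin n → ℝ)) :
    Submodule ℝ (Fin n → ℝ) :=
  Submodule.map (Matrix.mulVecLin (matR g)) W

/-- The image `g • W` of a subspace of `ℝⁿ` under `g ∈ SL(n,ℝ)`. -/
noncomputable def actSubR {n : ℕ} (g : SLR n) (W : Submodule ℝ (Fin n → ℝ)) :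
    Submodule ℝ (Fin n → ℝ) :=
  Submodule.map (Matrix.mulVecLin (g : Matrix (Fin n) (Fin n) ℝ)) W

/-- `d` is a metric on `ℙ^{n-1}(ℝ)` inducing the quotient topology. -/
structure IsCompatMetric {n : ℕ} (d : Proj n → Proj n → ℝ) : Prop where
  self : ∀ x, d x x = 0
  eq_of : ∀ x y, d x y = 0 → x = y
  symm : ∀ x y, d x y = d y x
  triangle : ∀ x y z, d x z ≤ d x y + d y z
  inducing : ∀ s : Set (Proj n), IsOpen s ↔ ∀ x ∈ s, ∃ ε > 0, ∀ y, d x y < ε → y ∈ s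

/-- The distance from a point to a set. -/
noncomputable def setDist {n : ℕ} (d : Proj n → Proj n → ℝ) (x : Proj n)
    (A : Set (Proj n)) : ℝ :=
  sInf (d x '' A)

/-- The open `ε`-neighbourhood `(A)_ε = {x | dist(x, A) < ε}`. -/
def oThick {n : ℕ} (d : Proj n → Proj n → ℝ) (A : Set (Proj n)) (ε : ℝ) : Set (Proj n) :=
  {x | setDist d x A < ε}

/-- The closed `ε`-neighbourhood `[A]_ε = {x | dist(x, A) ≤ ε}`. -/
def cThick {n : ℕ} (d : Proj n → Proj n → ℝ) (A : Set (Proj n)) (ε : ℝ) : Set (Proj n) :=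
  {x | setDist d x A ≤ ε}

/-- The Hausdorff distance between two subsets of `ℙ`. -/
noncomputable def hDist {n : ℕ} (d : Proj n → Proj n → ℝ) (A B : Set (Proj n)) : ℝ :=
  max (sSup ((fun a => setDist d a B) '' A)) (sSup ((fun b => setDist d b A) '' B))

/-- A rational point of `ℙ`: one spanned by a vector of `ℚⁿ`. -/
def RatPoint {n : ℕ} (p : Proj n) : Prop :=
  ∃ v : Fin n → ℚ, p.submodule = Submodule.span ℝ {fun i => ((v i : ℝ))}

/-- A subspace of `ℝⁿ` spanned by vectors of `ℚⁿ`. -/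
def IsRatSubmodule {n : ℕ} (W : Submodule ℝ (Fin n → ℝ)) : Prop :=
  ∃ T : Set (Fin n → ℚ),
    W = Submodule.span ℝ ((fun (v : Fin n → ℚ) (i : Fin n) => ((v i : ℝ))) '' T)

/-- A Schottky system `(S, 𝒜, ℛ)` with respect to the metric `d`: `S` is a nonempty
set of rank-1 unipotents, `𝒜 ⊆ ℛ` are closed, and for each `u ∈ S` there are
`δ_u ≥ ε_u > 0` satisfying the ping-pong conditions. -/
structure IsSchottky {n : ℕ} (d : Proj n → Proj n → ℝ) (S : Set (SLZ n))
    (A R : Set (Proj n)) : Prop where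
  nonempty : S.Nonempty
  unip : ∀ u ∈ S, IsR1U u
  AsubR : A ⊆ R
  closedA : IsClosed A
  closedR : IsClosed R
  cond : ∃ ε δ : SLZ n → ℝ, (∀ u ∈ S, 0 < ε u ∧ ε u ≤ δ u) ∧
    (∀ u ∈ S, ∀ k : ℤ, k ≠ 0 → ∀ x, x ∉ oThick d (fixSet u) (δ u) →
      act (u ^ k) x ∈ oThick d (attSet u) (ε u)) ∧
    (∀ u ∈ S, ∀ v ∈ S, u ≠ v → oThick d (attSet u) (ε u) ∩ oThick d (fixSet v) (δ v) = ∅) ∧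
    (∀ u ∈ S, oThick d (attSet u) (ε u) ⊆ A) ∧
    (∀ u ∈ S, oThick d (fixSet u) (δ u) ⊆ R)

/-- `H` is profinitely dense in `G`: `HN = G` for every finite-index normal `N ⊴ G`. -/
def ProfinitelyDense {G : Type*} [Group G] (H : Subgroup G) : Prop :=
  ∀ N : Subgroup G, N.Normal → N.FiniteIndex → H ⊔ N = ⊤

/-- `M` is a maximal (proper) subgroup of `G`. -/
def IsMaxSubgroup {G : Type*} [Group G] (M : Subgroup G) : Prop :=
  M ≠ ⊤ ∧ ∀ K : Subgroup G, M < K → K = ⊤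

noncomputable instance (n : ℕ) : TopologicalSpace (SLR n) :=
  inferInstanceAs (TopologicalSpace {A : Matrix (Fin n) (Fin n) ℝ // A.det = 1})

noncomputable instance (n : ℕ) : MeasurableSpace (SLR n) := borel _

/-- `Γ ≤ SL(n,ℝ)` is a lattice: a discrete subgroup admitting a Borel fundamental
domain of finite Haar measure. -/
def IsLatticeIn {n : ℕ} (Γ : Subgroup (SLR n)) : Prop :=
  DiscreteTopology Γ ∧
  ∃ μ : MeasureTheory.Measure (SLR n), μ.IsHaarMeasure ∧
    ∃ D : Set (SLR n), MeasurableSet D ∧ μ D < ⊤ ∧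
      ∀ g : SLR n, ∃! γ : Γ, (γ : SLR n)⁻¹ * g ∈ D

namespace MaximalSubgroups

section Transvections

variable {n : ℕ}

/-- The transvection `x ↦ x + (w ⬝ᵥ x) • v`, for `w ⬝ᵥ v = 0`. -/
def transv (v w : Fin n → ℤ) (h : w ⬝ᵥ v = 0) : SLZ n :=
  ⟨1 + vecMulVec v w, by
    rw [vecMulVec_eq Unit, det_one_add_replicateCol_mul_replicateRow, h, add_zero]⟩

theorem smul_eq_mulVec (g : SLZ n) (x : Fin n → ℤ) : g • x = g.1 *ᵥ x := rfl

theorem transv_smul {v w : Fin n → ℤ} (h : w ⬝ᵥ v = 0) (x : Fin n → ℤ) :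
    transv v w h • x = x + (w ⬝ᵥ x) • v := by
  rw [smul_eq_mulVec, transv, add_mulVec, one_mulVec, vecMulVec_mulVec]
  simp

theorem ext_smul {g g' : SLZ n} (h : ∀ x : Fin n → ℤ, g • x = g' • x) : g = g' := by
  apply Subtype.ext
  apply Matrix.ext_of_mulVec_single
  intro i
  exact h (Pi.single i 1)

theorem transv_add_left {v v' w : Fin n → ℤ} (h : w ⬝ᵥ v = 0) (h' : w ⬝ᵥ v' = 0)
    (h'' : w ⬝ᵥ (v + v') = 0) :
    transv (v + v') w h'' = transv v w h * transv v' w h' := by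
  refine ext_smul fun x => ?_
  simp only [mul_smul, transv_smul, dotProduct_add, dotProduct_smul, h']
  module

theorem transv_add_right {v w w' : Fin n → ℤ} (h : w ⬝ᵥ v = 0) (h' : w' ⬝ᵥ v = 0)
    (h'' : (w + w') ⬝ᵥ v = 0) :
    transv v (w + w') h'' = transv v w h * transv v w' h' := by
  refine ext_smul fun x => ?_
  simp only [mul_smul, transv_smul, dotProduct_add, dotProduct_smul, add_dotProduct, h]
  module

theorem transv_inv {v w : Fin n → ℤ} (h : w ⬝ᵥ v = 0) (h' : (-w) ⬝ᵥ v = 0) :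
    (transv v w h)⁻¹ = transv v (-w) h' := by
  rw [inv_eq_iff_mul_eq_one]
  refine ext_smul fun x => ?_
  simp only [mul_smul, transv_smul, dotProduct_add, dotProduct_smul, neg_dotProduct, h, one_smul]
  module

theorem transv_zpow {v w : Fin n → ℤ} (h : w ⬝ᵥ v = 0) (k : ℤ) (h' : (k • w) ⬝ᵥ v = 0) :
    transv v w h ^ k = transv v (k • w) h' := by
  induction k with
  | zero => refine ext_smul fun x => ?_; simp [transv_smul]
  | succ k ih =>
    rw [_root_.zpow_add, zpow_one, ih (by rw [smul_dotProduct, h, smul_zero])]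
    refine ext_smul fun x => ?_
    simp only [mul_smul, transv_smul, dotProduct_add, dotProduct_smul, smul_dotProduct, h]
    module
  | pred k ih =>
    rw [_root_.zpow_sub, zpow_one, ih (by rw [smul_dotProduct, h, smul_zero]),
      transv_inv h (by simp [h])]
    refine ext_smul fun x => ?_
    simp only [mul_smul, transv_smul, dotProduct_add, dotProduct_smul, smul_dotProduct,
      neg_dotProduct, h]
    module

theorem vecMul_dotProduct_smul (g : SLZ n) (w x : Fin n → ℤ) :
    (w ᵥ* (g⁻¹ : SLZ n).1) ⬝ᵥ (g • x) = w ⬝ᵥ x := by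
  rw [← dotProduct_mulVec, ← smul_eq_mulVec, inv_smul_smul]

theorem conj_transv (g : SLZ n) {v w : Fin n → ℤ} (h : w ⬝ᵥ v = 0)
    (h' : (w ᵥ* (g⁻¹ : SLZ n).1) ⬝ᵥ (g • v) = 0) :
    g * transv v w h * g⁻¹ = transv (g • v) (w ᵥ* (g⁻¹ : SLZ n).1) h' := by
  refine ext_smul fun x => ?_
  obtain ⟨y, rfl⟩ := MulAction.surjective g x
  beta_reduce
  rw [transv_smul, vecMul_dotProduct_smul, mul_smul, mul_smul, inv_smul_smul, transv_smul,
    smul_add, smul_comm]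

/-- The subgroup `L` contains the transvection along `v` with linear form `w`. -/
def HasTransv (L : Subgroup (SLZ n)) (v w : Fin n → ℤ) : Prop :=
  ∃ h : w ⬝ᵥ v = 0, transv v w h ∈ L

namespace HasTransv

variable {L : Subgroup (SLZ n)} {v v' w w' : Fin n → ℤ}

theorem zero_left : HasTransv L 0 w := by
  refine ⟨by simp, ?_⟩
  convert one_mem L
  exact ext_smul fun x => by simp [transv_smul]

theorem zero_right : HasTransv L v 0 := by
  refine ⟨by simp, ?_⟩
  convert one_mem L
  exact ext_smul fun x => by simp [transv_smul]

theorem add_left (h : HasTransv L v w) (h' : HasTransv L v' w) : HasTransv L (v + v') w := by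
  obtain ⟨h, hL⟩ := h
  obtain ⟨h', hL'⟩ := h'
  refine ⟨by rw [dotProduct_add, h, h', add_zero], ?_⟩
  rw [transv_add_left h h']
  exact mul_mem hL hL'

theorem add_right (h : HasTransv L v w) (h' : HasTransv L v w') : HasTransv L v (w + w') := by
  obtain ⟨h, hL⟩ := h
  obtain ⟨h', hL'⟩ := h'
  refine ⟨by rw [add_dotProduct, h, h', add_zero], ?_⟩
  rw [transv_add_right h h']
  exact mul_mem hL hL'

theorem zsmul_right (k : ℤ) (h : HasTransv L v w) : HasTransv L v (k • w) := by
  obtain ⟨h, hL⟩ := h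
  refine ⟨by rw [smul_dotProduct, h, smul_zero], ?_⟩
  rw [← transv_zpow h]
  exact zpow_mem hL k

theorem zsmul_left_iff (k : ℤ) : HasTransv L (k • v) w ↔ HasTransv L v (k • w) := by
  have key : ∀ (h : w ⬝ᵥ (k • v) = 0) (h' : (k • w) ⬝ᵥ v = 0),
      transv (k • v) w h = transv v (k • w) h' := fun h h' => ext_smul fun x => by
    simp only [transv_smul, smul_dotProduct]
    module
  have e : w ⬝ᵥ (k • v) = (k • w) ⬝ᵥ v := by rw [smul_dotProduct, dotProduct_smul]
  constructor
  · rintro ⟨h, hL⟩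
    exact ⟨e ▸ h, key h (e ▸ h) ▸ hL⟩
  · rintro ⟨h, hL⟩
    exact ⟨e ▸ h, (key (e ▸ h) h).symm ▸ hL⟩

theorem sum_left {κ : Type*} {s : Finset κ} {f : κ → Fin n → ℤ}
    (h : ∀ a ∈ s, HasTransv L (f a) w) : HasTransv L (∑ a ∈ s, f a) w :=
  Finset.sum_induction f (fun v => HasTransv L v w) (fun _ _ => add_left) zero_left h

theorem sum_right {κ : Type*} {s : Finset κ} {f : κ → Fin n → ℤ}
    (h : ∀ a ∈ s, HasTransv L v (f a)) : HasTransv L v (∑ a ∈ s, f a) :=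
  Finset.sum_induction f (fun w => HasTransv L v w) (fun _ _ => add_right) zero_right h

theorem commutator (h : HasTransv L v w) (h' : HasTransv L v' w') (h0 : w' ⬝ᵥ v = 0) :
    HasTransv L v ((w ⬝ᵥ v') • w') := by
  obtain ⟨h, hL⟩ := h
  obtain ⟨h', hL'⟩ := h'
  refine ⟨by rw [smul_dotProduct, h0, smul_zero], ?_⟩
  convert mul_mem (mul_mem (mul_mem hL hL') (inv_mem hL)) (inv_mem hL') using 1
  rw [transv_inv h (by simp [h]), transv_inv h' (by simp [h'])]
  refine ext_smul fun x => ?_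
  simp only [mul_smul, transv_smul, dotProduct_add, dotProduct_smul, smul_dotProduct,
    neg_dotProduct, h, h', h0]
  module

theorem of_conj {g : SLZ n} (h : HasTransv (L.comap (MulAut.conj g).toMonoidHom) v w) :
    HasTransv L (g • v) (w ᵥ* (g⁻¹ : SLZ n).1) := by
  obtain ⟨h, hL⟩ := h
  refine ⟨by rw [vecMul_dotProduct_smul, h], ?_⟩
  rw [← conj_transv g h]
  exact hL

end HasTransv

/-- `L` contains the `m`-th power of every transvection along a unimodular vector. -/
def HasCongruenceTransv (L : Subgroup (SLZ n)) (m : ℤ) : Prop :=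
  ∀ u v w : Fin n → ℤ, u ⬝ᵥ v = 1 → w ⬝ᵥ v = 0 → HasTransv L v (m • w)

theorem HasCongruenceTransv.of_conj {L : Subgroup (SLZ n)} {m : ℤ} {g : SLZ n}
    (h : HasCongruenceTransv (L.comap (MulAut.conj g).toMonoidHom) m) :
    HasCongruenceTransv L m := by
  intro u v w huv hwv
  have e : ∀ z : Fin n → ℤ, (z ᵥ* g.1) ⬝ᵥ (g⁻¹ • v) = z ⬝ᵥ v := fun z => by
    simpa using vecMul_dotProduct_smul g⁻¹ z v
  have := (h (u ᵥ* g.1) (g⁻¹ • v) (w ᵥ* g.1) (by rw [e, huv]) (by rw [e, hwv])).of_conj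
  rwa [smul_inv_smul, smul_vecMul, vecMul_vecMul,
    show g.1 * (g⁻¹ : SLZ n).1 = 1 from congrArg Subtype.val (mul_inv_cancel g),
    vecMul_one] at this

theorem exists_hasCongruenceTransv_of_finiteIndex (L : Subgroup (SLZ n)) [L.FiniteIndex] :
    ∃ m : ℕ, m ≠ 0 ∧ HasCongruenceTransv L m := by
  refine ⟨L.normalCore.index, Subgroup.FiniteIndex.index_ne_zero, fun u v w _ hwv => ?_⟩
  refine ⟨by rw [smul_dotProduct, hwv, smul_zero], ?_⟩
  rw [← transv_zpow hwv, zpow_natCast]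
  exact L.normalCore_le (Subgroup.pow_index_mem _ _)

/-- `L` contains the `m`-th powers of all elementary matrices. -/
def HasElementary (L : Subgroup (SLZ n)) (m : ℤ) : Prop :=
  ∀ i j : Fin n, i ≠ j → HasTransv L (Pi.single i 1) (m • Pi.single j 1)

theorem HasElementary.hasTransv_of_disjoint {L : Subgroup (SLZ n)} {m : ℤ}
    (hL : HasElementary L m) {v w : Fin n → ℤ} (h : ∀ i, v i * w i = 0) :
    HasTransv L v (m • w) := by
  have hv : v = ∑ i, v i • Pi.single i (1 : ℤ) := by
    ext j; simp [Finset.sum_apply, Pi.single_apply]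
  have hw : m • w = ∑ j, w j • m • Pi.single j (1 : ℤ) := by
    ext j; simp [Finset.sum_apply, Pi.single_apply, mul_comm]
  rw [hv]
  refine HasTransv.sum_left fun i _ => ?_
  rw [hw]
  refine HasTransv.sum_right fun j _ => ?_
  rw [HasTransv.zsmul_left_iff, smul_smul]
  obtain rfl | hij := eq_or_ne i j
  · rw [h i, zero_smul]
    exact .zero_right
  · exact (hL i j hij).zsmul_right _

theorem HasElementary.hasCongruenceTransv {L : Subgroup (SLZ n)} {m : ℤ} (hn : 3 ≤ n)
    (hL : HasElementary L m) : HasCongruenceTransv L (m ^ 2) := by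
  intro u v w huv hwv
  have hw : w = ∑ i, ∑ j, (w i * u j) • (v j • Pi.single i 1 - v i • Pi.single j (1 : ℤ)) := by
    ext a
    simp only [dotProduct] at huv hwv
    simp only [Finset.sum_apply, Pi.smul_apply, Pi.sub_apply, smul_eq_mul, Pi.single_apply,
      mul_sub, Finset.sum_sub_distrib, mul_ite, mul_one, mul_zero, Finset.sum_ite_irrel,
      Finset.sum_const_zero, Finset.sum_ite_eq, Finset.mem_univ, if_true]
    have h1 : ∑ j, w a * u j * v j = w a := by
      simp only [mul_assoc]
      rw [← Finset.mul_sum, huv, mul_one]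
    have h2 : ∑ i, w i * u a * v i = 0 := by
      rw [← mul_zero (u a), ← hwv, Finset.mul_sum]
      exact Finset.sum_congr rfl fun j _ => by ring
    rw [h1, h2, sub_zero]
  rw [hw, Finset.smul_sum]
  refine HasTransv.sum_right fun i _ => ?_
  rw [Finset.smul_sum]
  refine HasTransv.sum_right fun j _ => ?_
  rw [smul_comm]
  apply HasTransv.zsmul_right
  obtain rfl | hij := eq_or_ne i j
  · rw [sub_self, smul_zero]
    exact .zero_right
  obtain ⟨k, hk⟩ : ∃ k, k ∉ ({i, j} : Finset (Fin n)) := by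
    by_contra! hall
    have := Finset.card_le_card (fun k _ => hall k : (Finset.univ : Finset (Fin n)) ⊆ {i, j})
    have h2 := Finset.card_le_two (a := i) (b := j)
    rw [Finset.card_univ, Fintype.card_fin] at this
    omega
  simp only [Finset.mem_insert, Finset.mem_singleton, not_or] at hk
  set y : Fin n → ℤ := v j • Pi.single i 1 - v i • Pi.single j (1 : ℤ) with hy
  set v' : Fin n → ℤ := v i • Pi.single i 1 + v j • Pi.single j (1 : ℤ) with hv'
  have hyv : y ⬝ᵥ v' = 0 := by
    simp only [hy, hv', sub_dotProduct, dotProduct_add, smul_dotProduct, dotProduct_smul,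
      single_dotProduct, Pi.single_eq_same, Pi.single_eq_of_ne hij, Pi.single_eq_of_ne hij.symm,
      smul_eq_mul]
    ring
  have hsplit : v = v' + (v - v') := by abel
  rw [hsplit]
  apply HasTransv.add_left
  · have h1 : HasTransv L v' (m • Pi.single k 1) := by
      apply hL.hasTransv_of_disjoint
      intro a
      by_cases ha : a = k
      · subst ha; simp [hv', hk.1, hk.2]
      · simp [ha]
    have h2 : HasTransv L (Pi.single k 1) (m • y) := by
      apply hL.hasTransv_of_disjoint
      intro a
      by_cases ha : a = k
      · subst ha; simp [hy, hk.1, hk.2]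
      · simp [ha]
    have h3 := h1.commutator h2 (by rw [smul_dotProduct, hyv, smul_zero])
    rw [smul_dotProduct, single_dotProduct, Pi.single_eq_same, mul_one, smul_smul] at h3
    simpa [sq] using h3
  · rw [sq, mul_smul]
    apply HasTransv.zsmul_right
    apply hL.hasTransv_of_disjoint
    intro a
    by_cases ha : a = i
    · subst ha; simp [hv', hij]
    · by_cases hb : a = j
      · subst hb; simp [hv', hij]
      · simp [hy, ha, hb]

open Fin.NatCast in
theorem hasElementary_of_cyclic [NeZero n] {L : Subgroup (SLZ n)} {m : ℤ}
    (hL : ∀ i : Fin n, HasTransv L (Pi.single i 1) (m • Pi.single (i + 1) 1)) :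
    HasElementary L (m ^ n) := by
  have key : ∀ k : ℕ, k + 1 < n → ∀ i : Fin n,
      HasTransv L (Pi.single i 1) (m ^ (k + 1) • Pi.single (i + ((k + 1 : ℕ) : Fin n)) 1) := by
    intro k
    induction k with
    | zero => intro _ i; simpa using hL i
    | succ k ih =>
      intro hk i
      have h := (ih (by omega) i).commutator (hL (i + ((k + 1 : ℕ) : Fin n))) (by
        have : i ≠ i + ((k + 1 : ℕ) : Fin n) + 1 := by
          rw [add_assoc, ne_comm, Ne, add_eq_left]
          intro h0
          have := congrArg Fin.val h0
          rw [← Nat.cast_one (R := Fin n), ← Nat.cast_add, Fin.val_natCast,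
            Nat.mod_eq_of_lt hk] at this
          simp at this
        rw [smul_dotProduct, single_dotProduct, Pi.single_eq_of_ne this.symm, mul_zero,
          smul_zero])
      rw [smul_dotProduct, single_dotProduct, Pi.single_eq_same, mul_one, smul_smul] at h
      rw [pow_succ, Nat.cast_add (k + 1) 1, Nat.cast_one, ← add_assoc]
      simpa using h
  intro i j hij
  obtain ⟨k, hk⟩ : ∃ k, (j - i).val = k + 1 := by
    refine Nat.exists_eq_succ_of_ne_zero fun h => hij ?_
    rw [Fin.val_eq_zero_iff, sub_eq_zero] at h
    exact h.symm
  have hkn : k + 1 < n := hk ▸ (j - i).isLt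
  have h := (key k hkn i).zsmul_right (m ^ (n - (k + 1)))
  rw [smul_smul, ← pow_add, Nat.sub_add_cancel hkn.le, ← hk, Fin.cast_val_eq_self,
    add_sub_cancel] at h
  exact h

end Transvections

section Generation

variable {n : ℕ}

theorem HasTransv.exists_smul_eq {K : Subgroup (SLZ n)} {x w v z : Fin n → ℤ}
    (h : HasTransv K x w) (hz : ∃ g ∈ K, g • (v + (w ⬝ᵥ v) • x) = z) : ∃ g ∈ K, g • v = z := by
  obtain ⟨h, hK⟩ := h
  obtain ⟨g, hg, rfl⟩ := hz
  exact ⟨g * transv x w h, mul_mem hg hK, by rw [mul_smul, transv_smul]⟩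

theorem exists_smul_eq_single_of_apply_eq_one {K : Subgroup (SLZ n)} {k : Fin n}
    (hK : ∀ x : Fin n → ℤ, x k = 0 → HasTransv K x (Pi.single k 1)) {v : Fin n → ℤ}
    (hv : v k = 1) : ∃ g ∈ K, g • v = Pi.single k 1 := by
  refine (hK (Pi.single k 1 - v) (by simp [hv])).exists_smul_eq ⟨1, one_mem K, ?_⟩
  rw [single_dotProduct, hv, one_smul, one_mul, one_smul, add_sub_cancel]

theorem exists_smul_eq_single_of_apply_sq_eq_one {K : Subgroup (SLZ n)} {k j : Fin n}
    (hK : ∀ i, k ≤ i → ∀ x : Fin n → ℤ, x i = 0 → HasTransv K x (Pi.single i 1))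
    (hkj : k < j) {v : Fin n → ℤ} (hv : v j * v j = 1) : ∃ g ∈ K, g • v = Pi.single k 1 := by
  refine (hK j hkj.le ((v j * (1 - v k)) • Pi.single k 1) (by simp [hkj.ne'])).exists_smul_eq ?_
  apply exists_smul_eq_single_of_apply_eq_one (hK k le_rfl)
  simp only [single_dotProduct, Pi.add_apply, Pi.smul_apply, Pi.single_eq_same, smul_eq_mul]
  linear_combination (1 - v k) * hv

theorem exists_natAbs_add_mul_lt {a b : ℤ} (hb : b ≠ 0) (h : b.natAbs ≤ a.natAbs) :
    ∃ c : ℤ, (a + b * c).natAbs < a.natAbs := by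
  by_cases hab : (a + b).natAbs < a.natAbs
  · exact ⟨1, by simpa using hab⟩
  · exact ⟨-1, by rw [mul_neg, mul_one]; omega⟩

theorem exists_smul_eq_single {K : Subgroup (SLZ n)} {k l : Fin n} (hkl : k < l)
    (hK : ∀ i, k ≤ i → ∀ x : Fin n → ℤ, x i = 0 → HasTransv K x (Pi.single i 1))
    (u v : Fin n → ℤ) (hu : ∀ i < k, u i = 0) (huv : u ⬝ᵥ v = 1) :
    ∃ g ∈ K, g • v = Pi.single k 1 := by
  induction hN : ∑ i ∈ Finset.Ici k, (v i).natAbs using Nat.strong_induction_on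
    generalizing u v with
  | _ N ih =>
  subst hN
  by_cases hex : ∃ i j, k ≤ i ∧ k ≤ j ∧ i ≠ j ∧ v j ≠ 0 ∧ (v j).natAbs ≤ (v i).natAbs
  · obtain ⟨i, j, hi, hj, hij, hvj, hle⟩ := hex
    obtain ⟨c, hc⟩ := exists_natAbs_add_mul_lt hvj hle
    refine (hK j hj (c • Pi.single i 1) (by simp [hij.symm])).exists_smul_eq ?_
    rw [single_dotProduct, one_mul]
    refine ih _ ?_ (u - (u i * c) • Pi.single j 1) _ (fun a ha => ?_) ?_ rfl
    · refine Finset.sum_lt_sum (fun a _ => ?_) ⟨i, Finset.mem_Ici.2 hi, by simpa using hc⟩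
      by_cases ha : a = i
      · subst ha; simpa using hc.le
      · simp [ha]
    · simp [hu a ha, (ha.trans_le hj).ne]
    · have hi' : (u - (u i * c) • Pi.single j 1 : Fin n → ℤ) i = u i := by simp [hij]
      rw [dotProduct_add, dotProduct_smul, dotProduct_smul, dotProduct_single, hi',
        sub_dotProduct, smul_dotProduct, single_dotProduct, huv]
      simp only [smul_eq_mul]
      ring
  · push Not at hex
    obtain ⟨a, -, ha⟩ := Finset.exists_ne_zero_of_sum_ne_zero
      (show ∑ i, u i * v i ≠ 0 by rw [show ∑ i, u i * v i = 1 from huv]; exact one_ne_zero)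
    have hka : k ≤ a := by
      by_contra! h
      simp [hu a h] at ha
    have hz : ∀ i, k ≤ i → i ≠ a → v i = 0 := by
      intro i hi hia
      by_contra h
      have h1 := hex a i hka hi hia.symm h
      have h2 := hex i a hi hka hia (right_ne_zero_of_mul ha)
      omega
    have hva : u a * v a = 1 := by
      rw [← huv, dotProduct, Finset.sum_eq_single a (fun i _ hia => ?_) (by simp)]
      by_cases hi : k ≤ i
      · rw [hz i hi hia, mul_zero]
      · rw [hu i (not_le.1 hi), zero_mul]
    have hsq : v a * v a = 1 := by
      rcases Int.eq_one_or_neg_one_of_mul_eq_one' hva with ⟨-, h⟩ | ⟨-, h⟩ <;> rw [h] <;> rfl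
    obtain rfl | hne := eq_or_ne k a
    · refine (hK k le_rfl (v k • Pi.single l 1) (by simp [hkl.ne])).exists_smul_eq ?_
      apply exists_smul_eq_single_of_apply_sq_eq_one hK hkl
      simp [hz l hkl.le hkl.ne', hsq]
    · exact exists_smul_eq_single_of_apply_sq_eq_one hK (lt_of_le_of_ne hka hne) hsq

theorem ext_smul_single {g g' : SLZ n}
    (h : ∀ i, g • (Pi.single i 1 : Fin n → ℤ) = g' • Pi.single i 1) : g = g' :=
  Subtype.ext (Matrix.ext_of_mulVec_single h)

theorem HasElementary.mem_of_fixes_init {L : Subgroup (SLZ n)} (hL : HasElementary L 1) :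
    ∀ (d k : ℕ), k + d = n → ∀ g : SLZ n,
      (∀ i : Fin n, i.val < k → g • (Pi.single i 1 : Fin n → ℤ) = Pi.single i 1) → g ∈ L := by
  have hdisj : ∀ (i : Fin n) (x : Fin n → ℤ), x i = 0 → HasTransv L x (Pi.single i 1) := by
    intro i x hx
    rw [← one_smul ℤ (Pi.single i 1 : Fin n → ℤ)]
    refine hL.hasTransv_of_disjoint fun a => ?_
    by_cases ha : a = i
    · subst ha; simp [hx]
    · simp [ha]
  intro d
  induction d with
  | zero =>
    intro k hk g hg
    have : g = 1 := ext_smul_single fun i => by rw [hg i (by omega), one_smul]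
    exact this ▸ one_mem L
  | succ d ih =>
    intro k hk g hg
    let k' : Fin n := ⟨k, by omega⟩
    set v : Fin n → ℤ := g • Pi.single k' 1 with hv
    by_cases hd : d = 0
    · have hfix : ∀ i : Fin n, i ≠ k' → g • (Pi.single i 1 : Fin n → ℤ) = Pi.single i 1 :=
        fun i hi => hg i (by have := Fin.val_ne_of_ne hi; simp only [k'] at this; omega)
      have hmat : g.1 = 1 + vecMulVec (v - Pi.single k' 1) (Pi.single k' 1) := by
        refine Matrix.ext_of_mulVec_single fun i => ?_
        rw [add_mulVec, one_mulVec, vecMulVec_mulVec, ← smul_eq_mulVec]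
        obtain rfl | hi := eq_or_ne i k'
        · simp [hv]
        · simp [hfix i hi, hi]
      have hdet := g.2
      rw [hmat, vecMulVec_eq Unit, det_one_add_replicateCol_mul_replicateRow, add_eq_left,
        single_dotProduct, one_mul] at hdet
      obtain ⟨h, hmem⟩ := hdisj k' _ hdet
      rwa [show g = transv _ _ h from Subtype.ext hmat]
    · let l : Fin n := ⟨k + 1, by omega⟩
      let K : Subgroup (SLZ n) :=
        L ⊓ ⨅ i : Set.Iio k', MulAction.stabilizer (SLZ n) (Pi.single i.1 1 : Fin n → ℤ)
      have hK : ∀ i, k' ≤ i → ∀ x : Fin n → ℤ, x i = 0 → HasTransv K x (Pi.single i 1) := by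
        intro i hi x hx
        obtain ⟨h, hmem⟩ := hdisj i x hx
        refine ⟨h, Subgroup.mem_inf.2 ⟨hmem, Subgroup.mem_iInf.2 ?_⟩⟩
        rintro ⟨j, hj⟩
        rw [MulAction.mem_stabilizer_iff, transv_smul, single_dotProduct,
          Pi.single_eq_of_ne (hj.trans_le hi).ne', mul_zero, zero_smul, add_zero]
      obtain ⟨g', hg', he⟩ := exists_smul_eq_single (show k' < l from Nat.lt_succ_self k) hK
        (Pi.single k' 1 ᵥ* (g⁻¹ : SLZ n).1) v
        (fun i hi => by
          have h := vecMul_dotProduct_smul g (Pi.single k' 1) (Pi.single i 1)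
          rw [hg i hi, dotProduct_single, mul_one, single_dotProduct,
            Pi.single_eq_of_ne hi.ne', mul_zero] at h
          exact h)
        (by rw [hv, vecMul_dotProduct_smul]; simp)
      obtain ⟨hg'L, hg'S⟩ := Subgroup.mem_inf.1 hg'
      refine (L.mul_mem_cancel_left hg'L).1 (ih (k + 1) (by omega) _ fun i hi => ?_)
      rw [mul_smul]
      rcases Nat.lt_succ_iff_lt_or_eq.1 hi with hlt | heq
      · rw [hg i hlt]
        exact MulAction.mem_stabilizer_iff.1 (Subgroup.mem_iInf.1 hg'S ⟨i, hlt⟩)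
      · obtain rfl : i = k' := Fin.ext heq
        exact he

theorem HasElementary.eq_top {L : Subgroup (SLZ n)} (hL : HasElementary L 1) : L = ⊤ :=
  (Subgroup.eq_top_iff' L).2 fun g =>
    hL.mem_of_fixes_init n 0 (zero_add n) g fun _ hi => absurd hi (Nat.not_lt_zero _)

instance isCoatomic_subgroup : IsCoatomic (Subgroup (SLZ n)) := by
  have hfin : Finite {p : Fin n × Fin n // p.1 ≠ p.2} := inferInstance
  let f : {p : Fin n × Fin n // p.1 ≠ p.2} → SLZ n := fun p =>
    SpecialLinearGroup.transvection p.2 1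
  have htop : Subgroup.closure (Set.range f) = ⊤ := by
    apply HasElementary.eq_top
    intro i j hij
    have h : (1 • Pi.single j 1 : Fin n → ℤ) ⬝ᵥ Pi.single i 1 = 0 := by simp [hij.symm]
    have hf : transv (Pi.single i 1) _ h = f ⟨(i, j), hij⟩ := by
      apply Subtype.ext
      simp [f, transv, SpecialLinearGroup.transvection, Matrix.transvection,
        single_eq_single_vecMulVec_single]
    exact ⟨h, hf ▸ Subgroup.subset_closure (Set.mem_range_self _)⟩
  apply CompleteLattice.coatomic_of_top_compact
  rw [CompleteLattice.isCompactElement_iff_le_of_directed_sSup_le]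
  intro S hne hdir hS
  have hmem : ∀ x, ∃ H ∈ S, f x ∈ H := fun x =>
    (Subgroup.mem_sSup_of_directedOn hne hdir).1 (hS (Subgroup.mem_top _))
  choose H hHS hH using hmem
  have : Nonempty S := hne.to_subtype
  obtain ⟨M, hM⟩ := hdir.directed_val.finite_set_le
    (Set.finite_range fun x => (⟨H x, hHS x⟩ : S))
  refine ⟨M, M.2, ?_⟩
  rw [← htop, Subgroup.closure_le]
  rintro _ ⟨x, rfl⟩
  exact hM _ ⟨x, rfl⟩ (hH x)

end Generation

section PingPong

/-- `PingPongReach t p o x`: `x` is obtained from `p` by applying a reduced product of nonzero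
powers of the `t a`, whose last applied letter is recorded by `o`. -/
inductive PingPongReach {ι G X : Type*} [Group G] [MulAction G X] (t : ι → G) (p : X) :
    Option ι → X → Prop
  | base : PingPongReach t p none p
  | step {o : Option ι} {x : X} (h : PingPongReach t p o x) (a : ι) (ha : o ≠ some a) (r : ℤ)
      (hr : r ≠ 0) : PingPongReach t p (some a) (t a ^ r • x)

variable {ι G X : Type*} [Group G] [MulAction G X] {t : ι → G} {p : X}

theorem PingPongReach.exists_zpow_smul {o : Option ι} {x : X} (h : PingPongReach t p o x) (a : ι)
    (r : ℤ) : ∃ o', PingPongReach t p o' (t a ^ r • x) := by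
  by_cases hr : r = 0
  · exact ⟨o, by simpa [hr] using h⟩
  by_cases ho : o = some a
  · cases h with
    | base => cases ho
    | step h b hb r' hr' =>
      obtain rfl := Option.some.inj ho
      rw [smul_smul, ← _root_.zpow_add]
      by_cases hrr : r + r' = 0
      · exact ⟨_, by simpa [hrr] using h⟩
      · exact ⟨_, h.step b hb _ hrr⟩
  · exact ⟨_, h.step a ho r hr⟩

theorem exists_smul_mem_of_mem_closure {A : Option ι → Set X} (hp : p ∈ A none)
    (hA : ∀ o a (r : ℤ), r ≠ 0 → o ≠ some a → ∀ x ∈ A o, t a ^ r • x ∈ A (some a))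
    {g : G} (hg : g ∈ Subgroup.closure (Set.range t)) : ∃ o, g • p ∈ A o := by
  have hreach : ∀ o x, PingPongReach t p o x → x ∈ A o := by
    intro o x h
    induction h with
    | base => exact hp
    | step h a ha r hr ih => exact hA _ a r hr ha _ ih
  have key : ∀ x, (∃ o, PingPongReach t p o x) →
      (∃ o, PingPongReach t p o (g • x)) ∧ ∃ o, PingPongReach t p o (g⁻¹ • x) := by
    induction hg using Subgroup.closure_induction with
    | mem g hg =>
      obtain ⟨a, rfl⟩ := hg
      rintro x ⟨o, h⟩
      exact ⟨by simpa using h.exists_zpow_smul a 1, by simpa using h.exists_zpow_smul a (-1)⟩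
    | one => intro x hx; simpa using hx
    | mul g g' _ _ ih ih' =>
      intro x hx
      rw [_root_.mul_inv_rev, mul_smul, mul_smul]
      exact ⟨(ih _ (ih' x hx).1).1, (ih' _ (ih x hx).2).2⟩
    | inv g _ ih => intro x hx; rw [inv_inv]; exact (ih x hx).symm
  obtain ⟨o, h⟩ := (key p ⟨none, .base⟩).1
  exact ⟨o, hreach _ _ h⟩

end PingPong

section Norm

variable {n : ℕ}

/-- The `ℓ¹` norm of an integral vector. -/
def normOne (x : Fin n → ℤ) : ℤ := ∑ i, |x i|

theorem normOne_nonneg (x : Fin n → ℤ) : 0 ≤ normOne x :=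
  Finset.sum_nonneg fun _ _ => abs_nonneg _

theorem normOne_add_le (x y : Fin n → ℤ) : normOne (x + y) ≤ normOne x + normOne y := by
  rw [normOne, normOne, normOne, ← Finset.sum_add_distrib]
  exact Finset.sum_le_sum fun i _ => abs_add_le _ _

theorem normOne_smul (r : ℤ) (x : Fin n → ℤ) : normOne (r • x) = |r| * normOne x := by
  simp [normOne, abs_mul, Finset.mul_sum]

theorem normOne_one : normOne (1 : Fin n → ℤ) = n := by simp [normOne]

theorem normOne_single (i : Fin n) : normOne (Pi.single i 1 : Fin n → ℤ) = 1 := by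
  simp [normOne, Pi.single_apply, apply_ite]

theorem abs_dotProduct_le {w : Fin n → ℤ} {C : ℤ} (hw : ∀ i, |w i| ≤ C) (x : Fin n → ℤ) :
    |w ⬝ᵥ x| ≤ C * normOne x := by
  rw [normOne, Finset.mul_sum]
  refine (Finset.abs_sum_le_sum_abs _ _).trans (Finset.sum_le_sum fun i _ => ?_)
  rw [abs_mul]
  exact mul_le_mul_of_nonneg_right (hw i) (abs_nonneg _)

theorem normOne_lt_of_transv {x v φ ψ : Fin n → ℤ} {N D E C r : ℤ} (hr : r ≠ 0) (hN : 0 < N)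
    (hD : 0 < D) (hE : 0 < E) (hx : normOne x < D * |φ ⬝ᵥ x|) (hψ : ∀ i, |ψ i| ≤ C)
    (hpos : normOne v < E * |ψ ⬝ᵥ v|)
    (hle : D * (1 + E * C) ≤ N * (E * |ψ ⬝ᵥ v| - normOne v)) :
    normOne (x + (r * (N * (φ ⬝ᵥ x))) • v) < E * |ψ ⬝ᵥ (x + (r * (N * (φ ⬝ᵥ x))) • v)| := by
  have hX := normOne_nonneg x
  have hψx := abs_dotProduct_le hψ x
  have hT : N * |φ ⬝ᵥ x| ≤ |r * (N * (φ ⬝ᵥ x))| := by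
    rw [abs_mul, abs_mul N, abs_of_pos hN]
    exact le_mul_of_one_le_left (by positivity) (Int.one_le_abs hr)
  have h1 : normOne (x + (r * (N * (φ ⬝ᵥ x))) • v) ≤
      normOne x + |r * (N * (φ ⬝ᵥ x))| * normOne v := by
    rw [← normOne_smul]; exact normOne_add_le _ _
  have h2 : |r * (N * (φ ⬝ᵥ x))| * |ψ ⬝ᵥ v| - |ψ ⬝ᵥ x| ≤
      |ψ ⬝ᵥ (x + (r * (N * (φ ⬝ᵥ x))) • v)| := by
    rw [dotProduct_add, dotProduct_smul, smul_eq_mul, ← abs_mul, add_comm]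
    exact abs_sub_abs_le_abs_add _ _
  set T := |r * (N * (φ ⬝ᵥ x))|
  set P := |ψ ⬝ᵥ v|
  set V := normOne v
  set X := normOne x
  have h3 : N * X < D * T := by nlinarith
  have h4 : X * (1 + E * C) < T * (E * P - V) := by
    refine lt_of_mul_lt_mul_left ?_ hD.le
    nlinarith [mul_lt_mul_of_pos_right h3 (sub_pos.2 hpos), mul_le_mul_of_nonneg_left hle hX]
  nlinarith [mul_le_mul_of_nonneg_left h2 hE.le, mul_le_mul_of_nonneg_left hψx hE.le]

end Norm

section Generators

variable {n : ℕ}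

/-- A rapidly growing sequence of multiples of the factorials, used as shear parameters. -/
def scale (n k : ℕ) : ℤ := 100 * n ^ 2 * (k + 2).factorial

theorem le_scale (n k : ℕ) : 100 * (n : ℤ) ^ 2 ≤ scale n k :=
  le_mul_of_one_le_right (by positivity) (by exact_mod_cast Nat.factorial_pos _)

theorem nine_hundred_le_scale (hn : 3 ≤ n) (k : ℕ) : 900 ≤ scale n k := by
  have h : (3 : ℤ) ≤ n := by exact_mod_cast hn
  nlinarith [le_scale n k]

theorem scale_gap {k l : ℕ} (h : k ≠ l) :
    2 * scale n k ≤ scale n l ∨ 2 * scale n l ≤ scale n k := by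
  have key : ∀ {k l : ℕ}, k < l → 2 * scale n k ≤ scale n l := by
    intro k l h
    have h1 : 2 * (k + 2).factorial ≤ (l + 2).factorial :=
      calc 2 * (k + 2).factorial ≤ (k + 3) * (k + 2).factorial := by gcongr; omega
        _ = (k + 3).factorial := rfl
        _ ≤ _ := Nat.factorial_le (by omega)
    have h2 : 2 * ((k + 2).factorial : ℤ) ≤ (l + 2).factorial := by exact_mod_cast h1
    rw [scale, scale]
    nlinarith [sq_nonneg (n : ℤ)]
  rcases lt_or_gt_of_ne h with h | h
  · exact .inl (key h)
  · exact .inr (key h)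

variable [NeZero n]

/-- An integral form with nonzero entries which vanishes on the all-ones vector. -/
def sumZeroForm (n : ℕ) [NeZero n] : Fin n → ℤ := 1 - (n : ℤ) • Pi.single 0 1

theorem sumZeroForm_dotProduct_one : sumZeroForm n ⬝ᵥ 1 = 0 := by
  rw [sumZeroForm, sub_dotProduct, smul_dotProduct, single_dotProduct]
  simp

theorem abs_sumZeroForm_le (i : Fin n) : |sumZeroForm n i| ≤ n := by
  have := NeZero.one_le (n := n)
  rw [abs_le]
  obtain rfl | hi := eq_or_ne i 0
  · simp [sumZeroForm]
    omega
  · simp [sumZeroForm, hi]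
    omega

theorem one_le_abs_sumZeroForm (hn : 3 ≤ n) (i : Fin n) : 1 ≤ |sumZeroForm n i| := by
  apply Int.one_le_abs
  obtain rfl | hi := eq_or_ne i 0
  · simp [sumZeroForm]
    omega
  · simp [sumZeroForm, hi]

/-- A form with entries in `{0, 1, 2}` vanishing exactly at coordinate `i`; the two choices of `b`
differ by the coordinate form `i + 1`. -/
def baseForm (b : Bool) (i : Fin n) : Fin n → ℤ :=
  1 - Pi.single i 1 + if b then Pi.single (i + 1) 1 else 0

theorem add_one_ne_self (hn : 3 ≤ n) (i : Fin n) : i + 1 ≠ i := by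
  intro h
  have h1 := congrArg Fin.val (add_eq_left.1 h)
  rw [Fin.val_one', Nat.mod_eq_of_lt (by omega)] at h1
  simp at h1

theorem baseForm_apply_self (hn : 3 ≤ n) (b : Bool) (i : Fin n) : baseForm b i i = 0 := by
  cases b <;> simp [baseForm, (add_one_ne_self hn i).symm]

theorem baseForm_apply_mem (b : Bool) (i j : Fin n) :
    0 ≤ baseForm b i j ∧ baseForm b i j ≤ 2 := by
  cases b <;> simp only [baseForm, Pi.add_apply, Pi.sub_apply, Pi.one_apply, Pi.single_apply,
    if_true, Bool.false_eq_true, if_false, Pi.zero_apply] <;> split_ifs <;> norm_num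

theorem one_le_baseForm_apply (b : Bool) {i j : Fin n} (h : j ≠ i) : 1 ≤ baseForm b i j := by
  cases b <;> simp only [baseForm, Pi.add_apply, Pi.sub_apply, Pi.one_apply, Pi.single_apply,
    if_true, Bool.false_eq_true, if_false, Pi.zero_apply, if_neg h] <;> (try split_ifs) <;> norm_num

theorem baseForm_dotProduct_one (b : Bool) (i : Fin n) :
    n - 1 ≤ baseForm b i ⬝ᵥ 1 ∧ baseForm b i ⬝ᵥ 1 ≤ n := by
  cases b <;> simp [baseForm, sub_dotProduct, add_dotProduct]

/-- The translate of the basis vector `i` by `transv 1 (s • sumZeroForm n)`. -/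
def genVec (s : ℤ) (i : Fin n) : Fin n → ℤ := Pi.single i 1 + (s * sumZeroForm n i) • 1

/-- The translate of `baseForm b i` by `transv 1 (s • sumZeroForm n)`. -/
def genForm (s : ℤ) (b : Bool) (i : Fin n) : Fin n → ℤ :=
  baseForm b i - (s * baseForm b i ⬝ᵥ 1) • sumZeroForm n

theorem genForm_dotProduct_genVec (s s' : ℤ) (b : Bool) (i j : Fin n) :
    genForm s' b j ⬝ᵥ genVec s i =
      baseForm b j i + (s - s') * (sumZeroForm n i * baseForm b j ⬝ᵥ 1) := by
  rw [genForm, genVec, dotProduct_add, dotProduct_smul, dotProduct_single, sub_dotProduct,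
    smul_dotProduct, sumZeroForm_dotProduct_one, Pi.sub_apply, Pi.smul_apply]
  simp only [smul_eq_mul]
  ring

theorem genForm_dotProduct_one (s : ℤ) (b : Bool) (i : Fin n) :
    genForm s b i ⬝ᵥ 1 = baseForm b i ⬝ᵥ 1 := by
  rw [genForm, sub_dotProduct, smul_dotProduct, sumZeroForm_dotProduct_one, smul_zero, sub_zero]

theorem abs_genForm_apply_le {s : ℤ} (hs : 0 ≤ s) (b : Bool) (i j : Fin n) :
    |genForm s b i j| ≤ 2 + s * n ^ 2 := by
  have h1 := baseForm_apply_mem b i j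
  have h2 := baseForm_dotProduct_one b i
  have h3 := NeZero.one_le (n := n)
  have h4 : |s * baseForm b i ⬝ᵥ 1 * sumZeroForm n j| ≤ s * n ^ 2 := by
    rw [abs_mul, abs_mul, abs_of_nonneg hs, mul_assoc, sq]
    gcongr
    · rw [abs_le]; omega
    · exact abs_sumZeroForm_le j
  calc |genForm s b i j| = |baseForm b i j - s * baseForm b i ⬝ᵥ 1 * sumZeroForm n j| := rfl
    _ ≤ |baseForm b i j| + |s * baseForm b i ⬝ᵥ 1 * sumZeroForm n j| := abs_sub _ _
    _ ≤ _ := add_le_add (abs_le.2 ⟨by omega, h1.2⟩) h4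

theorem normOne_genVec_le {s : ℤ} (hs : 0 ≤ s) (i : Fin n) :
    normOne (genVec s i) ≤ 1 + s * |sumZeroForm n i| * n := by
  refine (normOne_add_le _ _).trans ?_
  rw [normOne_single, normOne_smul, normOne_one, abs_mul, abs_of_nonneg hs]

theorem smul_genForm_dotProduct_genVec (hn : 3 ≤ n) (s N : ℤ) (b : Bool) (i : Fin n) :
    (N • genForm s b i) ⬝ᵥ genVec s i = 0 := by
  rw [smul_dotProduct, genForm_dotProduct_genVec, baseForm_apply_self hn, sub_self, zero_mul,
    add_zero, smul_zero]

/-- The transvections whose nonzero powers play ping-pong on `pingPongSet c`. -/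
def gen (hn : 3 ≤ n) (c : ℕ → Bool) (p : ℕ × Fin n) : SLZ n :=
  transv (genVec (scale n p.1) p.2) ((1 + scale n p.1 ^ 6) • genForm (scale n p.1) (c p.1) p.2)
    (smul_genForm_dotProduct_genVec hn _ _ _ _)

theorem gen_zpow_smul (hn : 3 ≤ n) (c : ℕ → Bool) (p : ℕ × Fin n) (r : ℤ) (x : Fin n → ℤ) :
    gen hn c p ^ r • x = x + (r * ((1 + scale n p.1 ^ 6) *
      (genForm (scale n p.1) (c p.1) p.2 ⬝ᵥ x))) • genVec (scale n p.1) p.2 := by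
  rw [gen, transv_zpow _ _ (by rw [smul_dotProduct, smul_genForm_dotProduct_genVec hn, smul_zero]),
    transv_smul, smul_dotProduct, smul_dotProduct, smul_eq_mul, smul_eq_mul]

/-- The ping-pong test attached to a generator, or to the coordinate `0`. -/
def testForm (c : ℕ → Bool) : Option (ℕ × Fin n) → Fin n → ℤ
  | none => Pi.single 0 1
  | some p => genForm (scale n p.1) (c p.1) p.2

/-- The weight with which a test form has to dominate the norm. -/
def testWeight (n : ℕ) : Option (ℕ × Fin n) → ℤ
  | none => 100 * n ^ 2
  | some p => scale n p.1 ^ 3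

/-- A bound for the entries of a test form. -/
def testBound (n : ℕ) : Option (ℕ × Fin n) → ℤ
  | none => 1
  | some p => 2 + scale n p.1 * n ^ 2

theorem abs_testForm_le (c : ℕ → Bool) (o : Option (ℕ × Fin n)) (j : Fin n) :
    |testForm c o j| ≤ testBound n o := by
  cases o with
  | none =>
    simp only [testForm, testBound, Pi.single_apply]
    split_ifs <;> norm_num
  | some p =>
    exact abs_genForm_apply_le ((by positivity : (0 : ℤ) ≤ _).trans (le_scale n p.1)) _ _ _

theorem testWeight_pos (o : Option (ℕ × Fin n)) : 0 < testWeight n o := by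
  have := NeZero.pos n
  have h : ∀ k, 0 < scale n k := fun k => (by positivity : (0 : ℤ) < _).trans_le (le_scale n k)
  cases o with
  | none => simp only [testWeight]; positivity
  | some p => exact pow_pos (h _) 3

/-- The vectors passing every test, except possibly the one of the generator `o`. -/
def pingPongSet (c : ℕ → Bool) (o : Option (ℕ × Fin n)) : Set (Fin n → ℤ) :=
  {x | ∀ o', (o' = none ∨ o' ≠ o) → normOne x < testWeight n o' * |testForm c o' ⬝ᵥ x|}

end Generators

section Dominance

theorem dominance_coordinate {a m F V P : ℤ} (hm : 3 ≤ m) (ha : 100 * m ^ 2 ≤ a)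
    (hF : 1 ≤ F) (hV : V ≤ 1 + a * F * m) (hP : a * F - 1 ≤ P) : 1 ≤ 100 * m ^ 2 * P - V := by
  have h1 : m + 2 ≤ 100 * m ^ 2 := by nlinarith
  have h2 : a ≤ a * F := le_mul_of_one_le_right (by linarith) hF
  nlinarith [mul_le_mul_of_nonneg_left hP (show 0 ≤ 100 * m ^ 2 by positivity),
    mul_le_mul_of_nonneg_left h1 (show 0 ≤ a * F by linarith)]

theorem dominance_same {a q V P : ℤ} (ha : 900 ≤ a) (hq : 100 * q ≤ a)
    (hV : V ≤ 1 + a * q) (hP : 1 ≤ P) :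
    V < a ^ 3 * P ∧ a ^ 3 * (1 + a ^ 3 * (2 + a * q)) ≤ (1 + a ^ 6) * (a ^ 3 * P - V) := by
  have h1 : 100 * (a * q) ≤ a ^ 2 := by nlinarith
  have h2 : a ^ 3 ≤ a ^ 3 * P := le_mul_of_one_le_right (by positivity) hP
  have h3 : 900 * a ^ 2 ≤ a ^ 3 := by nlinarith [sq_nonneg a]
  have h4 : 900 * 900 ≤ a ^ 2 := by nlinarith
  have h5 : a ^ 2 ≤ a ^ 3 * P - V := by linarith
  refine ⟨by linarith, ?_⟩
  calc a ^ 3 * (1 + a ^ 3 * (2 + a * q)) ≤ a ^ 3 * (a ^ 3 * a ^ 2) := by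
        gcongr
        nlinarith [pow_nonneg (show 0 ≤ a by linarith) 3]
    _ = a ^ 6 * a ^ 2 := by ring
    _ ≤ (1 + a ^ 6) * (a ^ 3 * P - V) := by gcongr; linarith

theorem dominance_distinct {a b q V P : ℤ} (ha : 900 ≤ a) (hb : 900 ≤ b) (hqa : 100 * q ≤ a)
    (hqb : 100 * q ≤ b) (hV : V ≤ 1 + a * q) (hP : a + b ≤ 4 * P) :
    V < b ^ 3 * P ∧ a ^ 3 * (1 + b ^ 3 * (2 + b * q)) ≤ (1 + a ^ 6) * (b ^ 3 * P - V) := by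
  have h1 : 100 * (a * q) ≤ a * b := by nlinarith
  have h2 : 100 * (b * q) ≤ a * b := by nlinarith
  have h3 : 900 * b ^ 2 ≤ b ^ 3 := by nlinarith [sq_nonneg b]
  have h4 : b ^ 3 * (a + b) ≤ b ^ 3 * (4 * P) := by gcongr
  have h5 : 900 * b ≤ b ^ 2 := by nlinarith
  have h6 : a * b ≤ a * b ^ 3 := by gcongr; nlinarith
  have h7 : 900 ≤ b ^ 4 := by nlinarith
  have h8 : b ^ 4 ≤ 16 * (b ^ 3 * P - V) := by nlinarith
  have h9 : 900 * 900 ≤ a * b := by nlinarith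
  refine ⟨by linarith, ?_⟩
  have h10 : 16 * (a ^ 3 * (1 + b ^ 3 * (2 + b * q))) ≤ 16 * ((1 + a ^ 6) * (b ^ 3 * P - V)) :=
    calc 16 * (a ^ 3 * (1 + b ^ 3 * (2 + b * q))) ≤ a ^ 3 * (b ^ 3 * (a * b)) := by
          rw [mul_left_comm]
          refine mul_le_mul_of_nonneg_left ?_ (pow_nonneg (by linarith) 3)
          nlinarith [pow_nonneg (show 0 ≤ b by linarith) 3]
      _ = a ^ 4 * b ^ 4 := by ring
      _ ≤ a ^ 6 * (16 * (b ^ 3 * P - V)) := by gcongr <;> linarith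
      _ ≤ 16 * ((1 + a ^ 6) * (b ^ 3 * P - V)) := by linarith
  linarith

end Dominance

section FreeProduct

variable {n : ℕ} [NeZero n]

theorem dominance (hn : 3 ≤ n) (c : ℕ → Bool) (p : ℕ × Fin n) {o : Option (ℕ × Fin n)}
    (ho : o ≠ some p) :
    normOne (genVec (scale n p.1) p.2) <
        testWeight n o * |testForm c o ⬝ᵥ genVec (scale n p.1) p.2| ∧
      scale n p.1 ^ 3 * (1 + testWeight n o * testBound n o) ≤ (1 + scale n p.1 ^ 6) *
        (testWeight n o * |testForm c o ⬝ᵥ genVec (scale n p.1) p.2| -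
          normOne (genVec (scale n p.1) p.2)) := by
  obtain ⟨k, i⟩ := p
  have hm : (3 : ℤ) ≤ n := by exact_mod_cast hn
  have ha := nine_hundred_le_scale hn k
  have hqa := le_scale n k
  have hV := normOne_genVec_le (show 0 ≤ scale n k by linarith) i
  have hf := one_le_abs_sumZeroForm hn i
  have hV' : normOne (genVec (scale n k) i) ≤ 1 + scale n k * n ^ 2 := by
    refine hV.trans ?_
    rw [mul_assoc, sq]
    gcongr
    exact abs_sumZeroForm_le i
  match o with
  | none =>
    have hP : scale n k * |sumZeroForm n i| - 1 ≤
        |testForm c none ⬝ᵥ genVec (scale n k) i| := by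
      have h1 : |(Pi.single i 1 : Fin n → ℤ) 0| ≤ 1 := by
        rw [Pi.single_apply]; split_ifs <;> norm_num
      have h2 : testForm c none ⬝ᵥ genVec (scale n k) i =
          scale n k * sumZeroForm n i + (Pi.single i 1 : Fin n → ℤ) 0 := by
        rw [testForm, single_dotProduct, one_mul, genVec, add_comm]
        simp
      have h3 := abs_sub_abs_le_abs_add (scale n k * sumZeroForm n i)
        ((Pi.single i 1 : Fin n → ℤ) 0)
      rw [abs_mul, abs_of_nonneg (show 0 ≤ scale n k by linarith)] at h3
      rw [h2]
      linarith
    have h := dominance_coordinate hm hqa hf hV hP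
    simp only [testWeight, testBound]
    refine ⟨by linarith, ?_⟩
    have h3 : scale n k ^ 3 * (1 + 100 * n ^ 2 * 1) ≤ scale n k ^ 3 * scale n k ^ 3 := by
      gcongr
      nlinarith [sq_nonneg (scale n k)]
    nlinarith [pow_nonneg (show 0 ≤ scale n k by linarith) 6]
  | some (l, j) =>
    simp only [testForm, testWeight, testBound, genForm_dotProduct_genVec]
    have hb := nine_hundred_le_scale hn l
    have hqb := le_scale n l
    have hG := baseForm_dotProduct_one (c l) j
    have hbase := baseForm_apply_mem (c l) j i
    obtain rfl | hkl := eq_or_ne l k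
    · have hij : i ≠ j := by rintro rfl; exact ho rfl
      rw [sub_self, zero_mul, add_zero]
      exact dominance_same ha hqa hV' ((one_le_baseForm_apply _ hij).trans (le_abs_self _))
    · refine dominance_distinct ha hb hqa hqb hV' ?_
      have h1 : |scale n k - scale n l| ≤
          |(scale n k - scale n l) * (sumZeroForm n i * baseForm (c l) j ⬝ᵥ 1)| := by
        rw [abs_mul]
        refine le_mul_of_one_le_right (abs_nonneg _) (Int.one_le_abs (mul_ne_zero ?_ (by omega)))
        exact abs_pos.1 (by linarith)
      have h2 := abs_sub_abs_le_abs_add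
        ((scale n k - scale n l) * (sumZeroForm n i * baseForm (c l) j ⬝ᵥ 1)) (baseForm (c l) j i)
      rw [abs_of_nonneg hbase.1, add_comm _ (baseForm (c l) j i)] at h2
      rcases scale_gap (n := n) hkl with h | h
      · linarith [le_abs_self (scale n k - scale n l)]
      · linarith [neg_le_abs (scale n k - scale n l)]

theorem gen_zpow_smul_mem (hn : 3 ≤ n) (c : ℕ → Bool) (o : Option (ℕ × Fin n)) (p : ℕ × Fin n)
    (r : ℤ) (hr : r ≠ 0) (ho : o ≠ some p) (x : Fin n → ℤ) (hx : x ∈ pingPongSet c o) :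
    gen hn c p ^ r • x ∈ pingPongSet c (some p) := by
  intro o' ho'
  have hs := nine_hundred_le_scale hn p.1
  have hdom := dominance hn c p (o := o') (by rintro rfl; simp at ho')
  rw [gen_zpow_smul]
  exact normOne_lt_of_transv hr (by positivity) (testWeight_pos (some p)) (testWeight_pos o')
    (hx (some p) (.inr ho.symm)) (abs_testForm_le c o') hdom.1 hdom.2

/-- The subgroup generated by the ping-pong transvections selected by `c`. -/
def genSubgroup (hn : 3 ≤ n) (c : ℕ → Bool) : Subgroup (SLZ n) :=
  Subgroup.closure (Set.range (gen hn c))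

theorem one_mem_pingPongSet (hn : 3 ≤ n) (c : ℕ → Bool) : 1 ∈ pingPongSet (n := n) c none := by
  have hm : (3 : ℤ) ≤ n := by exact_mod_cast hn
  rintro (_ | ⟨k, i⟩) -
  · rw [normOne_one]
    simp [testForm, testWeight]
    nlinarith
  · have hs := nine_hundred_le_scale hn k
    have h1 := le_scale n k
    have h2 : scale n k ≤ scale n k ^ 3 := le_self_pow₀ (by linarith) (by norm_num)
    have h3 : 1 ≤ |baseForm (c k) i ⬝ᵥ 1| :=
      Int.one_le_abs (by have := baseForm_dotProduct_one (c k) i; omega)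
    simp only [testForm, testWeight]
    rw [normOne_one, genForm_dotProduct_one]
    nlinarith

theorem genSubgroup_ne_top (hn : 3 ≤ n) (c : ℕ → Bool) : genSubgroup hn c ≠ ⊤ := by
  intro htop
  have h0 : (-Pi.single 1 1 : Fin n → ℤ) ⬝ᵥ Pi.single 0 1 = 0 := by
    have := add_one_ne_self hn 0
    rw [zero_add] at this
    simp [this]
  obtain ⟨o, ho⟩ := exists_smul_mem_of_mem_closure (one_mem_pingPongSet hn c)
    (gen_zpow_smul_mem hn c) (g := transv _ _ h0) (by
      change _ ∈ genSubgroup hn c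
      rw [htop]
      exact Subgroup.mem_top _)
  have h := ho none (.inl rfl)
  have hz : (transv (Pi.single 0 1 : Fin n → ℤ) _ h0 • (1 : Fin n → ℤ)) 0 = 0 := by
    rw [transv_smul, neg_dotProduct, single_dotProduct]
    simp
  rw [testForm, single_dotProduct, hz, mul_zero, abs_zero, mul_zero] at h
  exact (normOne_nonneg _).not_gt h

end FreeProduct

section Maximal

variable {n : ℕ} [NeZero n]

theorem smul_sumZeroForm_dotProduct_one (s : ℤ) : (s • sumZeroForm n) ⬝ᵥ 1 = 0 := by
  rw [smul_dotProduct, sumZeroForm_dotProduct_one, smul_zero]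

theorem smul_baseForm_dotProduct_single (hn : 3 ≤ n) (N : ℤ) (b : Bool) (i : Fin n) :
    (N • baseForm b i) ⬝ᵥ Pi.single i 1 = 0 := by
  rw [dotProduct_single, mul_one, Pi.smul_apply, baseForm_apply_self hn, smul_zero]

/-- The transvection conjugating the coordinate transvections to the generators of stage `k`. -/
def shear (n : ℕ) [NeZero n] (k : ℕ) : SLZ n :=
  transv 1 (scale n k • sumZeroForm n) (smul_sumZeroForm_dotProduct_one _)

theorem gen_eq_conj (hn : 3 ≤ n) (c : ℕ → Bool) (k : ℕ) (i : Fin n) :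
    gen hn c (k, i) = shear n k * transv (Pi.single i 1) ((1 + scale n k ^ 6) • baseForm (c k) i)
      (smul_baseForm_dotProduct_single hn _ _ _) * (shear n k)⁻¹ := by
  have hv : shear n k • (Pi.single i 1 : Fin n → ℤ) = genVec (scale n k) i := by
    rw [shear, transv_smul, dotProduct_single, mul_one, Pi.smul_apply, genVec, smul_eq_mul]
  have hw : ((1 + scale n k ^ 6) • baseForm (c k) i) ᵥ* (shear n k)⁻¹.1 =
      (1 + scale n k ^ 6) • genForm (scale n k) (c k) i := by
    rw [shear, transv_inv _ (by rw [← neg_smul, smul_sumZeroForm_dotProduct_one]), smul_vecMul,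
      transv, vecMul_add, vecMul_one, vecMul_vecMulVec, genForm, sub_eq_add_neg,
      mul_comm (scale n k), mul_smul, smul_neg]
  rw [conj_transv _ _ (by rw [vecMul_dotProduct_smul, smul_baseForm_dotProduct_single hn])]
  simp only [hv, hw]
  rfl

theorem hasTransv_of_genSubgroup_le (hn : 3 ≤ n) {c : ℕ → Bool} {M : Subgroup (SLZ n)}
    (hM : genSubgroup hn c ≤ M) (k : ℕ) (i : Fin n) :
    HasTransv (M.comap (MulAut.conj (shear n k)).toMonoidHom) (Pi.single i 1)
      ((1 + scale n k ^ 6) • baseForm (c k) i) :=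
  ⟨smul_baseForm_dotProduct_single hn _ _ _, by
    have h : gen hn c (k, i) ∈ M := hM (Subgroup.subset_closure (Set.mem_range_self _))
    rwa [gen_eq_conj] at h⟩

theorem hasElementary_of_baseForm {L : Subgroup (SLZ n)} {m : ℤ}
    (h : ∀ b i, HasTransv L (Pi.single i 1) (m • baseForm b i)) : HasElementary L (m ^ n) := by
  refine hasElementary_of_cyclic fun i => ?_
  convert (h true i).add_right ((h false i).zsmul_right (-1)) using 1
  rw [smul_comm, ← smul_add]
  congr 1
  rw [neg_one_smul, ← sub_eq_add_neg]
  simp [baseForm]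

/-- A sequence in which both values occur beyond every bound. -/
def alternate (y : ℕ → Bool) (k : ℕ) : Bool := y (k / 2) ^^ k.bodd

theorem exists_alternate_eq (y : ℕ → Bool) (b : Bool) (m : ℕ) : ∃ k, m ≤ k ∧ alternate y k = b := by
  by_cases h : y m = b
  · exact ⟨2 * m, by omega, by simp [alternate, h]⟩
  · refine ⟨2 * m + 1, by omega, ?_⟩
    have h1 : (2 * m + 1) / 2 = m := by omega
    rw [alternate, h1]
    cases b <;> simp_all

theorem HasCongruenceTransv.eq_top (hn : 3 ≤ n) {y : ℕ → Bool} {M : Subgroup (SLZ n)}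
    (hM : genSubgroup hn (alternate y) ≤ M) {m : ℤ} (hm : m ≠ 0) (h : HasCongruenceTransv M m) :
    M = ⊤ := by
  suffices hbase : ∀ b i, HasTransv M (Pi.single i 1) (baseForm b i) from
    HasElementary.eq_top (one_pow (M := ℤ) n ▸ hasElementary_of_baseForm fun b i => by
      rw [one_smul]; exact hbase b i)
  intro b i
  obtain ⟨k, hmk, rfl⟩ := exists_alternate_eq y b m.natAbs
  obtain ⟨s, hs⟩ : m ∣ scale n k := by
    refine dvd_mul_of_dvd_right (Int.natAbs_dvd.1 (Int.natCast_dvd_natCast.2 ?_)) _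
    exact Nat.dvd_factorial (Int.natAbs_pos.2 hm) (by omega)
  have hshear : shear n k ∈ M := by
    obtain ⟨_, h1⟩ := h (Pi.single 0 1) 1 (s • sumZeroForm n) (by simp)
      (smul_sumZeroForm_dotProduct_one s)
    simp only [← mul_smul, ← hs] at h1
    exact h1
  have hgen : HasTransv M (Pi.single i 1) ((1 + scale n k ^ 6) • baseForm (alternate y k) i) := by
    obtain ⟨h0, h1⟩ := hasTransv_of_genSubgroup_le hn hM k i
    refine ⟨h0, ?_⟩
    have h2 : shear n k * transv _ _ h0 * (shear n k)⁻¹ ∈ M := h1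
    rwa [M.mul_mem_cancel_right (inv_mem hshear), M.mul_mem_cancel_left hshear] at h2
  have hcong : HasTransv M (Pi.single i 1) (scale n k ^ 6 • baseForm (alternate y k) i) := by
    have h1 := h (Pi.single i 1) (Pi.single i 1)
      ((s * scale n k ^ 5) • baseForm (alternate y k) i) (by simp)
      (smul_baseForm_dotProduct_single hn _ _ _)
    rwa [← mul_smul, ← mul_assoc, ← hs, ← pow_succ'] at h1
  convert hgen.add_right (hcong.zsmul_right (-1)) using 1
  rw [add_smul, neg_one_smul, add_neg_cancel_right, one_smul]

theorem eq_top_of_genSubgroup_le_of_le (hn : 3 ≤ n) {y z : ℕ → Bool} (hyz : y ≠ z)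
    {M : Subgroup (SLZ n)} (hy : genSubgroup hn (alternate y) ≤ M)
    (hz : genSubgroup hn (alternate z) ≤ M) : M = ⊤ := by
  obtain ⟨k, hk⟩ := Function.ne_iff.1 hyz
  have hk' : alternate y (2 * k) ≠ alternate z (2 * k) := by simpa [alternate] using hk
  have h : ∀ b i, HasTransv (M.comap (MulAut.conj (shear n (2 * k))).toMonoidHom) (Pi.single i 1)
      ((1 + scale n (2 * k) ^ 6) • baseForm b i) := by
    intro b i
    have h1 := hasTransv_of_genSubgroup_le hn hy (2 * k) i
    have h2 := hasTransv_of_genSubgroup_le hn hz (2 * k) i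
    by_cases hb : alternate y (2 * k) = b
    · rwa [hb] at h1
    · rwa [(by decide : ∀ p q b : Bool, p ≠ q → p ≠ b → q = b) _ _ _ hk' hb] at h2
  have hs := nine_hundred_le_scale hn (2 * k)
  exact HasCongruenceTransv.eq_top hn hy (pow_ne_zero 2 (pow_ne_zero n (by positivity)))
    ((hasElementary_of_baseForm h).hasCongruenceTransv hn).of_conj

theorem exists_isMaxSubgroup_genSubgroup_le (hn : 3 ≤ n) (y : ℕ → Bool) :
    ∃ M : Subgroup (SLZ n), (IsMaxSubgroup M ∧ M.index = 0) ∧ genSubgroup hn (alternate y) ≤ M := by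
  obtain ⟨M, hM, hle⟩ := (eq_top_or_exists_le_coatom (genSubgroup hn (alternate y))).resolve_left
    (genSubgroup_ne_top hn _)
  refine ⟨M, ⟨hM, by_contra fun hindex => hM.1 ?_⟩, hle⟩
  have : M.FiniteIndex := ⟨hindex⟩
  obtain ⟨m, hm, h⟩ := exists_hasCongruenceTransv_of_finiteIndex M
  exact h.eq_top hn hle (Nat.cast_ne_zero.2 hm)

end Maximal

end MaximalSubgroups

/-- Theorem 1 (Gelander–Meiri): for `n ≥ 3` there are `2^{ℵ₀}` (continuum many)
infinite-index maximal subgroups of `SL(n,ℤ)`. -/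
theorem continuum_many_maximal_subgroups (n : ℕ) (hn : 3 ≤ n) :
    Cardinal.mk {M : Subgroup (SLZ n) // IsMaxSubgroup M ∧ M.index = 0} =
      Cardinal.continuum := by
  have : NeZero n := ⟨by omega⟩
  have : Countable (SLZ n) :=
    (Subtype.val_injective.countable : Countable {A : Fin n → Fin n → ℤ // Matrix.det A = 1})
  apply le_antisymm
  · calc Cardinal.mk {M : Subgroup (SLZ n) // IsMaxSubgroup M ∧ M.index = 0}
        ≤ Cardinal.mk (Set (SLZ n)) :=
          Cardinal.mk_le_of_injective (SetLike.coe_injective.comp Subtype.val_injective)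
      _ = 2 ^ Cardinal.mk (SLZ n) := Cardinal.mk_set
      _ ≤ 2 ^ Cardinal.aleph0 :=
          Cardinal.power_le_power_left two_ne_zero Cardinal.mk_le_aleph0
      _ = Cardinal.continuum := Cardinal.two_power_aleph0
  · choose f hf hle using MaximalSubgroups.exists_isMaxSubgroup_genSubgroup_le hn
    have hinj : Function.Injective fun y =>
        (⟨f y, hf y⟩ : {M : Subgroup (SLZ n) // IsMaxSubgroup M ∧ M.index = 0}) := by
      intro y z hyz
      by_contra hne
      exact (hf y).1.1 (MaximalSubgroups.eq_top_of_genSubgroup_le_of_le hn hne (hle y)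
        ((hle z).trans (congrArg Subtype.val hyz).ge))
    simpa using Cardinal.mk_le_of_injective hinj
end

section
/- Let n ≥ 3. There exists a maximal subgroup Δ of SL(n,ℤ) which does not have a dense orbit in ℙ: for every x ∈ ℙ, the set {g • x : g ∈ Δ} is not dense in ℙ. -/
/- Common setup: `SL(n,ℤ)`, `SL(n,ℝ)`, the real projective space `ℙ^{n-1}(ℝ)`
with its quotient topology and the projective action, rank-1 unipotent elements
and their attracting points / fixed hyperplanes, metrics compatible with the
topology of `ℙ`, `ε`-neighbourhoods, Schottky systems, profinite density,
maximal subgroups, and lattices in `SL(n,ℝ)`. -/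

open Matrix LinearAlgebra.Projectivization

section Generation

variable {n : ℕ}

/-- The coset `G * A` contains an element whose first `k` columns are standard. -/
theorem exists_row_reduced (G : Subgroup (SLZ n))
    (hG : ∀ (i j : Fin n) (hij : i ≠ j) (c : ℤ), Matrix.SpecialLinearGroup.transvection hij c ∈ G)
    (A : SLZ n) (k : ℕ) (hk : k ≤ n) :
    ∃ g ∈ G, ∀ j : Fin n, (j : ℕ) < k → ∀ i,
      (g * A : SLZ n) i j = (1 : Matrix (Fin n) (Fin n) ℤ) i j := by
  induction k with
  | zero => exact ⟨1, G.one_mem, fun j hj => absurd hj (Nat.not_lt_zero _)⟩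
  | succ k ih =>
    obtain ⟨g₀, hg₀, h₀⟩ := ih (Nat.le_of_succ_le hk)
    set κ : Fin n := ⟨k, hk⟩ with hκ
    set S : Set (SLZ n) := {B | (∃ g ∈ G, B = g * A) ∧ ∀ j : Fin n, (j : ℕ) < k → ∀ i,
      B i j = (1 : Matrix (Fin n) (Fin n) ℤ) i j} with hS
    have step : ∀ B ∈ S, ∀ (a b : Fin n) (hab : a ≠ b) (c : ℤ), k ≤ (b : ℕ) →
        Matrix.SpecialLinearGroup.transvection hab c * B ∈ S := by
      rintro B ⟨⟨g, hg, rfl⟩, hB⟩ a b hab c hb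
      refine ⟨⟨_, G.mul_mem (hG a b hab c) hg, (mul_assoc _ _ _).symm⟩, fun j hj i => ?_⟩
      have e1 := hB j hj i
      have e2 := hB j hj b
      have hbj : b ≠ j := by rintro rfl; omega
      rw [Matrix.SpecialLinearGroup.coe_mul]
      change (Matrix.transvection a b c * (g * A : SLZ n).1 : Matrix (Fin n) (Fin n) ℤ) i j = _
      by_cases hia : i = a
      · subst hia
        rw [transvection_mul_apply_same, e1, e2, one_apply_ne hbj]; simp
      · rw [transvection_mul_apply_of_ne _ _ _ _ hia, e1]
    have tsame : ∀ (B : SLZ n) (a b : Fin n) (hab : a ≠ b) (c : ℤ),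
        (Matrix.SpecialLinearGroup.transvection hab c * B : SLZ n) a κ = B a κ + c * B b κ := by
      intro B a b hab c
      rw [Matrix.SpecialLinearGroup.coe_mul]
      exact transvection_mul_apply_same _ _ _ _ _
    have tne : ∀ (B : SLZ n) (a b : Fin n) (hab : a ≠ b) (c : ℤ) (i : Fin n), i ≠ a →
        (Matrix.SpecialLinearGroup.transvection hab c * B : SLZ n) i κ = B i κ := by
      intro B a b hab c i hi
      rw [Matrix.SpecialLinearGroup.coe_mul]
      exact transvection_mul_apply_of_ne _ _ _ _ hi _ _
    set μ : SLZ n → ℕ := fun B => ∑ i ∈ Finset.univ.filter (fun i : Fin n => k ≤ (i : ℕ)),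
      (B i κ).natAbs with hμ
    have hne : S.Nonempty := ⟨g₀ * A, ⟨g₀, hg₀, rfl⟩, h₀⟩
    obtain ⟨B, hBS, hmin⟩ : ∃ B ∈ S, ∀ B' ∈ S, μ B ≤ μ B' := by
      obtain ⟨B, hB, h⟩ := WellFounded.has_min (measure μ).wf S hne
      exact ⟨B, hB, fun B' hB' => not_lt.1 (h B' hB')⟩
    have huniq : ∀ a b : Fin n, k ≤ (a : ℕ) → k ≤ (b : ℕ) → a ≠ b → B a κ ≠ 0 →
        B b κ ≠ 0 → (B b κ).natAbs ≤ (B a κ).natAbs → False := by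
      intro a b ha hb hab hBa hBb hle
      obtain ⟨c, hc⟩ : ∃ c : ℤ, (B a κ + c * B b κ).natAbs < (B a κ).natAbs := by
        rcases lt_or_gt_of_ne hBa with h1 | h1 <;> rcases lt_or_gt_of_ne hBb with h2 | h2
        · exact ⟨-1, by omega⟩
        · exact ⟨1, by omega⟩
        · exact ⟨1, by omega⟩
        · exact ⟨-1, by omega⟩
      refine absurd (hmin _ (step B hBS a b hab c hb)) (not_le.2 ?_)
      refine Finset.sum_lt_sum (fun i _ => ?_) ⟨a, by simp [ha], ?_⟩
      · by_cases hia : i = a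
        · subst hia; rw [tsame]; exact hc.le
        · rw [tne _ _ _ _ _ _ hia]
      · rw [tsame]; exact hc
    have hsum : ∑ i, (B⁻¹ : SLZ n) κ i * B i κ = 1 := by
      have : (B⁻¹ * B : SLZ n) κ κ = 1 := by simp
      rwa [Matrix.SpecialLinearGroup.coe_mul, Matrix.mul_apply] at this
    have hinv : ∀ l : Fin n, (l : ℕ) < k → (B⁻¹ : SLZ n) κ l = 0 := by
      intro l hl
      have h1 : (B⁻¹ * B : SLZ n) κ l = 0 := by
        have : κ ≠ l := by rintro h; rw [← h] at hl; simp [hκ] at hl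
        simp [this]
      rw [Matrix.SpecialLinearGroup.coe_mul, Matrix.mul_apply] at h1
      simpa [hBS.2 l hl, Matrix.one_apply] using h1
    obtain ⟨r, hrk, hr⟩ : ∃ r : Fin n, k ≤ (r : ℕ) ∧ B r κ ≠ 0 := by
      by_contra! hcon
      rw [Finset.sum_eq_zero] at hsum
      · exact zero_ne_one hsum
      · intro i _
        rcases lt_or_ge (i : ℕ) k with h | h
        · rw [hinv i h, zero_mul]
        · rw [hcon i h, mul_zero]
    have hzero : ∀ i : Fin n, k ≤ (i : ℕ) → i ≠ r → B i κ = 0 := by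
      intro i hi hir
      by_contra hne
      rcases le_total (B i κ).natAbs (B r κ).natAbs with h | h
      · exact huniq r i hrk hi hir.symm hr hne h
      · exact huniq i r hi hrk hir hne hr h
    have hunit : B r κ * B r κ = 1 := by
      rw [Finset.sum_eq_single r] at hsum
      · rcases Int.isUnit_iff.1 (IsUnit.of_mul_eq_one_right _ hsum) with h | h <;> rw [h] <;> rfl
      · intro i _ hir
        rcases lt_or_ge (i : ℕ) k with h | h
        · rw [hinv i h, zero_mul]
        · rw [hzero i h hir, mul_zero]
      · simp
    obtain ⟨C, hCS, hC⟩ : ∃ C ∈ S, C κ κ = 1 := by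
      by_cases hrκ : r = κ
      · subst hrκ
        by_cases hlast : k + 1 = n
        · refine ⟨B, hBS, ?_⟩
          have hdet := B.2
          rw [det_of_isUpperTriangular, Finset.prod_eq_single κ] at hdet
          · exact hdet
          · intro i _ hi
            have : (i : ℕ) ≠ k := fun h => hi (Fin.ext h)
            rw [hBS.2 i (by omega), one_apply_eq]
          · simp
          · intro i j hij
            have hij' : (j : ℕ) < i := hij
            rw [hBS.2 j (by omega), one_apply_ne]
            rintro rfl; omega
        · have hs : k + 1 < n := by omega
          set s : Fin n := ⟨k + 1, hs⟩ with hs'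
          have hsκ : s ≠ κ := by simp [hs', hκ]
          have h1 := step B hBS s κ hsκ (B κ κ) le_rfl
          refine ⟨_, step _ h1 κ s hsκ.symm (1 - B κ κ) (Nat.le_succ k), ?_⟩
          rw [tsame, tsame, tne _ _ _ _ _ _ hsκ.symm, hunit, hzero s (Nat.le_succ k) hsκ]
          ring
      · refine ⟨_, step B hBS κ r (Ne.symm hrκ) (B r κ) hrk, ?_⟩
        rw [tsame, hunit, hzero κ le_rfl (Ne.symm hrκ), zero_add]
    have hclear : ∀ T : Finset (Fin n), κ ∉ T →
        ∃ D ∈ S, D κ κ = 1 ∧ ∀ i ∈ T, D i κ = 0 := by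
      intro T
      induction T using Finset.induction_on with
      | empty => exact fun _ => ⟨C, hCS, hC, by simp⟩
      | insert a T haT ihT =>
        intro hκT
        rw [Finset.mem_insert, not_or] at hκT
        obtain ⟨D, hDS, hD1, hD⟩ := ihT hκT.2
        refine ⟨_, step D hDS a κ (Ne.symm hκT.1) (-D a κ) le_rfl, ?_, ?_⟩
        · rw [tne _ _ _ _ _ _ hκT.1, hD1]
        · intro i hi
          rcases Finset.mem_insert.1 hi with rfl | hi
          · rw [tsame, hD1]; ring
          · rw [tne _ _ _ _ _ _ (fun h : i = a => haT (h ▸ hi)), hD i hi]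
    obtain ⟨D, ⟨⟨g, hg, rfl⟩, hD⟩, hD1, hD0⟩ := hclear (Finset.univ.erase κ) (by simp)
    refine ⟨g, hg, fun j hj i => ?_⟩
    rcases Nat.lt_succ_iff_lt_or_eq.1 hj with h | h
    · exact hD j h i
    · obtain rfl : j = κ := Fin.ext h
      by_cases hi : i = κ
      · rw [hi, hD1, one_apply_eq]
      · rw [hD0 i (by simp [hi]), one_apply_ne hi]

theorem eq_top_of_transvection_mem (G : Subgroup (SLZ n))
    (hG : ∀ (i j : Fin n) (hij : i ≠ j), Matrix.SpecialLinearGroup.transvection hij (1 : ℤ) ∈ G) :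
    G = ⊤ := by
  have hG' : ∀ (i j : Fin n) (hij : i ≠ j) (c : ℤ),
      Matrix.SpecialLinearGroup.transvection hij c ∈ G := by
    intro i j hij c
    have hadd : ∀ a b : ℤ, Matrix.SpecialLinearGroup.transvection hij (a + b) =
        Matrix.SpecialLinearGroup.transvection hij a * Matrix.SpecialLinearGroup.transvection hij b := by
      intro a b
      refine Subtype.ext ?_
      exact (transvection_mul_transvection_same _ _ hij a b).symm
    have h0 : Matrix.SpecialLinearGroup.transvection hij (0 : ℤ) = 1 := by
      ext; simp
    have hneg : Matrix.SpecialLinearGroup.transvection hij (-1 : ℤ) ∈ G := by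
      have := hadd (-1) 1
      rw [neg_add_cancel, h0] at this
      rw [eq_inv_of_mul_eq_one_left this.symm]
      exact G.inv_mem (hG i j hij)
    induction c using Int.induction_on with
    | zero => rw [h0]; exact G.one_mem
    | succ m ih => rw [hadd]; exact G.mul_mem ih (hG i j hij)
    | pred m ih => rw [sub_eq_add_neg, hadd]; exact G.mul_mem ih hneg
  refine (Subgroup.eq_top_iff' G).2 fun A => ?_
  obtain ⟨g, hg, h⟩ := exists_row_reduced G hG' A n le_rfl
  have : g * A = 1 := by
    ext i j
    rw [h j j.2 i, Matrix.SpecialLinearGroup.coe_one]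
  rw [eq_inv_of_mul_eq_one_right this]
  exact G.inv_mem hg

end Generation

section PingPong

variable {G X ι : Type*} [Group G]

/-- Reduced words in the cyclic groups generated by the elements `u i`; the first argument
records the index of the leading syllable. -/
inductive ReducedWord (u : ι → G) : Option ι → G → Prop
  | one : ReducedWord u none 1
  | cons (i : ι) (k : ℤ) (hk : k ≠ 0) (o : Option ι) (h : G) (ho : o ≠ some i)
      (hh : ReducedWord u o h) : ReducedWord u (some i) (u i ^ k * h)

theorem ReducedWord.exists_zpow_mul {u : ι → G} (i : ι) (k : ℤ) {o : Option ι} {h : G}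
    (hh : ReducedWord u o h) : ∃ o', ReducedWord u o' (u i ^ k * h) := by
  by_cases hk : k = 0
  · exact ⟨o, by simpa [hk] using hh⟩
  by_cases ho : o = some i
  · cases hh with
    | one => exact absurd ho (by simp)
    | cons j l hl o' h' ho' hh' =>
      obtain rfl : j = i := by simpa using ho
      rw [← mul_assoc, ← _root_.zpow_add]
      by_cases hkl : k + l = 0
      · exact ⟨o', by simpa [hkl] using hh'⟩
      · exact ⟨_, .cons j _ hkl o' h' ho' hh'⟩
  · exact ⟨_, .cons i k hk o h ho hh⟩

theorem exists_reducedWord {u : ι → G} {h : G} (hh : h ∈ Subgroup.closure (Set.range u)) :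
    ∃ o, ReducedWord u o h := by
  induction hh using Subgroup.closure_induction_left with
  | one => exact ⟨_, .one⟩
  | mul_left x hx y hy ih =>
    obtain ⟨i, rfl⟩ := hx
    obtain ⟨o, ho⟩ := ih
    simpa using ho.exists_zpow_mul i 1
  | inv_mul_cancel x hx y hy ih =>
    obtain ⟨i, rfl⟩ := hx
    obtain ⟨o, ho⟩ := ih
    simpa using ho.exists_zpow_mul i (-1)

theorem ping_pong {u : ι → G} {φ : G → X → X} (φ_one : ∀ x, φ 1 x = x)
    (φ_mul : ∀ g h x, φ (g * h) x = φ g (φ h x)) {A C : ι → Set X}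
    (hu : ∀ i, ∀ k : ℤ, k ≠ 0 → ∀ x ∈ C i, φ (u i ^ k) x ∈ A i)
    (hAC : ∀ i j, i ≠ j → A i ⊆ C j) {x₀ : X} (hx₀ : ∀ i, x₀ ∈ C i)
    {h : G} (hh : h ∈ Subgroup.closure (Set.range u)) : h = 1 ∨ ∃ i, φ h x₀ ∈ A i := by
  have key : ∀ (o : Option ι) (h : G), ReducedWord u o h →
      (o = none ∧ h = 1) ∨ ∃ i, o = some i ∧ φ h x₀ ∈ A i := by
    intro o h hw
    induction hw with
    | one => exact .inl ⟨rfl, rfl⟩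
    | cons i k hk o h ho hh ih =>
      refine .inr ⟨i, rfl, ?_⟩
      rw [φ_mul]
      refine hu i k hk _ ?_
      rcases ih with ⟨-, rfl⟩ | ⟨j, hj, hA⟩
      · rw [φ_one]; exact hx₀ i
      · exact hAC j i (by rintro rfl; exact ho hj) hA
  obtain ⟨o, ho⟩ := exists_reducedWord hh
  rcases key o h ho with ⟨-, h1⟩ | ⟨i, -, hi⟩
  · exact .inl h1
  · exact .inr ⟨i, hi⟩

end PingPong

section RankOne

variable {n : ℕ}

/-- The real vector with the given integer coordinates. -/
def toR (x : Fin n → ℤ) : Fin n → ℝ := fun i => (x i : ℝ)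

theorem toR_dot (x y : Fin n → ℤ) : toR x ⬝ᵥ toR y = ((x ⬝ᵥ y : ℤ) : ℝ) := by
  simp [toR, dotProduct]

@[simp] theorem toR_add (x y : Fin n → ℤ) : toR (x + y) = toR x + toR y := by
  ext; simp [toR]

@[simp] theorem toR_sub (x y : Fin n → ℤ) : toR (x - y) = toR x - toR y := by
  ext; simp [toR]

@[simp] theorem toR_smul (k : ℤ) (x : Fin n → ℤ) : toR (k • x) = (k : ℝ) • toR x := by
  ext; simp [toR]

theorem toR_injective : Function.Injective (toR (n := n)) := fun x y h =>
  funext fun i => by simpa [toR] using congrFun h i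

theorem toR_ne_zero {x : Fin n → ℤ} : toR x ≠ 0 ↔ x ≠ 0 := by
  rw [Ne, Ne, not_iff_not]
  exact ⟨fun h => toR_injective (by rw [h]; ext; simp [toR]), fun h => by rw [h]; ext; simp [toR]⟩

theorem matR_one : matR (1 : SLZ n) = 1 := by simp [matR]

theorem matR_mul (g h : SLZ n) : matR (g * h) = matR g * matR h := by simp [matR]

theorem matR_mul_mulVec (g h : SLZ n) (x : Fin n → ℝ) :
    matR (g * h) *ᵥ x = matR g *ᵥ (matR h *ᵥ x) := by rw [matR_mul, mulVec_mulVec]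

theorem matR_inv_mulVec (g : SLZ n) (x : Fin n → ℝ) : matR g⁻¹ *ᵥ (matR g *ᵥ x) = x := by
  rw [← matR_mul_mulVec, inv_mul_cancel, matR_one, one_mulVec]

theorem matR_apply (g : SLZ n) (i j : Fin n) : matR g i j = (g i j : ℝ) := by
  simp [matR]

theorem matR_mulVec_toR (g : SLZ n) (x : Fin n → ℤ) : matR g *ᵥ toR x = toR (g.1 *ᵥ x) := by
  ext i
  simp [mulVec, dotProduct, toR, matR_apply]

open Classical in
/-- The rank one unipotent `1 + y ⊗ F` when `F y = 0` (and `1` otherwise). -/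
noncomputable def tv (y F : Fin n → ℤ) : SLZ n :=
  if h : F ⬝ᵥ y = 0 then
    ⟨1 + vecMulVec y F, by
      rw [vecMulVec_eq Unit, det_one_add_replicateCol_mul_replicateRow, h, add_zero]⟩
  else 1

theorem tv_coe {y F : Fin n → ℤ} (h : F ⬝ᵥ y = 0) :
    (tv y F : SLZ n).1 = 1 + vecMulVec y F := by
  have h' : tv y F = ⟨1 + vecMulVec y F, _⟩ := dif_pos h
  rw [h']

theorem tv_mul {y F F' : Fin n → ℤ} (h : F ⬝ᵥ y = 0) (h' : F' ⬝ᵥ y = 0) :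
    tv y F * tv y F' = tv y (F + F') := by
  refine Subtype.ext ?_
  change (tv y F).1 * (tv y F').1 = (tv y (F + F')).1
  rw [tv_coe h, tv_coe h', tv_coe (by rw [add_dotProduct, h, h', add_zero]), add_mul, mul_add,
    mul_add, vecMulVec_mul_vecMulVec, h, vecMulVec_add]
  simp [add_comm, add_assoc]

theorem tv_zero (y : Fin n → ℤ) : tv y 0 = 1 := by
  refine Subtype.ext ?_
  rw [tv_coe (zero_dotProduct _)]
  ext i j; simp [vecMulVec]

theorem tv_inv {y F : Fin n → ℤ} (h : F ⬝ᵥ y = 0) : (tv y F)⁻¹ = tv y (-F) := by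
  rw [inv_eq_iff_mul_eq_one, tv_mul h (by rw [neg_dotProduct, h, neg_zero]), add_neg_cancel,
    tv_zero]

theorem tv_zpow {y F : Fin n → ℤ} (h : F ⬝ᵥ y = 0) (k : ℤ) : tv y F ^ k = tv y (k • F) := by
  have hs : ∀ m : ℤ, (m • F) ⬝ᵥ y = 0 := fun m => by rw [smul_dotProduct, h, smul_zero]
  induction k with
  | zero => rw [zpow_zero, zero_smul, tv_zero]
  | succ m ih => rw [_root_.zpow_add_one, ih, tv_mul (hs _) h, add_smul, one_smul]
  | pred m ih =>
    rw [_root_.zpow_sub_one, ih, tv_inv h, tv_mul (hs _) (by rw [neg_dotProduct, h, neg_zero]),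
      sub_smul, one_smul, sub_eq_add_neg]

theorem tv_conj (g : SLZ n) {y F : Fin n → ℤ} (h : F ⬝ᵥ y = 0) :
    g * tv y F * g⁻¹ = tv (g.1 *ᵥ y) (F ᵥ* (g⁻¹ : SLZ n).1) := by
  have hg : (g⁻¹ : SLZ n).1 * g.1 = 1 := congrArg Subtype.val (inv_mul_cancel g)
  have hg' : g.1 * (g⁻¹ : SLZ n).1 = 1 := congrArg Subtype.val (mul_inv_cancel g)
  have h' : (F ᵥ* (g⁻¹ : SLZ n).1) ⬝ᵥ (g.1 *ᵥ y) = 0 := by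
    rw [dotProduct_mulVec, vecMul_vecMul, hg, vecMul_one, h]
  refine Subtype.ext ?_
  change g.1 * (tv y F).1 * (g⁻¹ : SLZ n).1 = _
  rw [tv_coe h, tv_coe h', mul_add, add_mul, mul_one, hg', mul_vecMulVec, vecMulVec_mul]

theorem tv_conj_tv {w f y F : Fin n → ℤ} (hf : f ⬝ᵥ w = 0) (h : F ⬝ᵥ y = 0) (κ : ℤ) :
    tv w f ^ κ * tv y F * (tv w f ^ κ)⁻¹ =
      tv (y + κ • (f ⬝ᵥ y) • w) (F - κ • (F ⬝ᵥ w) • f) := by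
  have hs : ∀ m : ℤ, (m • f) ⬝ᵥ w = 0 := fun m => by rw [smul_dotProduct, hf, smul_zero]
  rw [tv_conj _ h]
  congr 1
  · rw [tv_zpow hf, tv_coe (hs _), add_mulVec, one_mulVec, vecMulVec_mulVec, smul_dotProduct,
      op_smul_eq_smul, smul_eq_mul, mul_smul]
  · rw [tv_zpow hf, tv_inv (hs _), ← neg_smul, tv_coe (hs _), vecMul_add, vecMul_one,
      vecMul_vecMulVec]
    ext i; simp; ring

theorem tv_mulVec {y F : Fin n → ℤ} (h : F ⬝ᵥ y = 0) (x : Fin n → ℝ) :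
    matR (tv y F) *ᵥ x = x + (toR F ⬝ᵥ x) • toR y := by
  have : matR (tv y F) = 1 + vecMulVec (toR y) (toR F) := by
    ext i j
    have := congrFun (congrFun (tv_coe h) i) j
    rw [matR_apply, this]
    simp [vecMulVec, toR, Matrix.one_apply]
  rw [this, add_mulVec, one_mulVec, vecMulVec_mulVec]
  ext i; simp

theorem tv_single {i j : Fin n} (hij : i ≠ j) :
    tv (Pi.single i 1) (Pi.single j 1) = Matrix.SpecialLinearGroup.transvection hij (1 : ℤ) := by
  refine Subtype.ext ?_
  rw [tv_coe (by simp [hij])]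
  change _ = Matrix.transvection i j (1 : ℤ)
  rw [Matrix.transvection]
  congr 1
  ext a b
  simp [vecMulVec, Matrix.single, Pi.single_apply]
  aesop

end RankOne

section Flags

open Filter Topology

variable {n : ℕ}

theorem self_dot_pos {x : Fin n → ℝ} (hx : x ≠ 0) : 0 < x ⬝ᵥ x := by
  simpa using (dotProduct_star_self_pos_iff (v := x)).2 hx

/-- The vectors which are not orthogonal to any vector of the closed ball `B(c, r)`. -/
def avoid (c : Fin n → ℝ) (r : ℝ) : Set (Fin n → ℝ) :=
  {x | ∀ ζ ∈ Metric.closedBall c r, ζ ⬝ᵥ x ≠ 0}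

theorem isOpen_avoid (c : Fin n → ℝ) (r : ℝ) : IsOpen (avoid c r) := by
  have : CompactSpace (Metric.closedBall c r) :=
    isCompact_iff_compactSpace.1 (isCompact_closedBall c r)
  have h2 : IsClosed {p : (Fin n → ℝ) × Metric.closedBall c r | (p.2 : Fin n → ℝ) ⬝ᵥ p.1 = 0} :=
    isClosed_eq (by fun_prop) (by fun_prop)
  have h3 := isClosedMap_fst_of_compactSpace _ h2
  rw [← isOpen_compl_iff] at h3
  convert h3 using 1
  ext x
  simp [avoid]

theorem avoid_anti (c : Fin n → ℝ) {r s : ℝ} (h : r ≤ s) : avoid c s ⊆ avoid c r :=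
  fun _ hx ζ hζ => hx ζ (Metric.closedBall_subset_closedBall h hζ)

theorem smul_mem_avoid {c x : Fin n → ℝ} {r t : ℝ} (ht : t ≠ 0) (hx : x ∈ avoid c r) :
    t • x ∈ avoid c r := fun ζ hζ => by
  rw [dotProduct_smul]; exact smul_ne_zero ht (hx ζ hζ)

theorem center_dot_ne_zero {c x : Fin n → ℝ} {r : ℝ} (hr : 0 ≤ r) (hx : x ∈ avoid c r) :
    c ⬝ᵥ x ≠ 0 := hx c (Metric.mem_closedBall_self hr)

theorem ne_zero_of_mem_avoid {c x : Fin n → ℝ} {r : ℝ} (hr : 0 ≤ r) (hx : x ∈ avoid c r) :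
    x ≠ 0 := by
  rintro rfl; exact center_dot_ne_zero hr hx (dotProduct_zero _)

theorem closedBall_subset_avoid_comm {a b : Fin n → ℝ} {r s : ℝ} :
    Metric.closedBall a r ⊆ avoid b s ↔ Metric.closedBall b s ⊆ avoid a r := by
  constructor <;> exact fun h x hx ζ hζ => by rw [dotProduct_comm]; exact h hζ x hx

theorem eventually_mem_avoid {p v : Fin n → ℝ} (h : v ⬝ᵥ p ≠ 0) :
    ∀ᶠ ε in 𝓝[>] (0 : ℝ), p ∈ avoid v ε := by
  have h1 : IsOpen {ζ : Fin n → ℝ | ζ ⬝ᵥ p ≠ 0} := isOpen_ne_fun (by fun_prop) (by fun_prop)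
  obtain ⟨ε, hε, hs⟩ := Metric.nhds_basis_closedBall.mem_iff.1 (h1.mem_nhds h)
  filter_upwards [Ioo_mem_nhdsGT hε] with r hr
  exact fun ζ hζ => hs (Metric.closedBall_subset_closedBall hr.2.le hζ)

theorem eventually_closedBall_subset_avoid {y v : Fin n → ℝ} (h : v ⬝ᵥ y ≠ 0) :
    ∀ᶠ ε in 𝓝[>] (0 : ℝ), Metric.closedBall y ε ⊆ avoid v ε := by
  obtain ⟨r, h1, hr⟩ := ((eventually_mem_avoid h).and self_mem_nhdsWithin).exists
  filter_upwards [mem_nhdsWithin_of_mem_nhds (eventually_closedBall_subset ((isOpen_avoid v r).mem_nhds h1)), Ioo_mem_nhdsGT hr]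
    with ε h2 h3
  exact h2.trans (avoid_anti v h3.2.le)

/-- Pairs `(p, v)` in general position with respect to the balls around `v₀` and `y₀`. -/
def sepSet (y₀ v₀ : Fin n → ℝ) (ε : ℝ) : Set ((Fin n → ℝ) × (Fin n → ℝ)) :=
  avoid v₀ ε ×ˢ avoid y₀ ε

theorem isOpen_sepSet (y₀ v₀ : Fin n → ℝ) (ε : ℝ) : IsOpen (sepSet y₀ v₀ ε) :=
  (isOpen_avoid _ _).prod (isOpen_avoid _ _)

theorem sepSet_anti (y₀ v₀ : Fin n → ℝ) {r s : ℝ} (h : r ≤ s) :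
    sepSet y₀ v₀ s ⊆ sepSet y₀ v₀ r :=
  Set.prod_mono (avoid_anti _ h) (avoid_anti _ h)

/-- Every hyperplane meeting `B(e, ρ)` contains the point of a flag of `U`. -/
def Good (e : Fin n → ℝ) (ρ : ℝ) (U : Set ((Fin n → ℝ) × (Fin n → ℝ))) : Prop :=
  ∀ φ : Fin n → ℝ, φ ≠ 0 → φ ∉ avoid e ρ → ∃ q ∈ U, q.1 ⬝ᵥ q.2 = 0 ∧ φ ⬝ᵥ q.1 = 0

theorem eventually_add_mul_ne (a : ℝ) {b : ℝ} (hb : b ≠ 0) :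
    ∀ᶠ s in 𝓝[≠] (0 : ℝ), a + s * b ≠ 0 := by
  have h1 : ∀ᶠ s in 𝓝[≠] (0 : ℝ), s ≠ -a / b := by
    by_cases h : -a / b = 0
    · rw [h]; exact self_mem_nhdsWithin
    · exact mem_nhdsWithin_of_mem_nhds (isOpen_ne.mem_nhds (Ne.symm h))
  filter_upwards [h1] with s hs h
  exact hs (by field_simp; linarith)

theorem Good.exists_inter_sepSet_local {e : Fin n → ℝ} {ρ : ℝ} (hρ : 0 ≤ ρ)
    {U : Set ((Fin n → ℝ) × (Fin n → ℝ))} (hU : IsOpen U) (hUe : U ⊆ sepSet e e ρ)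
    (hG : Good e ρ U) {y v : Fin n → ℝ} (hyv : y ⬝ᵥ v = 0) (hy : y ≠ 0) (hv : v ∈ avoid e ρ)
    {φ : Fin n → ℝ} (hφ : φ ≠ 0) (hφe : φ ∉ avoid e ρ) :
    ∃ ε > 0, ∀ᶠ ψ in 𝓝 φ, ∃ q ∈ U ∩ sepSet y v ε, q.1 ⬝ᵥ q.2 = 0 ∧ ψ ⬝ᵥ q.1 = 0 := by
  obtain ⟨⟨p, w⟩, hpwU, hpw, hφp⟩ := hG φ hφ hφe
  simp only at hpw hφp
  obtain ⟨z, hz, hφz⟩ : ∃ z ∈ Metric.closedBall e ρ, z ⬝ᵥ φ = 0 := by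
    simpa [avoid] using hφe
  have hvz : v ⬝ᵥ z ≠ 0 := by rw [dotProduct_comm]; exact hv z hz
  have hp : p ≠ 0 := ne_zero_of_mem_avoid hρ (hUe hpwU).1
  obtain ⟨s, hs1, hs2, hs3⟩ : ∃ s : ℝ, v ⬝ᵥ (p + s • z) ≠ 0 ∧ (p + s • z) ⬝ᵥ (p + s • z) ≠ 0 ∧
      (p + s • z, w - ((w ⬝ᵥ (p + s • z)) / ((p + s • z) ⬝ᵥ (p + s • z))) • (p + s • z)) ∈ U := by
    have hpp := (self_dot_pos hp).ne'
    have c1 : ContinuousAt (fun s : ℝ => (p + s • z) ⬝ᵥ (p + s • z)) 0 := by fun_prop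
    have e1 : ∀ᶠ s in 𝓝 (0 : ℝ), (p + s • z) ⬝ᵥ (p + s • z) ≠ 0 :=
      c1.eventually_ne (by simpa using hpp)
    have c2 : ContinuousAt (fun s : ℝ => (p + s • z,
        w - ((w ⬝ᵥ (p + s • z)) / ((p + s • z) ⬝ᵥ (p + s • z))) • (p + s • z))) 0 := by
      refine ContinuousAt.prodMk (by fun_prop) (ContinuousAt.sub (by fun_prop)
        (ContinuousAt.smul (ContinuousAt.div (by fun_prop) c1 (by simpa using hpp))
          (by fun_prop)))
    have e2 := c2.preimage_mem_nhds (t := U) (hU.mem_nhds (by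
      simpa [dotProduct_comm w p, hpw] using hpwU))
    have e3 := eventually_add_mul_ne (v ⬝ᵥ p) hvz
    obtain ⟨s, h3, h1, h2⟩ := (e3.and ((e1.filter_mono nhdsWithin_le_nhds).and
      (mem_nhdsWithin_of_mem_nhds e2))).exists
    exact ⟨s, by simpa [dotProduct_add] using h3, h1, h2⟩
  have hφp' : φ ⬝ᵥ (p + s • z) = 0 := by
    rw [dotProduct_add, hφp, dotProduct_smul, dotProduct_comm, hφz]; simp
  set P := p + s • z
  set W := w - ((w ⬝ᵥ P) / (P ⬝ᵥ P)) • P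
  have hWP : W ⬝ᵥ P = 0 := by
    simp only [W, sub_dotProduct, smul_dotProduct, smul_eq_mul]
    field_simp; ring
  set q := y - ((y ⬝ᵥ P) / (v ⬝ᵥ P)) • v
  have hqP : q ⬝ᵥ P = 0 := by
    simp only [q, sub_dotProduct, smul_dotProduct, smul_eq_mul]
    field_simp; ring
  have hqy : q ⬝ᵥ y ≠ 0 := by
    have : q ⬝ᵥ y = y ⬝ᵥ y := by
      simp only [q, sub_dotProduct, smul_dotProduct, smul_eq_mul]
      rw [dotProduct_comm v y, hyv]; ring
    rw [this]; exact (self_dot_pos hy).ne'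
  obtain ⟨s', hs1', hs2'⟩ : ∃ s' : ℝ, (W + s' • q) ⬝ᵥ y ≠ 0 ∧ (P, W + s' • q) ∈ U := by
    have c2 : ContinuousAt (fun s : ℝ => (P, W + s • q)) 0 := by fun_prop
    have e2 := c2.preimage_mem_nhds (t := U) (hU.mem_nhds (by simpa using hs3))
    have e3 := eventually_add_mul_ne (W ⬝ᵥ y) hqy
    obtain ⟨s, h3, h2⟩ := (e3.and (mem_nhdsWithin_of_mem_nhds e2)).exists
    exact ⟨s, by simpa [add_dotProduct] using h3, h2⟩
  set V := W + s' • q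
  have hVP : V ⬝ᵥ P = 0 := by
    simp only [V, add_dotProduct, smul_dotProduct, hWP, hqP]; simp
  have hVz : V ⬝ᵥ z ≠ 0 := by rw [dotProduct_comm]; exact (hUe hs2').2 z hz
  set r := φ - ((V ⬝ᵥ φ) / (V ⬝ᵥ z)) • z
  have hVr : V ⬝ᵥ r = 0 := by
    simp only [r, dotProduct_sub, dotProduct_smul, smul_eq_mul]
    field_simp; ring
  have hφr : φ ⬝ᵥ r ≠ 0 := by
    have : φ ⬝ᵥ r = φ ⬝ᵥ φ := by
      simp only [r, dotProduct_sub, dotProduct_smul, smul_eq_mul]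
      rw [dotProduct_comm φ z, hφz]; ring
    rw [this]; exact (self_dot_pos hφ).ne'
  obtain ⟨ε, ⟨h1, h2⟩, hε⟩ := (((eventually_mem_avoid hs1).and (eventually_mem_avoid (p := V)
    (v := y) (by rwa [dotProduct_comm]))).and self_mem_nhdsWithin).exists
  refine ⟨ε, hε, ?_⟩
  have c₀ : ContinuousAt (fun ψ : Fin n → ℝ => ψ ⬝ᵥ r) φ := by fun_prop
  have c : ContinuousAt (fun ψ : Fin n → ℝ => (P - ((ψ ⬝ᵥ P) / (ψ ⬝ᵥ r)) • r, V)) φ := by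
    exact ContinuousAt.prodMk (continuousAt_const.sub
        (ContinuousAt.smul (ContinuousAt.div (by fun_prop) c₀ hφr)
          continuousAt_const)) continuousAt_const
  have e1 := c.preimage_mem_nhds (t := U ∩ sepSet y v ε)
    ((hU.inter (isOpen_sepSet _ _ _)).mem_nhds (by simpa [hφp'] using ⟨hs2', h1, h2⟩))
  have e2 : ∀ᶠ ψ in 𝓝 φ, ψ ⬝ᵥ r ≠ 0 :=
    c₀.eventually_ne hφr
  filter_upwards [e1, e2] with ψ h1 h2
  refine ⟨_, h1, ?_, ?_⟩
  · simp only [sub_dotProduct, smul_dotProduct]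
    rw [dotProduct_comm P, dotProduct_comm r, hVP, hVr]; simp
  · simp only [dotProduct_sub, dotProduct_smul, smul_eq_mul]
    field_simp; ring

theorem Good.exists_inter_sepSet {e : Fin n → ℝ} {ρ : ℝ} (hρ : 0 ≤ ρ)
    {U : Set ((Fin n → ℝ) × (Fin n → ℝ))} (hU : IsOpen U) (hUe : U ⊆ sepSet e e ρ)
    (hG : Good e ρ U) {y v : Fin n → ℝ} (hyv : y ⬝ᵥ v = 0) (hy : y ≠ 0) (hv : v ∈ avoid e ρ) :
    ∃ ε > 0, Good e ρ (U ∩ sepSet y v ε) := by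
  have key : ∃ ε > 0, ∀ φ ∈ Metric.sphere (0 : Fin n → ℝ) 1, φ ∉ avoid e ρ →
      ∃ q ∈ U ∩ sepSet y v ε, q.1 ⬝ᵥ q.2 = 0 ∧ φ ⬝ᵥ q.1 = 0 := by
    refine (isCompact_sphere (0 : Fin n → ℝ) 1).induction_on
      (p := fun S => ∃ ε > 0, ∀ φ ∈ S, φ ∉ avoid e ρ →
        ∃ q ∈ U ∩ sepSet y v ε, q.1 ⬝ᵥ q.2 = 0 ∧ φ ⬝ᵥ q.1 = 0) ⟨1, one_pos, by simp⟩ ?_ ?_ ?_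
    · rintro S T hST ⟨ε, hε, h⟩
      exact ⟨ε, hε, fun φ hφ => h φ (hST hφ)⟩
    · rintro S T ⟨ε, hε, h⟩ ⟨ε', hε', h'⟩
      refine ⟨min ε ε', lt_min hε hε', ?_⟩
      rintro φ (hφ | hφ) ha
      · obtain ⟨q, hq, hq'⟩ := h φ hφ ha
        exact ⟨q, ⟨hq.1, sepSet_anti _ _ (min_le_left _ _) hq.2⟩, hq'⟩
      · obtain ⟨q, hq, hq'⟩ := h' φ hφ ha
        exact ⟨q, ⟨hq.1, sepSet_anti _ _ (min_le_right _ _) hq.2⟩, hq'⟩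
    · intro φ hφ
      by_cases ha : φ ∈ avoid e ρ
      · exact ⟨avoid e ρ, mem_nhdsWithin_of_mem_nhds ((isOpen_avoid e ρ).mem_nhds ha), 1,
          one_pos, fun ψ h h' => absurd h h'⟩
      · have hφ0 : φ ≠ 0 := by rintro rfl; simp at hφ
        obtain ⟨ε, hε, h⟩ := hG.exists_inter_sepSet_local hρ hU hUe hyv hy hv hφ0 ha
        exact ⟨_, mem_nhdsWithin_of_mem_nhds h, ε, hε, fun ψ hψ _ => hψ⟩
  obtain ⟨ε, hε, h⟩ := key
  refine ⟨ε, hε, fun φ hφ ha => ?_⟩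
  have hn : ‖φ‖⁻¹ ≠ 0 := inv_ne_zero (norm_ne_zero_iff.2 hφ)
  obtain ⟨q, hq, h1, h2⟩ := h (‖φ‖⁻¹ • φ) (by simp [norm_smul, norm_ne_zero_iff.2 hφ])
    (fun h' => ha (by simpa [hφ] using smul_mem_avoid (inv_ne_zero hn) h'))
  refine ⟨q, hq, h1, ?_⟩
  rw [smul_dotProduct] at h2
  exact (smul_eq_zero.1 h2).resolve_left hn

theorem exists_ne_zero_dot_eq_zero (hn : 3 ≤ n) (z φ : Fin n → ℝ) :
    ∃ y : Fin n → ℝ, y ≠ 0 ∧ z ⬝ᵥ y = 0 ∧ φ ⬝ᵥ y = 0 := by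
  let L : (Fin n → ℝ) →ₗ[ℝ] (Fin 2 → ℝ) := Matrix.mulVecLin (Matrix.of ![z, φ])
  have : LinearMap.ker L ≠ ⊥ := LinearMap.ker_ne_bot_of_finrank_lt (by simp; omega)
  obtain ⟨y, hy, hy0⟩ := (Submodule.ne_bot_iff _).1 this
  refine ⟨y, hy0, ?_, ?_⟩
  · simpa [L, mulVec] using congrFun (LinearMap.mem_ker.1 hy) 0
  · simpa [L, mulVec] using congrFun (LinearMap.mem_ker.1 hy) 1

theorem good_sepSet_single (hn : 3 ≤ n) (i₀ : Fin n) :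
    Good (Pi.single i₀ 1) (1 / (8 * n)) (sepSet (Pi.single i₀ 1) (Pi.single i₀ 1) (1 / (8 * n))) := by
  intro φ hφ ha
  have hn' : (3 : ℝ) ≤ n := by exact_mod_cast hn
  set ρ : ℝ := 1 / (8 * n) with hρ
  have hρn : ρ * n = 1 / 8 := by rw [hρ]; field_simp
  have hρ1 : ρ ≤ 1 / 24 := by rw [hρ]; gcongr; linarith
  have hρ0 : 0 < ρ := by rw [hρ]; positivity
  set e : Fin n → ℝ := Pi.single i₀ 1
  obtain ⟨z, hz, hzφ⟩ : ∃ z ∈ Metric.closedBall e ρ, z ⬝ᵥ φ = 0 := by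
    simpa [avoid] using ha
  have hzS : 3 / 4 ≤ z ⬝ᵥ z := by
    have h1 : |z i₀ - 1| ≤ ρ := by
      have := (dist_le_pi_dist z e i₀).trans hz
      simpa [e, Real.dist_eq] using this
    have h2 : z i₀ * z i₀ ≤ z ⬝ᵥ z :=
      Finset.single_le_sum (f := fun i => z i * z i) (fun i _ => mul_self_nonneg _)
        (Finset.mem_univ i₀)
    have := abs_le.1 h1
    nlinarith
  obtain ⟨y₀, hy₀, hzy₀, hφy₀⟩ := exists_ne_zero_dot_eq_zero hn z φ
  have hpos := self_dot_pos hy₀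
  obtain ⟨y, hzy, hφy, hyy⟩ : ∃ y : Fin n → ℝ, z ⬝ᵥ y = 0 ∧ φ ⬝ᵥ y = 0 ∧ y ⬝ᵥ y = z ⬝ᵥ z := by
    refine ⟨√(z ⬝ᵥ z / (y₀ ⬝ᵥ y₀)) • y₀, by simp [hzy₀], by simp [hφy₀], ?_⟩
    rw [smul_dotProduct, dotProduct_smul, smul_smul, Real.mul_self_sqrt (by positivity),
      smul_eq_mul]
    field_simp
  have key : ∀ y : Fin n → ℝ, z ⬝ᵥ y = 0 → y ⬝ᵥ y = z ⬝ᵥ z → z + y ∈ avoid e ρ := by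
    intro y hzy hyy ζ hζ
    have hb : ∀ i, |ζ i - z i| ≤ 2 * ρ := fun i => by
      have h1 := (dist_le_pi_dist ζ e i).trans hζ
      have h2 := (dist_le_pi_dist z e i).trans hz
      rw [Real.dist_eq, abs_le] at h1 h2
      rw [abs_le]; constructor <;> linarith [h1.1, h1.2, h2.1, h2.2]
    have hd : ∀ x : Fin n → ℝ, x ⬝ᵥ x = z ⬝ᵥ z → |(ζ - z) ⬝ᵥ x| ≤ ρ * (n + z ⬝ᵥ z) := by
      intro x hx
      calc |(ζ - z) ⬝ᵥ x| ≤ ∑ i, |(ζ - z) i * x i| := Finset.abs_sum_le_sum_abs _ _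
        _ ≤ ∑ i, ρ * (1 + x i * x i) := by
          refine Finset.sum_le_sum fun i _ => ?_
          rw [abs_mul, Pi.sub_apply]
          have h1 : 2 * |x i| ≤ 1 + x i * x i := by
            nlinarith [sq_nonneg (|x i| - 1), abs_mul_abs_self (x i)]
          nlinarith [hb i, abs_nonneg (x i)]
        _ = ρ * (n + z ⬝ᵥ z) := by
          rw [← Finset.mul_sum, Finset.sum_add_distrib, ← hx]; simp [dotProduct]
    have h1 := abs_le.1 (hd z rfl)
    have h2 := abs_le.1 (hd y hyy)
    have h3 : ζ ⬝ᵥ (z + y) = z ⬝ᵥ z + (ζ - z) ⬝ᵥ z + (ζ - z) ⬝ᵥ y := by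
      simp only [sub_dotProduct, dotProduct_add, hzy]; ring
    rw [h3]
    nlinarith
  refine ⟨(z + y, z - y), ⟨key y hzy hyy, ?_⟩, ?_, ?_⟩
  · rw [sub_eq_add_neg]
    exact key (-y) (by simp [hzy]) (by simp [hyy])
  · simp [add_dotProduct, dotProduct_sub, hzy, hyy, dotProduct_comm y z]
  · simp [dotProduct_add, hφy, dotProduct_comm φ z, hzφ]

end Flags

section States

open Filter Topology

variable {n : ℕ}

/-- All nontrivial powers of `u` map `avoid v ε` into the cone over `B(y, ε)`. -/
def Ping (y v : Fin n → ℝ) (ε : ℝ) (u : SLZ n) : Prop :=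
  ∀ k : ℤ, k ≠ 0 → ∀ x ∈ avoid v ε, ∃ t : ℝ, t ≠ 0 ∧
    t • (matR (u ^ k) *ᵥ x) ∈ Metric.closedBall y ε

theorem mul_norm_lt_abs_dot {v x : Fin n → ℝ} {ε : ℝ} (hε : 0 < ε) (hx : x ∈ avoid v ε) :
    ε * ‖x‖ < |v ⬝ᵥ x| := by
  have hx0 := ne_zero_of_mem_avoid hε.le hx
  have : Nonempty (Fin n) := by
    by_contra h
    rw [not_nonempty_iff] at h
    exact hx0 (Subsingleton.elim _ _)
  obtain ⟨i, hi⟩ : ∃ i, ‖x‖ = |x i| := by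
    obtain ⟨i, hi⟩ := Finite.exists_max (fun i => |x i|)
    exact ⟨i, le_antisymm ((pi_norm_le_iff_of_nonneg (abs_nonneg _)).2 hi) (norm_le_pi_norm x i)⟩
  have hxi : 0 < |x i| := hi ▸ norm_pos_iff.2 hx0
  by_contra! hle
  refine hx (v - Pi.single i ((v ⬝ᵥ x) / x i)) ?_ ?_
  · rw [mem_closedBall_iff_norm, sub_sub_cancel_left, norm_neg, Pi.norm_single, Real.norm_eq_abs,
      abs_div, div_le_iff₀ hxi, ← hi]
    exact hle
  · have : x i ≠ 0 := abs_pos.1 hxi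
    rw [sub_dotProduct, single_dotProduct]
    field_simp; ring

theorem exists_ping_tv {ε : ℝ} (hε : 0 < ε) (v a : Fin n → ℝ) :
    ∃ N₀ : ℝ, ∀ N ≥ N₀, ∀ y F : Fin n → ℤ, F ⬝ᵥ y = 0 → toR F = N • v + a →
      Ping (toR y) v ε (tv y F) := by
  refine ⟨(∑ i, |a i| + 1 / ε) / ε, fun N hN y F hFy hF k hk x hx => ?_⟩
  have h1 := mul_norm_lt_abs_dot hε hx
  have hx0 : 0 < ‖x‖ := norm_pos_iff.2 (ne_zero_of_mem_avoid hε.le hx)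
  have hs : 0 ≤ ∑ i, |a i| := Finset.sum_nonneg fun i _ => abs_nonneg _
  rw [ge_iff_le, div_le_iff₀ hε] at hN
  have hN0 : 0 ≤ N := by
    by_contra! h
    have : 0 < 1 / ε := by positivity
    nlinarith
  have h2 : |a ⬝ᵥ x| ≤ (∑ i, |a i|) * ‖x‖ := by
    rw [Finset.sum_mul]
    refine (Finset.abs_sum_le_sum_abs _ _).trans (Finset.sum_le_sum fun i _ => ?_)
    rw [abs_mul]
    exact mul_le_mul_of_nonneg_left (norm_le_pi_norm x i) (abs_nonneg _)
  have h3 : ‖x‖ / ε ≤ |toR F ⬝ᵥ x| := by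
    have h4 : N * |v ⬝ᵥ x| - |a ⬝ᵥ x| ≤ |toR F ⬝ᵥ x| := by
      rw [hF, add_dotProduct, smul_dotProduct, smul_eq_mul, ← abs_of_nonneg hN0, ← abs_mul,
        abs_of_nonneg hN0]
      have := abs_sub_abs_le_abs_sub (N * v ⬝ᵥ x) (-(a ⬝ᵥ x))
      rwa [abs_neg, sub_neg_eq_add] at this
    have h5 : (∑ i, |a i| + 1 / ε) * ‖x‖ ≤ N * |v ⬝ᵥ x| := by
      calc _ ≤ N * ε * ‖x‖ := by gcongr
        _ = N * (ε * ‖x‖) := by ring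
        _ ≤ _ := by gcongr
    have h6 : (∑ i, |a i| + 1 / ε) * ‖x‖ = (∑ i, |a i|) * ‖x‖ + ‖x‖ / ε := by ring
    linarith
  have hk1 : (1 : ℝ) ≤ |(k : ℝ)| := by exact_mod_cast Int.one_le_abs hk
  have hFx : 0 < |toR F ⬝ᵥ x| := lt_of_lt_of_le (by positivity) h3
  have hkF : (k : ℝ) * (toR F ⬝ᵥ x) ≠ 0 :=
    mul_ne_zero (by exact_mod_cast hk) (abs_pos.1 hFx)
  refine ⟨((k : ℝ) * (toR F ⬝ᵥ x))⁻¹, inv_ne_zero hkF, ?_⟩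
  rw [tv_zpow hFy, tv_mulVec (by rw [smul_dotProduct, hFy, smul_zero]), toR_smul, smul_dotProduct,
    smul_eq_mul, smul_add, smul_smul, inv_mul_cancel₀ hkF, one_smul, mem_closedBall_iff_norm,
    add_sub_cancel_right, norm_smul, norm_inv, Real.norm_eq_abs, abs_mul,
    inv_mul_le_iff₀ (by positivity)]
  rw [div_le_iff₀ hε] at h3
  calc ‖x‖ ≤ 1 * (|toR F ⬝ᵥ x| * ε) := by linarith
    _ ≤ |(k : ℝ)| * (|toR F ⬝ᵥ x| * ε) := by gcongr
    _ = _ := by ring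

/-- An element `u` together with its attracting point `y` and repelling hyperplane `v`. -/
structure Datum (n : ℕ) where
  y : Fin n → ℝ
  v : Fin n → ℝ
  ε : ℝ
  u : SLZ n

/-- The pairs in general position with respect to `(e, e)` and all data of `Q`. -/
def flags (e : Fin n → ℝ) (ρ : ℝ) (Q : Set (Datum n)) : Set ((Fin n → ℝ) × (Fin n → ℝ)) :=
  sepSet e e ρ ∩ ⋂ d ∈ Q, sepSet d.y d.v d.ε

/-- A finite ping-pong configuration which leaves enough room for extensions. -/
structure IsState (e : Fin n → ℝ) (ρ : ℝ) (Q : Set (Datum n)) : Prop where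
  finite : Q.Finite
  pos : ∀ d ∈ Q, 0 < d.ε
  ping : ∀ d ∈ Q, Ping d.y d.v d.ε d.u
  pair : ∀ d ∈ Q, ∀ d' ∈ Q, d ≠ d' → Metric.closedBall d.y d.ε ⊆ avoid d'.v d'.ε
  base_v : ∀ d ∈ Q, Metric.closedBall e ρ ⊆ avoid d.v d.ε
  base_y : ∀ d ∈ Q, Metric.closedBall d.y d.ε ⊆ avoid e ρ
  good : Good e ρ (flags e ρ Q)
  good_swap : Good e ρ (Prod.swap ⁻¹' flags e ρ Q)

theorem Good.mono {e : Fin n → ℝ} {ρ : ℝ} {U V : Set ((Fin n → ℝ) × (Fin n → ℝ))}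
    (h : Good e ρ U) (hUV : U ⊆ V) : Good e ρ V := fun φ hφ ha => by
  obtain ⟨q, hq, hq'⟩ := h φ hφ ha
  exact ⟨q, hUV hq, hq'⟩

theorem mem_flags {e : Fin n → ℝ} {ρ : ℝ} {Q : Set (Datum n)} {q : (Fin n → ℝ) × (Fin n → ℝ)} :
    q ∈ flags e ρ Q ↔ (q.1 ∈ avoid e ρ ∧ q.2 ∈ avoid e ρ) ∧
      ∀ d ∈ Q, q.1 ∈ avoid d.v d.ε ∧ q.2 ∈ avoid d.y d.ε := by
  simp [flags, sepSet, Set.mem_prod]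

theorem isOpen_flags (e : Fin n → ℝ) (ρ : ℝ) {Q : Set (Datum n)} (hQ : Q.Finite) :
    IsOpen (flags e ρ Q) :=
  (isOpen_sepSet _ _ _).inter (hQ.isOpen_biInter fun _ _ => isOpen_sepSet _ _ _)

theorem smul_mem_flags {e : Fin n → ℝ} {ρ : ℝ} {Q : Set (Datum n)} {p v : Fin n → ℝ} {s t : ℝ}
    (hs : s ≠ 0) (ht : t ≠ 0) (h : (p, v) ∈ flags e ρ Q) : (s • p, t • v) ∈ flags e ρ Q := by
  rw [mem_flags] at h ⊢
  exact ⟨⟨smul_mem_avoid hs h.1.1, smul_mem_avoid ht h.1.2⟩,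
    fun d hd => ⟨smul_mem_avoid hs (h.2 d hd).1, smul_mem_avoid ht (h.2 d hd).2⟩⟩

theorem isState_empty (hn : 3 ≤ n) (i₀ : Fin n) :
    IsState (Pi.single i₀ 1) (1 / (8 * n)) ∅ where
  finite := Set.finite_empty
  pos := by simp
  ping := by simp
  pair := by simp
  base_v := by simp
  base_y := by simp
  good := (good_sepSet_single hn i₀).mono fun q hq => by simpa [flags] using hq
  good_swap := (good_sepSet_single hn i₀).mono fun q hq => by
    simpa [flags, sepSet, Set.mem_prod, and_comm] using hq

theorem IsState.exists_good {e : Fin n → ℝ} {ρ : ℝ} (hρ : 0 ≤ ρ) {Q : Set (Datum n)}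
    (hQ : IsState e ρ Q) {I : Type*} {y v : I → Fin n → ℝ}
    (hmem : ∀ a, (y a, v a) ∈ flags e ρ Q) (h0 : ∀ a, y a ⬝ᵥ v a = 0) (s : Finset I) :
    ∃ ε > 0, Good e ρ (flags e ρ Q ∩ ⋂ a ∈ s, sepSet (y a) (v a) ε) ∧
      Good e ρ (Prod.swap ⁻¹' (flags e ρ Q ∩ ⋂ a ∈ s, sepSet (y a) (v a) ε)) := by
  classical
  induction s using Finset.induction_on with
  | empty => exact ⟨1, one_pos, by simpa using hQ.good, by simpa using hQ.good_swap⟩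
  | insert b s hb ih =>
    obtain ⟨ε, hε, h1, h2⟩ := ih
    have hU : IsOpen (flags e ρ Q ∩ ⋂ a ∈ s, sepSet (y a) (v a) ε) :=
      (isOpen_flags e ρ hQ.finite).inter (isOpen_biInter_finset fun _ _ => isOpen_sepSet _ _ _)
    have hsub : flags e ρ Q ∩ ⋂ a ∈ s, sepSet (y a) (v a) ε ⊆ sepSet e e ρ :=
      fun q hq => hq.1.1
    have hb' := (mem_flags.1 (hmem b)).1
    obtain ⟨ε₁, hε₁, h1'⟩ := h1.exists_inter_sepSet hρ hU hsub (h0 b)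
      (ne_zero_of_mem_avoid hρ hb'.1) hb'.2
    obtain ⟨ε₂, hε₂, h2'⟩ := h2.exists_inter_sepSet hρ (hU.preimage continuous_swap)
      (fun q hq => ⟨(hsub hq).2, (hsub hq).1⟩) (by rw [dotProduct_comm]; exact h0 b)
      (ne_zero_of_mem_avoid hρ hb'.2) hb'.1
    have key : ∀ r, min ε (min ε₁ ε₂) ≤ r → ∀ c, sepSet (y c) (v c) r ⊆
        sepSet (y c) (v c) (min ε (min ε₁ ε₂)) := fun r hr c => sepSet_anti _ _ hr
    refine ⟨min ε (min ε₁ ε₂), by positivity, h1'.mono ?_, h2'.mono ?_⟩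
    · rintro q ⟨⟨hq, hq1⟩, hq2⟩
      refine ⟨hq, ?_⟩
      simp only [Set.mem_iInter, Finset.mem_insert, forall_eq_or_imp] at hq1 ⊢
      exact ⟨key _ (by simp) _ hq2, fun a ha => key _ (by simp) _ (hq1 a ha)⟩
    · rintro q ⟨⟨hq, hq1⟩, hq2⟩
      refine ⟨hq, ?_⟩
      simp only [Set.mem_iInter, Finset.mem_insert, forall_eq_or_imp] at hq1 ⊢
      exact ⟨key ε₂ (by simp) _ ⟨hq2.2, hq2.1⟩, fun a ha => key _ (by simp) _ (hq1 a ha)⟩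

theorem IsState.exists_extension {e : Fin n → ℝ} {ρ : ℝ} (hρ : 0 ≤ ρ) {Q : Set (Datum n)}
    (hQ : IsState e ρ Q) {I : Type*} [Fintype I] {y v : I → Fin n → ℝ}
    (hmem : ∀ a, (y a, v a) ∈ flags e ρ Q) (h0 : ∀ a, y a ⬝ᵥ v a = 0)
    (hne : ∀ a b, a ≠ b → v a ⬝ᵥ y b ≠ 0) :
    ∃ ε > 0, ∀ u : I → SLZ n, (∀ a, Ping (y a) (v a) ε (u a)) →
      IsState e ρ (Q ∪ Set.range fun a => ⟨y a, v a, ε, u a⟩) := by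
  obtain ⟨ε₀, hε₀, hg, hg'⟩ := hQ.exists_good hρ hmem h0 Finset.univ
  have e0 : ∀ᶠ ε in 𝓝[>] (0 : ℝ), ε ≤ ε₀ := by
    filter_upwards [Ioo_mem_nhdsGT hε₀] with ε h using h.2.le
  have e1 : ∀ᶠ ε in 𝓝[>] (0 : ℝ), ∀ a b, a ≠ b → Metric.closedBall (y b) ε ⊆ avoid (v a) ε := by
    simp only [eventually_all]
    exact fun a b hab => eventually_closedBall_subset_avoid (hne a b hab)
  have hball : ∀ {S : Set (Fin n → ℝ)} {c : Fin n → ℝ}, IsOpen S → c ∈ S →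
      ∀ᶠ ε in 𝓝[>] (0 : ℝ), Metric.closedBall c ε ⊆ S := fun hS hc =>
    (eventually_closedBall_subset (hS.mem_nhds hc)).filter_mono nhdsWithin_le_nhds
  have e2 : ∀ᶠ ε in 𝓝[>] (0 : ℝ), ∀ a, ∀ d ∈ Q, Metric.closedBall (y a) ε ⊆ avoid d.v d.ε ∧
      Metric.closedBall (v a) ε ⊆ avoid d.y d.ε := by
    simp only [eventually_all, eventually_all_finite hQ.finite]
    intro a d hd
    have := (mem_flags.1 (hmem a)).2 d hd
    exact (hball (isOpen_avoid _ _) this.1).and (hball (isOpen_avoid _ _) this.2)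
  have e3 : ∀ᶠ ε in 𝓝[>] (0 : ℝ), ∀ a, Metric.closedBall (y a) ε ⊆ avoid e ρ ∧
      Metric.closedBall (v a) ε ⊆ avoid e ρ := by
    simp only [eventually_all]
    intro a
    have := (mem_flags.1 (hmem a)).1
    exact (hball (isOpen_avoid _ _) this.1).and (hball (isOpen_avoid _ _) this.2)
  obtain ⟨ε, h0', h1, h2, h3, hε⟩ :=
    (e0.and (e1.and (e2.and (e3.and self_mem_nhdsWithin)))).exists
  refine ⟨ε, hε, fun u hu => ?_⟩
  have hsub : flags e ρ Q ∩ ⋂ a ∈ (Finset.univ : Finset I), sepSet (y a) (v a) ε₀ ⊆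
      flags e ρ (Q ∪ Set.range fun a => ⟨y a, v a, ε, u a⟩) := by
    rintro q ⟨hq, hq'⟩
    refine ⟨hq.1, ?_⟩
    have hq2 := hq.2
    simp only [Set.mem_iInter, Finset.mem_univ, true_imp_iff] at hq' hq2 ⊢
    rintro d (hd | ⟨a, rfl⟩)
    · exact hq2 d hd
    · exact sepSet_anti _ _ h0' (hq' a)
  refine ⟨hQ.finite.union (Set.finite_range _), ?_, ?_, ?_, ?_, ?_, hg.mono hsub,
    hg'.mono (Set.preimage_mono hsub)⟩
  · rintro d (hd | ⟨a, rfl⟩)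
    exacts [hQ.pos d hd, hε]
  · rintro d (hd | ⟨a, rfl⟩)
    exacts [hQ.ping d hd, hu a]
  · rintro d (hd | ⟨a, rfl⟩) d' (hd' | ⟨b, rfl⟩) hdd
    · exact hQ.pair d hd d' hd' hdd
    · exact closedBall_subset_avoid_comm.1 (h2 b d hd).2
    · exact (h2 a d' hd').1
    · exact h1 b a (by rintro rfl; exact hdd rfl)
  · rintro d (hd | ⟨a, rfl⟩)
    exacts [hQ.base_v d hd, closedBall_subset_avoid_comm.1 (h3 a).2]
  · rintro d (hd | ⟨a, rfl⟩)
    exacts [hQ.base_y d hd, (h3 a).1]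

end States

section Rational

open Filter Topology

theorem dense_ne_zero {ι : Type*} (ℓ : (ι → ℝ) →ₗ[ℝ] ℝ) (hℓ : ℓ ≠ 0) :
    Dense {x | ℓ x ≠ 0} := by
  obtain ⟨w, hw⟩ : ∃ w, ℓ w ≠ 0 := by
    by_contra! h
    exact hℓ (LinearMap.ext h)
  intro x
  have h1 : Tendsto (fun s : ℝ => x + s • w) (𝓝[≠] 0) (𝓝 x) := by
    have : ContinuousAt (fun s : ℝ => x + s • w) 0 := by fun_prop
    have h := this.tendsto
    simp only [zero_smul, add_zero] at h
    exact h.mono_left nhdsWithin_le_nhds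
  refine mem_closure_of_tendsto h1 ?_
  filter_upwards [eventually_add_mul_ne (ℓ x) hw] with s hs
  simpa using hs

/-- Rational approximation, with common denominator and generic with respect to finitely many
linear forms. -/
theorem exists_int_smul_mem {ι B : Type*} [Fintype ι] [Finite B] {O : Set (ι → ℝ)} {c₀ : ι → ℝ}
    (hO : O ∈ 𝓝 c₀) (ℓ : B → (ι → ℝ) →ₗ[ℝ] ℝ) (hℓ : ∀ b, ℓ b ≠ 0) :
    ∃ (L : ℕ) (m : ι → ℤ), 0 < L ∧ ((L : ℝ)⁻¹ • fun i => (m i : ℝ)) ∈ O ∧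
      ∀ b, ℓ b (fun i => (m i : ℝ)) ≠ 0 := by
  have hop : ∀ b, IsOpen {x | ℓ b x ≠ 0} := fun b =>
    isOpen_ne_fun (LinearMap.continuous_of_finiteDimensional _) continuous_const
  have hd : Dense (⋂ b, {x | ℓ b x ≠ 0}) :=
    dense_iInter_of_isOpen hop fun b => dense_ne_zero _ (hℓ b)
  have hop' : IsOpen (interior O ∩ ⋂ b, {x | ℓ b x ≠ 0}) :=
    isOpen_interior.inter (isOpen_iInter_of_finite hop)
  have hne : (interior O ∩ ⋂ b, {x | ℓ b x ≠ 0}).Nonempty :=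
    hd.inter_open_nonempty _ isOpen_interior ⟨c₀, mem_interior_iff_mem_nhds.2 hO⟩
  have hQ : DenseRange (fun c : ι → ℚ => fun i => (c i : ℝ)) :=
    DenseRange.piMap fun _ => Rat.denseRange_cast
  obtain ⟨c, hc⟩ := hQ.exists_mem_open hop' hne
  set L : ℕ := ∏ i, (c i).den
  have hL : 0 < L := Finset.prod_pos fun i _ => (c i).den_pos
  have hm : ∀ i, ∃ m : ℤ, (m : ℝ) = L * (c i : ℝ) := by
    intro i
    obtain ⟨k, hk⟩ : (c i).den ∣ L := Finset.dvd_prod_of_mem _ (Finset.mem_univ i)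
    refine ⟨k * (c i).num, ?_⟩
    rw [hk]
    have : ((c i : ℚ) : ℝ) * (c i).den = (c i).num := by exact_mod_cast Rat.mul_den_eq_num (c i)
    push_cast
    linear_combination -(k : ℝ) * this
  choose m hm using hm
  have hL' : (L : ℝ) ≠ 0 := by positivity
  have hmc : (fun i => (m i : ℝ)) = (L : ℝ) • fun i => (c i : ℝ) := by
    ext i; simp [hm]
  refine ⟨L, m, hL, ?_, fun b => ?_⟩
  · rw [hmc, smul_smul, inv_mul_cancel₀ hL', one_smul]
    exact interior_subset hc.1
  · rw [hmc, map_smul]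
    exact smul_ne_zero hL' (Set.mem_iInter.1 hc.2 b)

variable {n : ℕ}

/-- Integer points of the hyperplane orthogonal to an integer vector approximate any direction,
generically. -/
theorem exists_int_orth {B : Type*} [Finite B] {V : Fin n → ℤ} (hV : V ≠ 0) {p : Fin n → ℝ}
    (hp : p ⬝ᵥ toR V = 0) {O : Set (Fin n → ℝ)} (hO : O ∈ 𝓝 p)
    (hcone : ∀ x ∈ O, ∀ t : ℝ, 0 < t → t • x ∈ O) (z : B → Fin n → ℝ)
    (hz : ∀ b, (toR V ⬝ᵥ toR V) • z b - (toR V ⬝ᵥ z b) • toR V ≠ 0) :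
    ∃ P : Fin n → ℤ, P ⬝ᵥ V = 0 ∧ toR P ∈ O ∧ ∀ b, toR P ⬝ᵥ z b ≠ 0 := by
  have hVV : 0 < toR V ⬝ᵥ toR V := self_dot_pos (toR_ne_zero.2 hV)
  set π : (Fin n → ℝ) → (Fin n → ℝ) :=
    fun x => (toR V ⬝ᵥ toR V) • x - (x ⬝ᵥ toR V) • toR V with hπ
  have hc : ContinuousAt (fun x => (toR V ⬝ᵥ toR V)⁻¹ • π x) p := by fun_prop
  have hO' := hc.preimage_mem_nhds (t := O) (by
    simp only [hπ, hp, zero_smul, sub_zero, smul_smul, inv_mul_cancel₀ hVV.ne', one_smul]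
    exact hO)
  let ℓ : B → (Fin n → ℝ) →ₗ[ℝ] ℝ := fun b =>
    LinearMap.mk (AddHom.mk (fun x => π x ⬝ᵥ z b) (by
      intro x y; simp only [hπ, sub_dotProduct, smul_dotProduct, add_dotProduct, smul_eq_mul]
      ring)) (by
      intro t x; simp only [hπ, sub_dotProduct, smul_dotProduct, smul_eq_mul, RingHom.id_apply]
      ring)
  have hℓz : ∀ b x, ℓ b x = x ⬝ᵥ ((toR V ⬝ᵥ toR V) • z b - (toR V ⬝ᵥ z b) • toR V) := by
    intro b x
    change π x ⬝ᵥ z b = _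
    simp only [hπ, sub_dotProduct, dotProduct_sub, smul_dotProduct, dotProduct_smul, smul_eq_mul]
    ring
  obtain ⟨L, m, hL, hm, hm'⟩ := exists_int_smul_mem hO' ℓ (fun b h => by
    have := hℓz b ((toR V ⬝ᵥ toR V) • z b - (toR V ⬝ᵥ z b) • toR V)
    rw [h, LinearMap.zero_apply] at this
    exact (self_dot_pos (hz b)).ne this)
  have hP : toR ((V ⬝ᵥ V) • m - (m ⬝ᵥ V) • V) = π (toR m) := by
    rw [toR_sub, toR_smul, toR_smul, ← toR_dot, ← toR_dot]
  refine ⟨(V ⬝ᵥ V) • m - (m ⬝ᵥ V) • V, ?_, ?_, fun b => ?_⟩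
  · rw [sub_dotProduct, smul_dotProduct, smul_dotProduct, smul_eq_mul, smul_eq_mul, mul_comm,
      sub_self]
  · have h1 := hcone _ hm (L * (toR V ⬝ᵥ toR V)) (by positivity)
    rw [hP]
    convert h1 using 1
    have hL' : (L : ℝ) ≠ 0 := by positivity
    have h2 : π ((L : ℝ)⁻¹ • toR m) = (L : ℝ)⁻¹ • π (toR m) := by
      simp only [hπ, smul_dotProduct, smul_sub, smul_smul, smul_eq_mul]
      congr 2; ring
    change _ = _ • _ • π ((L : ℝ)⁻¹ • toR m)
    rw [h2, smul_smul, smul_smul]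
    rw [mul_inv_cancel_right₀ hVV.ne', mul_inv_cancel₀ hL', one_smul]
  · rw [hP]; exact hm' b

theorem IsState.exists_fixing {e : Fin n → ℝ} {ρ : ℝ} (hρ : 0 ≤ ρ) {Q : Set (Datum n)}
    (hQ : IsState e ρ Q) {x : Fin n → ℤ} (hx : x ≠ 0) (hxe : toR x ∉ avoid e ρ) :
    ∃ Q', Q ⊆ Q' ∧ IsState e ρ Q' ∧ ∃ P F : Fin n → ℤ, F ⬝ᵥ P = 0 ∧ F ⬝ᵥ x = 0 ∧ P ≠ 0 ∧ F ≠ 0 ∧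
      ∃ d ∈ Q', d.u = tv P F := by
  obtain ⟨⟨v, p⟩, hpv, hpv0, hxv⟩ := hQ.good_swap (toR x) (toR_ne_zero.2 hx) hxe
  change (p, v) ∈ flags e ρ Q at hpv
  simp only at hpv0 hxv
  have hop := isOpen_flags e ρ hQ.finite
  have hv : v ≠ 0 := ne_zero_of_mem_avoid hρ (mem_flags.1 hpv).1.2
  have c : ContinuousAt (fun c : Fin n → ℝ => (p - ((p ⬝ᵥ c) / (c ⬝ᵥ c)) • c, c)) v := by
    have c₁ : ContinuousAt (fun c : Fin n → ℝ => p ⬝ᵥ c) v := by fun_prop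
    have c₂ : ContinuousAt (fun c : Fin n → ℝ => c ⬝ᵥ c) v := by fun_prop
    exact (continuousAt_const.sub ((c₁.div c₂ (self_dot_pos hv).ne').smul continuousAt_id)).prodMk
      continuousAt_id
  obtain ⟨V, hVx, hV, -⟩ := exists_int_orth (B := Empty) hx (by rwa [dotProduct_comm])
    (c.preimage_mem_nhds (t := flags e ρ Q) (hop.mem_nhds (by
      simpa [dotProduct_comm p v, hpv0] using hpv))) (by
      intro c hc t ht
      have := smul_mem_flags one_ne_zero ht.ne' hc
      rw [one_smul] at this
      have h2 : (p ⬝ᵥ (t • c) / ((t • c) ⬝ᵥ (t • c))) • (t • c) = (p ⬝ᵥ c / c ⬝ᵥ c) • c := by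
        simp only [dotProduct_smul, smul_dotProduct, smul_smul, smul_eq_mul]
        congr 1
        rcases eq_or_ne (c ⬝ᵥ c) 0 with h | h
        · simp [h]
        · field_simp
      simpa only [Set.mem_preimage, h2] using this) nofun nofun
  have hV' := hV
  simp only [Set.mem_preimage] at hV'
  have hV0' : toR V ≠ 0 := ne_zero_of_mem_avoid hρ (mem_flags.1 hV').1.2
  have hV0 : V ≠ 0 := toR_ne_zero.1 hV0'
  have hVV := (self_dot_pos hV0').ne'
  set p' := p - ((p ⬝ᵥ toR V) / (toR V ⬝ᵥ toR V)) • toR V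
  obtain ⟨P, hPV, hP, -⟩ := exists_int_orth (B := Empty) (p := p')
    (O := {c | (c, toR V) ∈ flags e ρ Q}) hV0 (by
      simp only [p', sub_dotProduct, smul_dotProduct, smul_eq_mul]; field_simp; ring)
    ((hop.preimage (by fun_prop : Continuous fun c : Fin n → ℝ => (c, toR V))).mem_nhds hV') (by
      intro c hc t ht
      simpa using smul_mem_flags ht.ne' one_ne_zero hc) nofun nofun
  have hP0 : P ≠ 0 := toR_ne_zero.1 (ne_zero_of_mem_avoid hρ (mem_flags.1 hP).1.1)
  obtain ⟨ε, hε, h⟩ := hQ.exists_extension hρ (I := Unit) (y := fun _ => toR P)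
    (v := fun _ => toR V) (fun _ => hP) (fun _ => by rw [toR_dot, hPV, Int.cast_zero])
    (fun a b hab => absurd rfl hab)
  obtain ⟨N₀, hN₀⟩ := exists_ping_tv hε (toR V) 0
  obtain ⟨N, hN⟩ := exists_nat_ge (max N₀ 1)
  have hN1 : (1 : ℝ) ≤ N := (le_max_right _ _).trans hN
  have hNV : ((N : ℤ) • V) ⬝ᵥ P = 0 := by
    rw [smul_dotProduct, dotProduct_comm, hPV, smul_zero]
  refine ⟨_, Set.subset_union_left, h (fun _ => tv P ((N : ℤ) • V)) (fun _ =>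
    hN₀ N ((le_max_left _ _).trans hN) P _ hNV (by
      rw [toR_smul, add_zero, Int.cast_natCast])), P, (N : ℤ) • V, hNV, ?_, hP0, ?_,
    ⟨toR P, toR V, ε, tv P ((N : ℤ) • V)⟩, .inr ⟨(), rfl⟩, rfl⟩
  · rw [smul_dotProduct, hVx, smul_zero]
  · refine smul_ne_zero ?_ hV0
    have : 0 < N := by exact_mod_cast lt_of_lt_of_le one_pos hN1
    exact_mod_cast this.ne'

end Rational

section Slides

open Filter Topology

variable {n : ℕ} {R : Type*} [CommRing R]

/-- The action of `(1 + w ⊗ f) ^ κ` on vectors. -/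
def slide (w f : Fin n → R) (κ : R) (x : Fin n → R) : Fin n → R :=
  x + κ • (f ⬝ᵥ x) • w

/-- The action of `(1 + w ⊗ f) ^ κ` on covectors. -/
def coslide (w f : Fin n → R) (κ : R) (V : Fin n → R) : Fin n → R :=
  V - κ • (V ⬝ᵥ w) • f

theorem coslide_dot_slide {w f : Fin n → R} (h : f ⬝ᵥ w = 0) (κ κ' : R) (V x : Fin n → R) :
    coslide w f κ V ⬝ᵥ slide w f κ' x = V ⬝ᵥ slide w f (κ' - κ) x := by
  simp only [coslide, slide, sub_dotProduct, dotProduct_add, dotProduct_smul, smul_dotProduct,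
    smul_eq_mul, h]
  ring

theorem toR_slide (w f x : Fin n → ℤ) (κ : ℤ) :
    toR (slide w f κ x) = slide (toR w) (toR f) (κ : ℝ) (toR x) := by
  rw [slide, toR_add, toR_smul, toR_smul, slide, toR_dot]

theorem toR_coslide (w f V : Fin n → ℤ) (κ : ℤ) :
    toR (coslide w f κ V) = coslide (toR w) (toR f) (κ : ℝ) (toR V) := by
  rw [coslide, toR_sub, toR_smul, toR_smul, coslide, toR_dot]

theorem slide_smul (w f : Fin n → R) (κ t : R) (x : Fin n → R) :
    slide w f κ (t • x) = t • slide w f κ x := by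
  ext i; simp [slide]; ring

theorem coslide_smul (w f : Fin n → R) (κ t : R) (V : Fin n → R) :
    coslide w f κ (t • V) = t • coslide w f κ V := by
  ext i; simp [coslide]; ring

theorem coslide_add (w f : Fin n → R) (κ : R) (V V' : Fin n → R) :
    coslide w f κ (V + V') = coslide w f κ V + coslide w f κ V' := by
  ext i; simp [coslide]; ring

/-- Exponents which are distinct, and in arithmetic progression for fixed `i`. -/
def expo (i : Fin n) (s : Fin 3) : ℤ := 3 * (i : ℕ) + (s : ℕ)

theorem expo_injective {i i' : Fin n} {s s' : Fin 3} (h : expo i s = expo i' s') :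
    i = i' ∧ s = s' := by
  have := s.2
  have := s'.2
  unfold expo at h
  refine ⟨Fin.ext ?_, Fin.ext ?_⟩ <;> omega

/-- The sequence `A, A + B, B`. -/
def mix {M : Type*} [Add M] (s : Fin 3) (A B : M) : M := ![A, A + B, B] s

theorem mix_dot (s : Fin 3) (A B x : Fin n → R) : mix s A B ⬝ᵥ x = mix s (A ⬝ᵥ x) (B ⬝ᵥ x) := by
  fin_cases s
  exacts [rfl, add_dotProduct _ _ _, rfl]

theorem mix_smul {M : Type*} [AddCommGroup M] [Module R M] (s : Fin 3) (t : R) (A B : M) :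
    mix s (t • A) (t • B) = t • mix s A B := by
  fin_cases s
  exacts [rfl, (smul_add _ _ _).symm, rfl]

theorem toR_mix (s : Fin 3) (A B : Fin n → ℤ) : toR (mix s A B) = mix s (toR A) (toR B) := by
  fin_cases s
  exacts [rfl, toR_add _ _, rfl]

theorem mix_add {M : Type*} [AddCommGroup M] (s : Fin 3) (A B A' B' : M) :
    mix s (A + A') (B + B') = mix s A B + mix s A' B' := by
  fin_cases s
  exacts [rfl, add_add_add_comm _ _ _ _, rfl]

theorem continuous_mix {M X : Type*} [TopologicalSpace X] [TopologicalSpace M] [Add M]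
    [ContinuousAdd M] (s : Fin 3) {A B : X → M} (hA : Continuous A) (hB : Continuous B) :
    Continuous fun x => mix s (A x) (B x) := by
  fin_cases s
  exacts [hA, hA.add hB, hB]

theorem slide_single_apply (w f : Fin n → R) (κ : R) (j l : Fin n) :
    slide w f κ (Pi.single j 1) l = (Pi.single j 1 : Fin n → R) l + κ * (f j * w l) := by
  simp [slide]

theorem exists_slide_single_ne_zero (hn : 3 ≤ n) {w f : Fin n → ℝ} (hw : ∀ j, w j ≠ 0)
    (hf : ∀ j, f j ≠ 0) {j j' : Fin n} {m : ℝ} (h : j = j' → m ≠ 0) :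
    ∃ l ≠ j, slide w f m (Pi.single j' 1) l ≠ 0 := by
  rcases eq_or_ne m 0 with rfl | hm
  · have hj : j' ≠ j := fun h' => h h'.symm rfl
    exact ⟨j', hj, by simp [slide]⟩
  · obtain ⟨l, hl⟩ : ∃ l, l ∉ ({j, j'} : Finset (Fin n)) := by
      by_contra! h
      have h1 : (Finset.univ : Finset (Fin n)) ⊆ {j, j'} := fun x _ => h x
      have h2 := (Finset.card_le_card h1).trans Finset.card_le_two
      rw [Finset.card_univ, Fintype.card_fin] at h2
      omega
    simp only [Finset.mem_insert, Finset.mem_singleton, not_or] at hl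
    refine ⟨l, hl.1, ?_⟩
    rw [slide_single_apply, Pi.single_eq_of_ne hl.2, zero_add]
    exact mul_ne_zero hm (mul_ne_zero (hf _) (hw _))

/-- Zeroing out one coordinate. -/
def mask (j : Fin n) (A : Fin n → R) : Fin n → R := Function.update A j 0

theorem mask_single {j l : Fin n} (h : l ≠ j) :
    mask j (Pi.single l 1 : Fin n → R) = Pi.single l 1 := by
  ext i
  rcases eq_or_ne i j with rfl | hi
  · simp [mask, h.symm]
  · simp [mask, hi]

theorem mask_add (j : Fin n) (A B : Fin n → R) : mask j (A + B) = mask j A + mask j B := by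
  ext i
  rcases eq_or_ne i j with rfl | hi <;> simp [mask, *]

theorem mask_smul (j : Fin n) (t : R) (A : Fin n → R) : mask j (t • A) = t • mask j A := by
  ext i
  rcases eq_or_ne i j with rfl | hi <;> simp [mask, *]

theorem toR_mask (j : Fin n) (A : Fin n → ℤ) : toR (mask j A) = mask j (toR A) := by
  ext i
  rcases eq_or_ne i j with rfl | hi <;> simp [mask, toR, *]

theorem exists_generic_coslides (hn : 3 ≤ n) {w f : Fin n → ℝ} (hw : ∀ j, w j ≠ 0)
    (hf : ∀ j, f j ≠ 0) {U : Set ((Fin n → ℝ) × (Fin n → ℝ))} (hU : IsOpen U)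
    (hUs : ∀ p v, ∀ t : ℝ, t ≠ 0 → (p, v) ∈ U → (p, t • v) ∈ U)
    {A₀ B₀ : Fin n → Fin n → Fin n → ℝ} (hA₀ : ∀ j i, A₀ j i j = 0) (hB₀ : ∀ j i, B₀ j i j = 0)
    (hmem : ∀ j i s, (slide w f (expo i s) (Pi.single j 1),
      coslide w f (expo i s) (mix s (A₀ j i) (B₀ j i))) ∈ U) :
    ∃ A B : Fin n → Fin n → Fin n → ℤ, (∀ j i, A j i j = 0) ∧ (∀ j i, B j i j = 0) ∧
      (∀ j i s, (slide w f (expo i s) (Pi.single j 1),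
        coslide w f (expo i s) (mix s (toR (A j i)) (toR (B j i)))) ∈ U) ∧
      ∀ j i s j' i' s', (j, i, s) ≠ (j', i', s') → mix s (toR (A j i)) (toR (B j i)) ⬝ᵥ
        slide w f (expo i' s' - expo i s : ℝ) (Pi.single j' 1) ≠ 0 := by
  let α : (Fin n × Fin n × Bool × Fin n → ℝ) → Bool → Fin n → Fin n → Fin n → ℝ :=
    fun c b j i => mask j fun l => c (j, i, b, l)
  have hα_add : ∀ c c' b j i, α (c + c') b j i = α c b j i + α c' b j i := fun c c' b j i =>
    mask_add j _ _
  have hα_smul : ∀ (t : ℝ) c b j i, α (t • c) b j i = t • α c b j i := fun t c b j i =>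
    mask_smul j t _
  have hα : ∀ b j i, Continuous fun c => α c b j i := fun b j i => by
    refine continuous_pi fun l => ?_
    rcases eq_or_ne l j with rfl | hl
    · simp only [α, mask, Function.update_self]; exact continuous_const
    · simp only [α, mask, Function.update_of_ne hl]; fun_prop
  let Z := {q : (Fin n × Fin n × Fin 3) × (Fin n × Fin n × Fin 3) // q.1 ≠ q.2}
  let z : Z → Fin n → ℝ := fun q =>
    slide w f (expo q.1.2.2.1 q.1.2.2.2 - expo q.1.1.2.1 q.1.1.2.2 : ℝ) (Pi.single q.1.2.1 1)
  let ℓ : Z → (Fin n × Fin n × Bool × Fin n → ℝ) →ₗ[ℝ] ℝ := fun q =>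
    { toFun := fun c => mix q.1.1.2.2 (α c false q.1.1.1 q.1.1.2.1)
        (α c true q.1.1.1 q.1.1.2.1) ⬝ᵥ z q
      map_add' := fun c c' => by rw [hα_add, hα_add, mix_add, add_dotProduct]
      map_smul' := fun t c => by
        rw [hα_smul, hα_smul, mix_smul, smul_dotProduct, RingHom.id_apply] }
  have hℓ : ∀ q, ℓ q ≠ 0 := by
    rintro ⟨⟨⟨j, i, s⟩, ⟨j', i', s'⟩⟩, hq⟩ h
    obtain ⟨l, hl, hl'⟩ := exists_slide_single_ne_zero hn hw hf (j := j) (j' := j')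
      (m := (expo i' s' - expo i s : ℝ)) (by
        rintro rfl h0
        obtain ⟨rfl, rfl⟩ := expo_injective (Int.cast_injective (sub_eq_zero.1 h0))
        exact hq rfl)
    obtain ⟨b, hb⟩ : ∃ b : Bool, mix s (if b = false then (1 : ℝ) else 0)
        (if b = true then 1 else 0) = 1 := by
      fin_cases s
      exacts [⟨false, by simp [mix]⟩, ⟨false, by simp [mix]⟩, ⟨true, by simp [mix]⟩]
    have h1 : mix s (α (fun p => if p = (j, i, b, l) then 1 else 0) false j i)
        (α (fun p => if p = (j, i, b, l) then 1 else 0) true j i) ⬝ᵥ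
          slide w f (expo i' s' - expo i s : ℝ) (Pi.single j' 1) = 0 :=
      LinearMap.congr_fun h (fun p => if p = (j, i, b, l) then 1 else 0)
    have h2 : ∀ b', α (fun p => if p = (j, i, b, l) then 1 else 0) b' j i =
        (if b = b' then (1 : ℝ) else 0) • Pi.single l 1 := by
      intro b'
      rw [← mask_single hl, ← mask_smul]
      change mask _ _ = _
      congr 1
      ext k
      by_cases hb' : b' = b <;> by_cases hk : k = l <;> simp [hb', hk, Ne.symm]
    rw [h2, h2, mix_dot, smul_dotProduct, smul_dotProduct, smul_eq_mul, smul_eq_mul,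
      single_dotProduct, one_mul, mul_comm, mul_comm _ (slide _ _ _ _ l), ← smul_eq_mul, ← smul_eq_mul,
      mix_smul, hb, smul_eq_mul, mul_one] at h1
    exact hl' h1
  let c₀ : Fin n × Fin n × Bool × Fin n → ℝ := fun p =>
    if p.2.2.1 then B₀ p.1 p.2.1 p.2.2.2 else A₀ p.1 p.2.1 p.2.2.2
  have hc₀ : ∀ j i, α c₀ false j i = A₀ j i ∧ α c₀ true j i = B₀ j i := fun j i => by
    constructor <;> ext l <;> rcases eq_or_ne l j with rfl | hl <;> simp [α, mask, c₀, *]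
  have hO : {c | ∀ j i s, (slide w f (expo i s) (Pi.single j 1),
      coslide w f (expo i s) (mix s (α c false j i) (α c true j i))) ∈ U} ∈ 𝓝 c₀ := by
    simp only [Set.ofPred_forall, Filter.iInter_mem]
    intro j i s
    have hc : Continuous fun c => (slide w f (expo i s) (Pi.single j 1),
        coslide w f (expo i s) (mix s (α c false j i) (α c true j i))) := by
      have := continuous_mix s (hα false j i) (hα true j i)
      unfold coslide
      fun_prop
    refine (hU.preimage hc).mem_nhds ?_
    simp only [Set.mem_preimage, hc₀]
    exact hmem j i s
  obtain ⟨L, m, hL, hm, hm'⟩ := exists_int_smul_mem hO ℓ hℓ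
  have hα' : ∀ b j i, toR (mask j fun l => m (j, i, b, l)) = α (fun p => (m p : ℝ)) b j i :=
    fun b j i => toR_mask _ _
  refine ⟨fun j i => mask j fun l => m (j, i, false, l),
    fun j i => mask j fun l => m (j, i, true, l), fun j i => by simp [mask],
    fun j i => by simp [mask], fun j i s => ?_, fun j i s j' i' s' hne => ?_⟩
  · have hL' : (L : ℝ) ≠ 0 := by positivity
    have := hUs _ _ L hL' (hm j i s)
    rw [hα_smul, hα_smul, mix_smul, coslide_smul, smul_smul, mul_inv_cancel₀ hL', one_smul] at this
    rwa [hα', hα']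
  · rw [hα', hα']
    exact hm' ⟨(⟨j, i, s⟩, ⟨j', i', s'⟩), hne⟩

end Slides

section Bases

open Filter Topology

variable {n : ℕ}

theorem eventually_add_natCast_mul_ne (d : ℤ) {c : ℤ} (hc : c ≠ 0) :
    ∀ᶠ M : ℕ in atTop, d + M * c ≠ 0 := by
  filter_upwards [eventually_gt_atTop d.natAbs] with M hM h
  have h1 : (d.natAbs : ℤ) = M * c.natAbs := by
    rw [Int.natCast_natAbs, Int.natCast_natAbs, eq_neg_of_add_eq_zero_left h, abs_neg, abs_mul,
      Nat.abs_cast]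
  have h2 : 1 ≤ c.natAbs := Int.natAbs_pos.2 hc
  have h3 : d.natAbs = M * c.natAbs := by exact_mod_cast h1
  nlinarith

theorem toR_single (j : Fin n) : toR (Pi.single j 1) = Pi.single j 1 := by
  ext i
  rcases eq_or_ne i j with rfl | h <;> simp [toR, *]

theorem mem_nhds_smul {N : Set (Fin n → ℝ)} (hNs : ∀ x ∈ N, ∀ t : ℝ, t ≠ 0 → t • x ∈ N)
    {x : Fin n → ℝ} (hx : N ∈ 𝓝 x) {t : ℝ} (ht : t ≠ 0) : N ∈ 𝓝 (t • x) := by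
  have hc : ContinuousAt (fun y : Fin n → ℝ => t⁻¹ • y) (t • x) := by fun_prop
  have := hc.preimage_mem_nhds (t := N) (by rwa [smul_smul, inv_mul_cancel₀ ht, one_smul])
  filter_upwards [this] with y hy
  simpa [smul_smul, mul_inv_cancel₀ ht] using hNs _ hy t ht

/-- A basis of `ℤⁿ` inside a given open cone, in general position with respect to `(w, f)`. -/
theorem exists_basis_mem (hn : 2 ≤ n) {w f : Fin n → ℤ} (hw : w ≠ 0) (hf : f ≠ 0)
    (hfw : f ⬝ᵥ w = 0) {N : Set (Fin n → ℝ)} {w₁ : Fin n → ℝ} (hN : N ∈ 𝓝 w₁)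
    (hNs : ∀ x ∈ N, ∀ t : ℝ, t ≠ 0 → t • x ∈ N) :
    ∃ γ : SLZ n, (∀ j, toR (γ.1 *ᵥ Pi.single j 1) ∈ N) ∧ (∀ j, (f ᵥ* γ.1) j ≠ 0) ∧
      ∀ j, ((γ⁻¹ : SLZ n).1 *ᵥ w) j ≠ 0 := by
  have hN' : {x | N ∈ 𝓝 x} ∈ 𝓝 w₁ := eventually_eventually_nhds.2 hN
  obtain ⟨L, a, hL, ha, ha'⟩ := exists_int_smul_mem hN'
    (fun o : Option (Fin n) => o.elim (dotProductBilin ℝ ℝ (toR f)) LinearMap.proj) (by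
      rintro (_ | j) h
      · have := LinearMap.congr_fun h (toR f)
        exact (self_dot_pos (toR_ne_zero.2 hf)).ne' this
      · have := LinearMap.congr_fun h (Pi.single j 1)
        simp at this)
  have hL' : (L : ℝ) ≠ 0 := by positivity
  have haN : N ∈ 𝓝 (toR a) := by
    have := mem_nhds_smul hNs ha hL'
    rwa [smul_smul, mul_inv_cancel₀ hL', one_smul] at this
  have haj : ∀ j, a j ≠ 0 := fun j h => ha' (some j) (by simp [h])
  have hfa : f ⬝ᵥ a ≠ 0 := fun h => ha' none (by
    change toR f ⬝ᵥ toR a = 0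
    rw [toR_dot, h, Int.cast_zero])
  have ha0 : a ≠ 0 := fun h => haj ⟨0, by omega⟩ (by rw [h]; rfl)
  obtain ⟨b, hba, -, hb⟩ := exists_int_orth (p := 0) ha0 (by simp) univ_mem
    (fun _ _ _ _ => Set.mem_univ _) (fun o : Option (Fin n) => toR (o.elim w (Pi.single · 1))) (by
      rintro (_ | j) h
      · have h1 : (a ⬝ᵥ a) • w - (a ⬝ᵥ w) • a = 0 := by
          apply toR_injective
          rw [toR_sub, toR_smul, toR_smul, ← toR_dot, ← toR_dot]
          exact h.trans (by ext; simp [toR])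
        have h2 := congrArg (f ⬝ᵥ ·) h1
        simp only [dotProduct_sub, dotProduct_smul, hfw, dotProduct_zero, smul_eq_mul, mul_zero,
          zero_sub, neg_eq_zero, mul_eq_zero, hfa, or_false] at h2
        rw [h2, zero_smul, sub_zero] at h1
        rcases smul_eq_zero.1 h1 with h3 | h3
        · exact (self_dot_pos (toR_ne_zero.2 ha0)).ne' (by rw [toR_dot, h3, Int.cast_zero])
        · exact hw h3
      · obtain ⟨l, hl⟩ : ∃ l : Fin n, l ≠ j := by
          have : Nontrivial (Fin n) := Fin.nontrivial_iff_two_le.2 hn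
          exact exists_ne j
        have := congrFun h l
        simp only [Option.elim, toR_single, Pi.sub_apply, Pi.smul_apply, Pi.single_eq_of_ne hl,
          smul_eq_mul, mul_zero, zero_sub, dotProduct_single, mul_one, Pi.zero_apply, neg_eq_zero,
          mul_eq_zero] at this
        rcases this with h | h
        exacts [haj j (Int.cast_eq_zero.1 h), haj l (Int.cast_eq_zero.1 h)])
  have hbj : ∀ j, b j ≠ 0 := fun j h => hb (some j) (by
    rw [toR_dot]; simp [h])
  have hbw : b ⬝ᵥ w ≠ 0 := fun h => hb none (by
    rw [toR_dot]; simp [h])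
  have e1 : ∀ᶠ M : ℕ in atTop, ∀ j, f j + M * (b j * f ⬝ᵥ a) ≠ 0 :=
    eventually_all.2 fun j => eventually_add_natCast_mul_ne _ (mul_ne_zero (hbj j) hfa)
  have e2 : ∀ᶠ M : ℕ in atTop, ∀ j, w j + M * (-(b ⬝ᵥ w * a j)) ≠ 0 :=
    eventually_all.2 fun j => eventually_add_natCast_mul_ne _
      (neg_ne_zero.2 (mul_ne_zero hbw (haj j)))
  have e3 : ∀ᶠ M : ℕ in atTop, ∀ j, toR a + ((M : ℝ) * b j)⁻¹ • Pi.single j 1 ∈ N := by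
    refine eventually_all.2 fun j => ?_
    have h1 : Tendsto (fun M : ℕ => ((M : ℝ) * b j)⁻¹) atTop (𝓝 0) := by
      simp only [mul_inv]
      simpa using (tendsto_inv_atTop_nhds_zero_nat (𝕜 := ℝ)).mul_const ((b j : ℝ)⁻¹)
    have h2 : Tendsto (fun M : ℕ => toR a + ((M : ℝ) * b j)⁻¹ • (Pi.single j 1 : Fin n → ℝ))
        atTop (𝓝 (toR a + (0 : ℝ) • Pi.single j 1)) :=
      tendsto_const_nhds.add (h1.smul_const _)
    rw [zero_smul, add_zero] at h2
    exact h2 haN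
  obtain ⟨M, h1, h2, h3, hM⟩ := (e1.and (e2.and (e3.and (eventually_gt_atTop 0)))).exists
  have hMb : ((M : ℤ) • b) ⬝ᵥ a = 0 := by rw [smul_dotProduct, hba, smul_zero]
  refine ⟨tv a ((M : ℤ) • b), fun j => ?_, fun j => ?_, fun j => ?_⟩
  · have ht : (M : ℝ) * b j ≠ 0 := mul_ne_zero (by positivity) (by exact_mod_cast hbj j)
    have := hNs _ (h3 j) _ ht
    convert this using 1
    rw [← matR_mulVec_toR, tv_mulVec hMb, toR_dot, toR_single, smul_add, smul_smul,
      mul_inv_cancel₀ ht, one_smul, add_comm]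
    simp
  · rw [tv_coe hMb, vecMul_add, vecMul_one, vecMul_vecMulVec]
    have := h1 j
    simp only [Pi.add_apply, Pi.smul_apply, smul_eq_mul]
    convert this using 2
    ring
  · rw [tv_inv hMb, tv_coe (by rw [neg_dotProduct, hMb, neg_zero]), add_mulVec, one_mulVec,
      vecMulVec_mulVec, op_smul_eq_smul, neg_dotProduct, smul_dotProduct]
    have := h2 j
    simp only [Pi.add_apply, Pi.smul_apply, smul_eq_mul]
    convert this using 2
    ring

/-- The orthogonal projection of `V` to the hyperplane orthogonal to `x`. -/
noncomputable def orth (x V : Fin n → ℝ) : Fin n → ℝ := V - ((V ⬝ᵥ x) / (x ⬝ᵥ x)) • x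

theorem orth_dot {x : Fin n → ℝ} (hx : x ≠ 0) (V : Fin n → ℝ) : orth x V ⬝ᵥ x = 0 := by
  rw [orth, sub_dotProduct, smul_dotProduct, smul_eq_mul, div_mul_cancel₀ _ (self_dot_pos hx).ne',
    sub_self]

theorem orth_of_dot_eq_zero {x V : Fin n → ℝ} (h : V ⬝ᵥ x = 0) : orth x V = V := by
  rw [orth, h, zero_div, zero_smul, sub_zero]

theorem orth_smul {t : ℝ} (ht : t ≠ 0) (x V : Fin n → ℝ) : orth (t • x) V = orth x V := by
  simp only [orth, dotProduct_smul, smul_dotProduct, smul_smul, smul_eq_mul]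
  congr 2
  rcases eq_or_ne (x ⬝ᵥ x) 0 with h | h
  · simp [h]
  · field_simp

theorem continuousAt_orth {x : Fin n → ℝ} (hx : x ≠ 0) (V : Fin n → ℝ) :
    ContinuousAt (fun x => orth x V) x := by
  have c₁ : ContinuousAt (fun c : Fin n → ℝ => V ⬝ᵥ c) x := by fun_prop
  have c₂ : ContinuousAt (fun c : Fin n → ℝ => c ⬝ᵥ c) x := by fun_prop
  exact continuousAt_const.sub ((c₁.div c₂ (self_dot_pos hx).ne').smul continuousAt_id)

theorem coslide_mix_coslide {w f f₁ : Fin n → ℝ} (hfw : f ⬝ᵥ w = 0) (i : Fin n) (s : Fin 3) :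
    coslide w f (expo i s) (mix s (coslide w f (-expo i 0 : ℝ) f₁)
      (coslide w f (-expo i 2 : ℝ) f₁)) = (mix s 1 1 : ℝ) • f₁ := by
  ext l
  fin_cases s <;> simp [mix, coslide, hfw, expo, add_dotProduct] <;> ring

theorem mix_one_one_ne_zero (s : Fin 3) : (mix s 1 1 : ℝ) ≠ 0 := by
  fin_cases s <;> norm_num [mix]

/-- The vectors whose slides, together with suitable covectors, are in `U`. -/
def slideSet (w f f₁ : Fin n → ℝ) (U : Set ((Fin n → ℝ) × (Fin n → ℝ))) : Set (Fin n → ℝ) :=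
  {x | x ≠ 0 ∧ ∀ (i : Fin n) (s : Fin 3), (slide w f (expo i s) x,
    coslide w f (expo i s) (mix s (orth x (coslide w f (-expo i 0 : ℝ) f₁))
      (orth x (coslide w f (-expo i 2 : ℝ) f₁)))) ∈ U}

theorem slideSet_mem_nhds {w f w₁ f₁ : Fin n → ℝ} (hfw : f ⬝ᵥ w = 0) (hfw₁ : f ⬝ᵥ w₁ = 0)
    (hw₁ : w₁ ≠ 0) (hf₁ : w₁ ⬝ᵥ f₁ = 0) {U : Set ((Fin n → ℝ) × (Fin n → ℝ))} (hU : IsOpen U)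
    (hUs : ∀ p v, ∀ t : ℝ, t ≠ 0 → (p, v) ∈ U → (p, t • v) ∈ U) (hmem : (w₁, f₁) ∈ U) :
    slideSet w f f₁ U ∈ 𝓝 w₁ := by
  have hc : ∀ κ : ℝ, coslide w f κ f₁ ⬝ᵥ w₁ = 0 := fun κ => by
    simp [coslide, sub_dotProduct, hfw₁, dotProduct_comm f₁, hf₁]
  have h1 : ∀ (i : Fin n) s, ∀ᶠ x in 𝓝 w₁, (slide w f (expo i s) x,
      coslide w f (expo i s) (mix s (orth x (coslide w f (-expo i 0 : ℝ) f₁))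
        (orth x (coslide w f (-expo i 2 : ℝ) f₁)))) ∈ U := by
    intro i s
    have c₁ := continuousAt_orth hw₁ (coslide w f (-expo i 0 : ℝ) f₁)
    have c₂ := continuousAt_orth hw₁ (coslide w f (-expo i 2 : ℝ) f₁)
    have c₃ : Continuous fun q : (Fin n → ℝ) × (Fin n → ℝ) × (Fin n → ℝ) =>
        (slide w f (expo i s) q.1, coslide w f (expo i s) (mix s q.2.1 q.2.2)) := by
      have := continuous_mix s (continuous_fst.comp continuous_snd :
        Continuous fun q : (Fin n → ℝ) × (Fin n → ℝ) × (Fin n → ℝ) => q.2.1)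
        (continuous_snd.comp continuous_snd)
      unfold coslide slide
      fun_prop
    have c₄ := ContinuousAt.comp (x := w₁) (g := fun q : (Fin n → ℝ) × (Fin n → ℝ) × (Fin n → ℝ) =>
      (slide w f (expo i s) q.1, coslide w f (expo i s) (mix s q.2.1 q.2.2)))
      c₃.continuousAt (continuousAt_id.prodMk (c₁.prodMk c₂))
    refine c₄.preimage_mem_nhds (hU.mem_nhds ?_)
    simp only [Function.comp, id, orth_of_dot_eq_zero (hc _), coslide_mix_coslide hfw]
    rw [slide, hfw₁, zero_smul, smul_zero, add_zero]
    exact hUs _ _ _ (mix_one_one_ne_zero s) hmem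
  filter_upwards [eventually_all.2 fun i => eventually_all.2 (h1 i), isOpen_ne.mem_nhds hw₁] with
    x hx hx0 using ⟨hx0, hx⟩

theorem smul_mem_slideSet {w f f₁ : Fin n → ℝ} {U : Set ((Fin n → ℝ) × (Fin n → ℝ))}
    (hUs : ∀ p v, ∀ t : ℝ, t ≠ 0 → (p, v) ∈ U → (t • p, v) ∈ U) {x : Fin n → ℝ}
    (hx : x ∈ slideSet w f f₁ U) {t : ℝ} (ht : t ≠ 0) : t • x ∈ slideSet w f f₁ U := by
  refine ⟨smul_ne_zero ht hx.1, fun i s => ?_⟩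
  rw [orth_smul ht, orth_smul ht, slide_smul]
  exact hUs _ _ _ ht (hx.2 i s)

end Bases

section Generation

open Filter Topology

variable {n : ℕ} {R : Type*} [CommRing R]

theorem mulVec_slide {g g' : Matrix (Fin n) (Fin n) R} (h : g * g' = 1) (w f : Fin n → R) (κ : R)
    (x : Fin n → R) : g *ᵥ slide (g' *ᵥ w) (f ᵥ* g) κ x = slide w f κ (g *ᵥ x) := by
  rw [slide, slide, mulVec_add, mulVec_smul, mulVec_smul, mulVec_mulVec, h, one_mulVec,
    dotProduct_mulVec]

theorem coslide_vecMul {g g' : Matrix (Fin n) (Fin n) R} (h : g * g' = 1) (w f : Fin n → R) (κ : R)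
    (V : Fin n → R) : coslide (g' *ᵥ w) (f ᵥ* g) κ V ᵥ* g' = coslide w f κ (V ᵥ* g') := by
  rw [coslide, coslide, sub_vecMul, smul_vecMul, smul_vecMul, vecMul_vecMul, h, vecMul_one,
    dotProduct_mulVec]

theorem vecMul_dot_mulVec {g g' : Matrix (Fin n) (Fin n) R} (h : g' * g = 1) (V x : Fin n → R) :
    (V ᵥ* g') ⬝ᵥ (g *ᵥ x) = V ⬝ᵥ x := by
  rw [dotProduct_mulVec, vecMul_vecMul, h, vecMul_one]

theorem mix_vecMul (s : Fin 3) (A B : Fin n → R) (g : Matrix (Fin n) (Fin n) R) :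
    mix s (A ᵥ* g) (B ᵥ* g) = mix s A B ᵥ* g := by
  fin_cases s
  exacts [rfl, (add_vecMul _ _ _).symm, rfl]

theorem toR_vecMul (f : Fin n → ℤ) (g : SLZ n) : toR (f ᵥ* g.1) = toR f ᵥ* matR g := by
  ext i
  simp [vecMul, dotProduct, toR, matR_apply]

theorem slide_zero (w f x : Fin n → R) : slide w f 0 x = x := by
  rw [slide, zero_smul, add_zero]

theorem IsState.exists_generating (hn : 3 ≤ n) {e : Fin n → ℝ} {ρ : ℝ} (hρ : 0 ≤ ρ)
    {Q : Set (Datum n)} (hQ : IsState e ρ Q) {w f : Fin n → ℤ} (hw : w ≠ 0) (hf : f ≠ 0)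
    (hfw : f ⬝ᵥ w = 0) (hfe : toR f ∉ avoid e ρ) :
    ∃ Q', Q ⊆ Q' ∧ IsState e ρ Q' ∧
      Subgroup.closure (Datum.u '' Q') ⊔ Subgroup.zpowers (tv w f) = ⊤ := by
  obtain ⟨⟨w₁, f₁⟩, hmem, h0, hfw₁⟩ := hQ.good (toR f) (toR_ne_zero.2 hf) hfe
  simp only at h0 hfw₁
  have hU := isOpen_flags e ρ hQ.finite
  have hfwR : toR f ⬝ᵥ toR w = 0 := by rw [toR_dot, hfw, Int.cast_zero]
  have hN := slideSet_mem_nhds hfwR hfw₁ (ne_zero_of_mem_avoid hρ (mem_flags.1 hmem).1.1) h0 hU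
    (fun p v t ht h => by simpa using smul_mem_flags one_ne_zero ht h) hmem
  obtain ⟨γ, hγN, hγf, hγw⟩ := exists_basis_mem (by omega) hw hf hfw hN
    (fun x hx t ht => smul_mem_slideSet
      (fun p v t ht h => by simpa using smul_mem_flags ht one_ne_zero h) hx ht)
  have hγ : γ.1 * (γ⁻¹ : SLZ n).1 = 1 := congrArg Subtype.val (mul_inv_cancel γ)
  have hγ' : (γ⁻¹ : SLZ n).1 * γ.1 = 1 := congrArg Subtype.val (inv_mul_cancel γ)
  have hγR : matR γ * matR γ⁻¹ = 1 := by rw [← matR_mul, mul_inv_cancel, matR_one]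
  have hγR' : matR γ⁻¹ * matR γ = 1 := by rw [← matR_mul, inv_mul_cancel, matR_one]
  set w' := (γ⁻¹ : SLZ n).1 *ᵥ w with hw'
  set f' := f ᵥ* γ.1 with hf'
  have hw'R : toR w' = matR γ⁻¹ *ᵥ toR w := (matR_mulVec_toR _ _).symm
  have hf'R : toR f' = toR f ᵥ* matR γ := toR_vecMul _ _
  have hfw' : f' ⬝ᵥ w' = 0 := by
    rw [hw', hf', vecMul_dot_mulVec hγ, hfw]
  have hx : ∀ j, matR γ *ᵥ Pi.single j 1 = toR (γ.1 *ᵥ Pi.single j 1) := fun j => by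
    rw [← matR_mulVec_toR, toR_single]
  let A₀ : Fin 3 → Fin n → Fin n → Fin n → ℝ := fun s j i =>
    orth (toR (γ.1 *ᵥ Pi.single j 1)) (coslide (toR w) (toR f) (-expo i s : ℝ) f₁) ᵥ* matR γ
  have hA₀ : ∀ s j i, A₀ s j i j = 0 := fun s j i => by
    have := orth_dot (hγN j).1 (coslide (toR w) (toR f) (-expo i s : ℝ) f₁)
    rw [← hx, dotProduct_mulVec, dotProduct_single, mul_one] at this
    simpa only [A₀, ← hx] using this
  obtain ⟨A, B, hA, hB, hAB, hne⟩ := exists_generic_coslides hn (w := toR w') (f := toR f')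
    (fun j => Int.cast_ne_zero.2 (hγw j)) (fun j => Int.cast_ne_zero.2 (hγf j))
    (U := {q | (matR γ *ᵥ q.1, q.2 ᵥ* matR γ⁻¹) ∈ flags e ρ Q})
    (hU.preimage (by fun_prop)) (fun p v t ht h => by
      have := smul_mem_flags one_ne_zero ht h
      rwa [one_smul, ← smul_vecMul] at this)
    (hA₀ 0) (hA₀ 2) (fun j i s => by
      have := (hγN j).2 i s
      simp only [Set.mem_ofPred_eq]
      rw [hw'R, hf'R, mulVec_slide hγR, coslide_vecMul hγR, mix_vecMul, vecMul_vecMul, hγR,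
        vecMul_one, hx]
      exact this)
  let y : Fin n × Fin n × Fin 3 → Fin n → ℤ := fun a =>
    γ.1 *ᵥ slide w' f' (expo a.2.1 a.2.2) (Pi.single a.1 1)
  let v : Fin n × Fin n × Fin 3 → Fin n → ℤ := fun a =>
    coslide w' f' (expo a.2.1 a.2.2) (mix a.2.2 (A a.1 a.2.1) (B a.1 a.2.1)) ᵥ* (γ⁻¹ : SLZ n).1
  have hy : ∀ a, toR (y a) = matR γ *ᵥ
      slide (toR w') (toR f') (expo a.2.1 a.2.2) (Pi.single a.1 1) := fun a => by
    rw [← matR_mulVec_toR, toR_slide, toR_single]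
  have hv : ∀ a, toR (v a) = coslide (toR w') (toR f') (expo a.2.1 a.2.2)
      (mix a.2.2 (toR (A a.1 a.2.1)) (toR (B a.1 a.2.1))) ᵥ* matR γ⁻¹ := fun a => by
    rw [toR_vecMul, toR_coslide, toR_mix]
  have hfwR' : toR f' ⬝ᵥ toR w' = 0 := by rw [toR_dot, hfw', Int.cast_zero]
  have hvy : ∀ a b, toR (v a) ⬝ᵥ toR (y b) =
      mix a.2.2 (toR (A a.1 a.2.1)) (toR (B a.1 a.2.1)) ⬝ᵥ slide (toR w') (toR f')
        (expo b.2.1 b.2.2 - expo a.2.1 a.2.2 : ℝ) (Pi.single b.1 1) := fun a b => by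
    rw [hv, hy, vecMul_dot_mulVec hγR', coslide_dot_slide hfwR']
  obtain ⟨ε, hε, hext⟩ := hQ.exists_extension hρ (y := fun a => toR (y a))
    (v := fun a => toR (v a)) (fun a => by
      rw [hy, hv]
      exact hAB a.1 a.2.1 a.2.2) (fun a => by
      rw [dotProduct_comm, hvy, sub_self, slide_zero, mix_dot, dotProduct_single,
        dotProduct_single, toR, toR, hA, hB]
      generalize a.2.2 = s
      fin_cases s <;> simp [mix]) (fun a b hab => by
      rw [hvy]
      exact hne _ _ _ _ _ _ hab)
  let E : Fin n × Fin n × Fin 3 → Fin n → ℤ := fun a =>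
    if a.2.2 = 1 ∧ a.2.1 ≠ a.1 then Pi.single a.2.1 1 else 0
  have hE : ∀ a, E a a.1 = 0 := fun a => by
    by_cases h : a.2.2 = 1 ∧ a.2.1 ≠ a.1 <;> simp [E, h]
  choose N₀ hN₀ using fun a => exists_ping_tv hε (toR (v a))
    (toR (coslide w' f' (expo a.2.1 a.2.2) (E a) ᵥ* (γ⁻¹ : SLZ n).1))
  obtain ⟨N, hN⟩ : ∃ N : ℕ, ∀ a, N₀ a ≤ N :=
    (eventually_all.2 fun a =>
      tendsto_natCast_atTop_atTop.eventually_ge_atTop (N₀ a)).exists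
  let F : Fin n × Fin n × Fin 3 → Fin n → ℤ := fun a =>
    (N : ℤ) • mix a.2.2 (A a.1 a.2.1) (B a.1 a.2.1) + E a
  have hF : ∀ a, F a ⬝ᵥ Pi.single a.1 1 = 0 := fun a => by
    rw [add_dotProduct, smul_dotProduct, mix_dot, dotProduct_single, dotProduct_single,
      dotProduct_single, hA, hB, hE]
    generalize a.2.2 = s
    fin_cases s <;> simp [mix]
  have hF' : ∀ a, coslide w' f' (expo a.2.1 a.2.2) (F a) ⬝ᵥ
      slide w' f' (expo a.2.1 a.2.2) (Pi.single a.1 1) = 0 := fun a => by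
    rw [coslide_dot_slide hfw', sub_self, slide_zero, hF]
  let u : Fin n × Fin n × Fin 3 → SLZ n := fun a =>
    γ * (tv w' f' ^ expo a.2.1 a.2.2 * tv (Pi.single a.1 1) (F a) *
      (tv w' f' ^ expo a.2.1 a.2.2)⁻¹) * γ⁻¹
  have hu : ∀ a, u a = tv (y a) (coslide w' f' (expo a.2.1 a.2.2) (F a) ᵥ* (γ⁻¹ : SLZ n).1) := by
    intro a
    have h1 := tv_conj_tv hfw' (hF a) (expo a.2.1 a.2.2)
    change _ = tv (slide w' f' _ _) (coslide w' f' _ _) at h1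
    simp only [u]
    rw [h1, tv_conj _ (hF' a)]
  have hstate := hext u (fun a => by
    rw [hu]
    refine hN₀ a N (hN a) _ _ ?_ ?_
    · rw [vecMul_dot_mulVec hγ', hF']
    · rw [coslide_add, coslide_smul, add_vecMul, toR_add, smul_vecMul, toR_smul, Int.cast_natCast])
  refine ⟨_, Set.subset_union_left, hstate, ?_⟩
  set Q' := Q ∪ Set.range fun a => (⟨toR (y a), toR (v a), ε, u a⟩ : Datum n)
  set G := Subgroup.closure (Datum.u '' Q') ⊔ Subgroup.zpowers (tv w f)
  have hGu : ∀ a, u a ∈ G := fun a => Subgroup.mem_sup_left (Subgroup.subset_closure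
    ⟨⟨toR (y a), toR (v a), ε, u a⟩, .inr ⟨a, rfl⟩, rfl⟩)
  have hGg : γ * tv w' f' * γ⁻¹ ∈ G := by
    rw [tv_conj _ hfw', hw', hf', mulVec_mulVec, vecMul_vecMul, hγ, one_mulVec, vecMul_one]
    exact Subgroup.mem_sup_right (Subgroup.mem_zpowers _)
  set G' := G.comap (MulAut.conj γ).toMonoidHom
  have hG' : ∀ g, g ∈ G' ↔ γ * g * γ⁻¹ ∈ G := fun g => Iff.rfl
  have hg' : tv w' f' ∈ G' := (hG' _).2 hGg
  have hF'' : ∀ a, tv (Pi.single a.1 1) (F a) ∈ G' := fun a => by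
    have h1 := (hG' _).2 (hGu a)
    have h2 := G'.zpow_mem hg' (expo a.2.1 a.2.2)
    rw [Subgroup.mul_mem_cancel_right _ (G'.inv_mem h2), Subgroup.mul_mem_cancel_left _ h2] at h1
    exact h1
  have htop : G' = ⊤ := by
    refine eq_top_of_transvection_mem G' fun j i hij => ?_
    rw [← tv_single]
    have h1 := G'.mul_mem (G'.mul_mem (hF'' (j, i, 1)) (G'.inv_mem (hF'' (j, i, 0))))
      (G'.inv_mem (hF'' (j, i, 2)))
    have n0 := hF (j, i, 0)
    have n1 := hF (j, i, 1)
    have n2 := hF (j, i, 2)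
    have m0 : -F (j, i, 0) ⬝ᵥ Pi.single j 1 = 0 := by rw [neg_dotProduct, n0, neg_zero]
    have m2 : -F (j, i, 2) ⬝ᵥ Pi.single j 1 = 0 := by rw [neg_dotProduct, n2, neg_zero]
    rw [tv_inv n0, tv_inv n2, tv_mul n1 m0, tv_mul (by rw [add_dotProduct, n1, m0, add_zero]) m2]
      at h1
    convert h1 using 2
    ext l
    simp [F, E, mix, hij.symm]
    ring
  rw [eq_top_iff]
  intro g _
  have h1 : γ⁻¹ * g * γ ∈ G' := htop ▸ Subgroup.mem_top _
  rw [hG'] at h1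
  simpa [mul_assoc] using h1

end Generation

section Assembly

open Filter Topology

theorem exists_monotone_seq {D T : Type*} [Countable T] [Nonempty T] {S : Set D → Prop}
    {Done : T → Set D → Prop} (h0 : S ∅)
    (hstep : ∀ Q t, S Q → ∃ Q', Q ⊆ Q' ∧ S Q' ∧ Done t Q') :
    ∃ Qs : ℕ → Set D, Monotone Qs ∧ (∀ k, S (Qs k)) ∧ ∀ t, ∃ k, Done t (Qs k) := by
  obtain ⟨τ, hτ⟩ := exists_surjective_nat T
  choose next h1 h2 h3 using hstep
  let seq : ℕ → {Q // S Q} :=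
    Nat.rec ⟨∅, h0⟩ fun k Q => ⟨next Q.1 (τ k) Q.2, h2 Q.1 (τ k) Q.2⟩
  refine ⟨fun k => (seq k).1, monotone_nat_of_le_succ fun k => h1 _ (τ k) (seq k).2,
    fun k => (seq k).2, fun t => ?_⟩
  obtain ⟨k, rfl⟩ := hτ t
  exact ⟨k + 1, h3 _ (τ k) (seq k).2⟩

theorem exists_maximal_not_mem {G : Type*} [Group G] {H : Subgroup G} {g : G} (hg : g ∉ H) :
    ∃ Δ : Subgroup G, H ≤ Δ ∧ g ∉ Δ ∧ ∀ K, Δ < K → g ∈ K := by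
  obtain ⟨Δ, hH, hΔ⟩ := zorn_le_nonempty₀ {K : Subgroup G | g ∉ K} (fun c hc hch K hK =>
    ⟨sSup c, fun h => by
      obtain ⟨K', hK', hg'⟩ := (Subgroup.mem_sSup_of_directedOn ⟨K, hK⟩ hch.directedOn).1 h
      exact hc hK' hg', fun _ => le_sSup⟩) H hg
  refine ⟨Δ, hH, hΔ.1, fun K hK => ?_⟩
  by_contra h
  exact hK.not_ge (hΔ.2 h hK.le)

variable {n : ℕ}

theorem closure_ne_top {i₀ i₁ : Fin n} (hi : i₀ ≠ i₁) {ρ : ℝ} (hρ : 0 ≤ ρ)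
    {Qs : ℕ → Set (Datum n)} (hmono : Monotone Qs)
    (hQs : ∀ k, IsState (Pi.single i₀ 1) ρ (Qs k)) :
    Subgroup.closure (Datum.u '' ⋃ k, Qs k) ≠ ⊤ := by
  intro htop
  have hrange : Datum.u '' (⋃ k, Qs k) = Set.range fun d : (⋃ k, Qs k) => d.1.u := by
    rw [Set.image_eq_range]
  let e : Fin n → ℝ := Pi.single i₀ 1
  have hone : (Pi.single i₁ 1 : Fin n → ℤ) ⬝ᵥ Pi.single i₀ 1 = 0 := by simp [hi]
  have hone' : (-Pi.single i₁ 1 : Fin n → ℤ) ⬝ᵥ Pi.single i₀ 1 = 0 := by simp [hi]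
  set h : SLZ n := tv (Pi.single i₀ 1) (-Pi.single i₁ 1) * tv (Pi.single i₁ 1) (Pi.single i₀ 1)
  have hh : matR h *ᵥ e = Pi.single i₁ 1 := by
    have hneg : toR (-Pi.single i₁ 1 : Fin n → ℤ) = -Pi.single i₁ 1 := by
      rw [← toR_single]
      ext l
      simp [toR]
    rw [matR_mul_mulVec, tv_mulVec hone', tv_mulVec (by rw [dotProduct_comm]; exact hone), hneg,
      toR_single, toR_single]
    simp [e, hi]
  have hball : ∀ d ∈ ⋃ k, Qs k, ∀ x : Fin n → ℝ, ∀ t : ℝ, t ≠ 0 →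
      t • x ∈ Metric.closedBall d.y d.ε → x ∈ avoid e ρ := by
    intro d hd x t ht hx
    obtain ⟨k, hk⟩ := Set.mem_iUnion.1 hd
    have := smul_mem_avoid (inv_ne_zero ht) ((hQs k).base_y d hk hx)
    rwa [smul_smul, inv_mul_cancel₀ ht, one_smul] at this
  rcases ping_pong (u := fun d : (⋃ k, Qs k) => d.1.u) (φ := fun g x => matR g *ᵥ x)
    (fun x => by rw [matR_one, one_mulVec]) matR_mul_mulVec
    (A := fun d => {x | ∃ t : ℝ, t ≠ 0 ∧ t • x ∈ Metric.closedBall d.1.y d.1.ε})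
    (C := fun d => avoid d.1.v d.1.ε) (by
      rintro ⟨d, hd⟩ k hk x hx
      obtain ⟨m, hm⟩ := Set.mem_iUnion.1 hd
      exact (hQs m).ping d hm k hk x hx) (by
      rintro ⟨d, hd⟩ ⟨d', hd'⟩ hne x ⟨t, ht, hx⟩
      obtain ⟨m, hm⟩ := Set.mem_iUnion.1 hd
      obtain ⟨m', hm'⟩ := Set.mem_iUnion.1 hd'
      have := (hQs (max m m')).pair d (hmono (le_max_left _ _) hm) d'
        (hmono (le_max_right _ _) hm') (fun h => hne (Subtype.ext h)) hx
      have := smul_mem_avoid (inv_ne_zero ht) this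
      rwa [smul_smul, inv_mul_cancel₀ ht, one_smul] at this) (x₀ := e) (by
      rintro ⟨d, hd⟩
      obtain ⟨m, hm⟩ := Set.mem_iUnion.1 hd
      exact (hQs m).base_v d hm (Metric.mem_closedBall_self hρ))
    (h := h) (by rw [← hrange, htop]; exact Subgroup.mem_top _) with h1 | ⟨⟨d, hd⟩, t, ht, hx⟩
  · rw [h1, matR_one, one_mulVec] at hh
    have := congrFun hh i₀
    simp [e, hi] at this
  · simp only [hh] at hx
    exact hball d hd _ t ht hx e (Metric.mem_closedBall_self hρ) (by simp [e, hi.symm])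

theorem isOpen_rep_mem {C : Set (Fin n → ℝ)} (hC : IsOpen C)
    (hCs : ∀ x ∈ C, ∀ t : ℝ, t ≠ 0 → t • x ∈ C) : IsOpen {p : Proj n | p.rep ∈ C} := by
  have h : IsOpen ((fun v : {v : Fin n → ℝ // v ≠ 0} => Projectivization.mk ℝ v.1 v.2) ⁻¹'
      {p : Proj n | p.rep ∈ C}) := by
    have : (fun v : {v : Fin n → ℝ // v ≠ 0} => Projectivization.mk ℝ v.1 v.2) ⁻¹'
      {p : Proj n | p.rep ∈ C} = Subtype.val ⁻¹' C := by
      ext ⟨v, hv⟩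
      obtain ⟨a, ha⟩ := Projectivization.exists_smul_eq_mk_rep ℝ v hv
      simp only [Set.mem_preimage, Set.mem_ofPred_eq, ← ha]
      refine ⟨fun h => ?_, fun h => hCs _ h _ a.ne_zero⟩
      have := hCs _ h _ (a⁻¹).ne_zero
      change (a⁻¹ : ℝˣ) • a • v ∈ C at this
      rwa [inv_smul_smul] at this
    rw [this]
    exact hC.preimage continuous_subtype_val
  exact h

theorem rep_act_mem {C : Set (Fin n → ℝ)} (hCs : ∀ x ∈ C, ∀ t : ℝ, t ≠ 0 → t • x ∈ C) {g : SLZ n}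
    {p : Proj n} (h : (act g p).rep ∈ C) : matR g *ᵥ p.rep ∈ C := by
  have h1 : matR g *ᵥ p.rep ≠ 0 := fun h0 => p.rep_nonzero (by
    rw [← matR_inv_mulVec g p.rep, h0, mulVec_zero])
  have h2 : act g p = Projectivization.mk ℝ (matR g *ᵥ p.rep) h1 := by
    conv_lhs => rw [← p.mk_rep]
    exact Projectivization.map_mk _ (SpecialLinearGroup.toLin'
      (SpecialLinearGroup.map (Int.castRingHom ℝ) g)).injective _ p.rep_nonzero
  obtain ⟨a, ha⟩ := Projectivization.exists_smul_eq_mk_rep ℝ _ h1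
  rw [h2, ← ha] at h
  have := hCs _ h _ (a⁻¹).ne_zero
  change (a⁻¹ : ℝˣ) • a • (matR g *ᵥ p.rep) ∈ C at this
  rwa [inv_smul_smul] at this

theorem not_mem_avoid_of_orth {i₀ : Fin n} {ρ : ℝ} {v V : Fin n → ℝ}
    (hv : ‖v - v i₀ • Pi.single i₀ 1‖ < ρ * |v i₀|) (h : V ⬝ᵥ v = 0) :
    V ∉ avoid (Pi.single i₀ 1) ρ := by
  intro hV
  have h0 : v i₀ ≠ 0 := fun h0 => by
    rw [h0, abs_zero, mul_zero] at hv
    exact (norm_nonneg _).not_gt hv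
  refine hV ((v i₀)⁻¹ • v) ?_ (by rw [smul_dotProduct, dotProduct_comm, h, smul_zero])
  have : (v i₀)⁻¹ • v - Pi.single i₀ 1 = (v i₀)⁻¹ • (v - v i₀ • Pi.single i₀ 1) := by
    rw [smul_sub, smul_smul, inv_mul_cancel₀ h0, one_smul]
  rw [mem_closedBall_iff_norm, this, norm_smul, norm_inv, Real.norm_eq_abs,
    inv_mul_le_iff₀ (abs_pos.2 h0), mul_comm]
  exact hv.le

theorem not_mem_avoid_of_lt {i₀ i₁ : Fin n} {ρ : ℝ} {v : Fin n → ℝ}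
    (hv : |v i₀| < ρ * |v i₁|) : v ∉ avoid (Pi.single i₀ 1) ρ := by
  intro hV
  have h1 : v i₁ ≠ 0 := fun h1 => by
    rw [h1, abs_zero, mul_zero] at hv
    exact (abs_nonneg _).not_gt hv
  refine hV (Pi.single i₀ 1 - Pi.single i₁ (v i₀ / v i₁)) ?_ ?_
  · rw [mem_closedBall_iff_norm, sub_sub_cancel_left, norm_neg, Pi.norm_single, Real.norm_eq_abs,
      abs_div, div_le_iff₀ (abs_pos.2 h1)]
    exact hv.le
  · rw [sub_dotProduct, single_dotProduct, single_dotProduct, div_mul_cancel₀ _ h1, one_mul,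
      sub_self]

theorem not_dense_orbit {i₀ i₁ : Fin n} (hi : i₀ ≠ i₁) {ρ : ℝ} (hρ : 0 < ρ)
    {Δ : Subgroup (SLZ n)} (hΔ : Δ ≠ ⊤)
    (hfix : ∀ x : Fin n → ℤ, x ≠ 0 → toR x ∉ avoid (Pi.single i₀ 1) ρ →
      ∃ P F : Fin n → ℤ, F ⬝ᵥ P = 0 ∧ F ⬝ᵥ x = 0 ∧ P ≠ 0 ∧ F ≠ 0 ∧ tv P F ∈ Δ)
    (hgen : ∀ w f : Fin n → ℤ, w ≠ 0 → f ≠ 0 → f ⬝ᵥ w = 0 →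
      toR f ∉ avoid (Pi.single i₀ 1) ρ → tv w f ∈ Δ → Δ = ⊤) (x : Proj n) :
    ¬ Dense {y : Proj n | ∃ g ∈ Δ, y = act g x} := by
  intro hd
  let C₁ : Set (Fin n → ℝ) := {v | ‖v - v i₀ • Pi.single i₀ 1‖ < ρ * |v i₀|}
  let C₂ : Set (Fin n → ℝ) := {v | |v i₀| < ρ * |v i₁|}
  have hC₁ : IsOpen C₁ := isOpen_lt (by fun_prop) (by fun_prop)
  have hC₂ : IsOpen C₂ := isOpen_lt (by fun_prop) (by fun_prop)
  have hC₁s : ∀ v ∈ C₁, ∀ t : ℝ, t ≠ 0 → t • v ∈ C₁ := fun v hv t ht => by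
    have h1 : t • v - (t • v) i₀ • Pi.single i₀ 1 = t • (v - v i₀ • Pi.single i₀ 1) := by
      rw [Pi.smul_apply, smul_sub, smul_eq_mul, mul_smul]
    change ‖t • v - (t • v) i₀ • Pi.single i₀ 1‖ < ρ * |(t • v) i₀|
    rw [h1, norm_smul, Pi.smul_apply, smul_eq_mul, abs_mul, Real.norm_eq_abs, mul_left_comm]
    exact mul_lt_mul_of_pos_left hv (abs_pos.2 ht)
  have hC₂s : ∀ v ∈ C₂, ∀ t : ℝ, t ≠ 0 → t • v ∈ C₂ := fun v hv t ht => by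
    change |(t • v) i₀| < ρ * |(t • v) i₁|
    rw [Pi.smul_apply, Pi.smul_apply, smul_eq_mul, smul_eq_mul, abs_mul, abs_mul, mul_left_comm]
    exact mul_lt_mul_of_pos_left hv (abs_pos.2 ht)
  have key : ∀ C : Set (Fin n → ℝ), IsOpen C → (∀ v ∈ C, ∀ t : ℝ, t ≠ 0 → t • v ∈ C) →
      ∀ v ∈ C, v ≠ 0 → ∃ g ∈ Δ, matR g *ᵥ x.rep ∈ C := by
    intro C hC hCs v hv hv0
    obtain ⟨a, ha⟩ := Projectivization.exists_smul_eq_mk_rep ℝ v hv0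
    obtain ⟨y, hy, g, hg, rfl⟩ := hd.inter_open_nonempty _ (isOpen_rep_mem hC hCs)
      ⟨Projectivization.mk ℝ v hv0, by
        rw [Set.mem_ofPred_eq, ← ha]
        exact hCs _ hv _ a.ne_zero⟩
    exact ⟨g, hg, rep_act_mem hCs hy⟩
  obtain ⟨g₁, hg₁, h₁⟩ := key C₁ hC₁ hC₁s (Pi.single i₀ 1) (by simpa [C₁] using hρ) (by simp)
  obtain ⟨g₂, hg₂, h₂⟩ := key C₂ hC₂ hC₂s (Pi.single i₁ 1) (by simpa [C₂, hi] using hρ) (by simp)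
  set δ := g₂ * g₁⁻¹
  have hδ : δ ∈ Δ := Δ.mul_mem hg₂ (Δ.inv_mem hg₁)
  have hO : IsOpen {z | z ∈ C₂ ∧ matR δ⁻¹ *ᵥ z ∈ C₁} :=
    hC₂.inter (hC₁.preimage (by fun_prop))
  obtain ⟨L, X, hL, hX, -⟩ := exists_int_smul_mem (B := Empty) (hO.mem_nhds
    (show matR g₂ *ᵥ x.rep ∈ _ from ⟨h₂, by
      rw [mulVec_mulVec, ← matR_mul]
      simpa [δ] using h₁⟩)) nofun nofun
  have hL' : (L : ℝ) ≠ 0 := by positivity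
  have hX₂ : toR X ∈ C₂ := by
    have := hC₂s _ hX.1 L hL'
    rwa [smul_smul, mul_inv_cancel₀ hL', one_smul] at this
  have hX₁ : toR ((δ⁻¹ : SLZ n).1 *ᵥ X) ∈ C₁ := by
    have := hC₁s _ hX.2 L hL'
    rw [mulVec_smul, smul_smul, mul_inv_cancel₀ hL', one_smul] at this
    rwa [← matR_mulVec_toR]
  have hX0 : X ≠ 0 := by
    rintro rfl
    simp [C₂, toR] at hX₂
  obtain ⟨P, F, hFP, hFX, hP, hF, hu⟩ := hfix X hX0 (not_mem_avoid_of_lt hX₂)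
  have hδ1 : (δ : SLZ n).1 * (δ⁻¹ : SLZ n).1 = 1 := congrArg Subtype.val (mul_inv_cancel δ)
  have hconj := tv_conj δ⁻¹ hFP
  rw [inv_inv] at hconj
  refine hΔ (hgen ((δ⁻¹ : SLZ n).1 *ᵥ P) (F ᵥ* δ.1) (fun h => hP ?_) (fun h => hF ?_) ?_ ?_ ?_)
  · rw [← one_mulVec P, ← hδ1, ← mulVec_mulVec, h, mulVec_zero]
  · rw [← vecMul_one F, ← hδ1, ← vecMul_vecMul, h, zero_vecMul]
  · rw [vecMul_dot_mulVec hδ1, hFP]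
  · refine not_mem_avoid_of_orth hX₁ ?_
    rw [toR_dot, vecMul_dot_mulVec hδ1, hFX, Int.cast_zero]
  · rw [← hconj]
    exact Δ.mul_mem (Δ.mul_mem (Δ.inv_mem hδ) hu) hδ

end Assembly

/-- Theorem 2 (Gelander–Meiri): for `n ≥ 3` there is a maximal subgroup `Δ` of
`SL(n,ℤ)` none of whose orbits on `ℙ^{n-1}(ℝ)` is dense. -/
theorem exists_maximal_subgroup_no_dense_orbit (n : ℕ) (hn : 3 ≤ n) :
    ∃ Δ : Subgroup (SLZ n), IsMaxSubgroup Δ ∧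
      ∀ x : Proj n, ¬ Dense {y : Proj n | ∃ g ∈ Δ, y = act g x} := by
  let i₀ : Fin n := ⟨0, by omega⟩
  let i₁ : Fin n := ⟨1, by omega⟩
  have hi : i₀ ≠ i₁ := by simp [i₀, i₁]
  let ρ : ℝ := 1 / (8 * n)
  have hρ : 0 < ρ := by
    have : 0 < n := by omega
    positivity
  obtain ⟨Qs, hmono, hQs, hdone⟩ := exists_monotone_seq
    (T := (Fin n → ℤ) ⊕ (Fin n → ℤ) × (Fin n → ℤ)) (S := IsState (Pi.single i₀ 1) ρ)
    (Done := fun t Q => t.elim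
      (fun x => x ≠ 0 → toR x ∉ avoid (Pi.single i₀ 1) ρ →
        ∃ P F : Fin n → ℤ, F ⬝ᵥ P = 0 ∧ F ⬝ᵥ x = 0 ∧ P ≠ 0 ∧ F ≠ 0 ∧ ∃ d ∈ Q, d.u = tv P F)
      (fun q => q.1 ≠ 0 → q.2 ≠ 0 → q.2 ⬝ᵥ q.1 = 0 → toR q.2 ∉ avoid (Pi.single i₀ 1) ρ →
        Subgroup.closure (Datum.u '' Q) ⊔ Subgroup.zpowers (tv q.1 q.2) = ⊤))
    (isState_empty hn i₀) (by
      rintro Q (x | ⟨w, f⟩) hQ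
      · by_cases h : x ≠ 0 ∧ toR x ∉ avoid (Pi.single i₀ 1) ρ
        · obtain ⟨Q', h1, h2, h3⟩ := hQ.exists_fixing hρ.le h.1 h.2
          exact ⟨Q', h1, h2, fun _ _ => h3⟩
        · exact ⟨Q, subset_rfl, hQ, fun h1 h2 => absurd ⟨h1, h2⟩ h⟩
      · by_cases h : w ≠ 0 ∧ f ≠ 0 ∧ f ⬝ᵥ w = 0 ∧ toR f ∉ avoid (Pi.single i₀ 1) ρ
        · obtain ⟨Q', h1, h2, h3⟩ := hQ.exists_generating hn hρ.le h.1 h.2.1 h.2.2.1 h.2.2.2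
          exact ⟨Q', h1, h2, fun _ _ _ _ => h3⟩
        · exact ⟨Q, subset_rfl, hQ, fun h1 h2 h3 h4 => absurd ⟨h1, h2, h3, h4⟩ h⟩)
  set H := Subgroup.closure (Datum.u '' ⋃ k, Qs k)
  have hH : H ≠ ⊤ := closure_ne_top hi hρ.le hmono hQs
  have hQH : ∀ k, Subgroup.closure (Datum.u '' Qs k) ≤ H := fun k =>
    Subgroup.closure_mono (Set.image_mono (Set.subset_iUnion Qs k))
  have hgen : ∀ w f : Fin n → ℤ, w ≠ 0 → f ≠ 0 → f ⬝ᵥ w = 0 →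
      toR f ∉ avoid (Pi.single i₀ 1) ρ → ∀ K : Subgroup (SLZ n), H ≤ K → tv w f ∈ K → K = ⊤ := by
    intro w f hw hf hfw hfe K hK hg
    obtain ⟨k, hk⟩ := hdone (.inr (w, f))
    rw [eq_top_iff, ← hk hw hf hfw hfe]
    exact sup_le ((hQH k).trans hK) (by rwa [Subgroup.zpowers_le])
  have hgen₀ := hgen (Pi.single i₀ 1) (Pi.single i₁ 1) (by simp) (by simp) (by simp [hi])
    (not_mem_avoid_of_lt (i₁ := i₁) (by simpa [toR, hi] using hρ))
  obtain ⟨Δ, hHΔ, hgΔ, hmax⟩ := exists_maximal_not_mem (fun h => hH (hgen₀ H le_rfl h))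
  have hΔ : Δ ≠ ⊤ := fun h => hgΔ (h ▸ Subgroup.mem_top _)
  refine ⟨Δ, ⟨hΔ, fun K hK => hgen₀ K (hHΔ.trans hK.le) (hmax K hK)⟩,
    not_dense_orbit hi hρ hΔ (fun x hx hxe => ?_)
      (fun w f hw hf hfw hfe h => hgen w f hw hf hfw hfe Δ hHΔ h)⟩
  obtain ⟨k, hk⟩ := hdone (.inl x)
  obtain ⟨P, F, h1, h2, h3, h4, d, hd, hdu⟩ := hk hx hxe
  exact ⟨P, F, h1, h2, h3, h4, hdu ▸
    hHΔ (Subgroup.subset_closure ⟨d, Set.mem_iUnion.2 ⟨k, hd⟩, rfl⟩)⟩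
end
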